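/- Suppose the weak cut distance δ_□(W_{Q_n}, W) → 0 for some W ∈ 𝒲, the tail assumption (T) holds for some p ∈ [1,∞], and there exists q ∈ (1,∞] with 1/p + 1/q ≤ 1 such that limsup_{n→∞} ‖W_{Q_n}‖_{qΔ} < ∞. Then both U_n(X) and V_n(X) satisfy a large deviation principle at speed n with the good rate function I₀(t) = inf{ D(ν|ρ) : ν ∈ 𝒯ℳ, D(ν|ρ) < ∞, T_{W,φ}(ν) = t }. -/

import Mathlib

open MeasureTheory Filter Set
open scoped ENNReal NNReal

noncomputable section

/-- The uniform probability measure on `[0,1]`. -/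
def unif01 : Measure ℝ := volume.restrict (Set.Icc 0 1)

instance : IsProbabilityMeasure unif01 :=
  ⟨by rw [unif01, Measure.restrict_apply_univ, Real.volume_Icc]; norm_num⟩

/-- The `L^r` norm (`r : ℝ≥0∞`) of a kernel, viewed as a function on `[0,1]²`. -/
def kerNorm (W : ℝ → ℝ → ℝ) (r : ℝ≥0∞) : ℝ≥0∞ :=
  eLpNorm (fun z : ℝ × ℝ => W z.1 z.2) r (unif01.prod unif01)

/-- The (strong) cut distance `d_□` between two kernels on `[0,1]²`. -/
def cutDist (W₁ W₂ : ℝ → ℝ → ℝ) : ℝ :=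
  ⨆ S : {S : Set ℝ // MeasurableSet S}, ⨆ T : {T : Set ℝ // MeasurableSet T},
    |∫ x in Set.Icc (0:ℝ) 1 ∩ S.1, ∫ y in Set.Icc (0:ℝ) 1 ∩ T.1, (W₁ x y - W₂ x y)|

/-- A Lebesgue-measure-preserving bijection of `[0,1]`. -/
def MPB (σ : ℝ → ℝ) : Prop :=
  Set.BijOn σ (Set.Icc 0 1) (Set.Icc 0 1) ∧ MeasurePreserving σ unif01 unif01

/-- The weak cut distance `δ_□`. -/
def weakCutDist (W₁ W₂ : ℝ → ℝ → ℝ) : ℝ :=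
  ⨅ σ : {σ : ℝ → ℝ // MPB σ}, cutDist (fun x y => W₁ (σ.1 x) (σ.1 y)) W₂

/-- The step kernel `W_{Q_n}` associated to an `n × n` matrix `Q`:
it equals `Q i j` when `⌈n x⌉ = i, ⌈n y⌉ = j`. -/
def stepKernel (n : ℕ) (Q : Fin n → Fin n → ℝ) : ℝ → ℝ → ℝ := fun x y =>
  ∑ i : Fin n, ∑ j : Fin n,
    if x ∈ Set.Ioc (((i : ℕ) : ℝ)/n) ((((i : ℕ) : ℝ)+1)/n) ∧
       y ∈ Set.Ioc (((j : ℕ) : ℝ)/n) ((((j : ℕ) : ℝ)+1)/n)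
    then Q i j else 0

/-- Product over the edges of `H` (each edge counted once) of `f a b`. -/
def edgeProd {v : ℕ} (G : SimpleGraph (Fin v)) [DecidableRel G.Adj]
    (f : Fin v → Fin v → ℝ) : ℝ :=
  ∏ p ∈ Finset.univ.filter (fun p : Fin v × Fin v => G.Adj p.1 p.2 ∧ p.1 < p.2), f p.1 p.2

/-- The number of edges `|E(H)|`. -/
def edgeCard {v : ℕ} (G : SimpleGraph (Fin v)) [DecidableRel G.Adj] : ℕ :=
  (Finset.univ.filter (fun p : Fin v × Fin v => G.Adj p.1 p.2 ∧ p.1 < p.2)).card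

/-- The inhomogeneous U-statistic `U_n(X)` (sum over distinct indices). -/
def Ustat {X : Type*} {v : ℕ} (G : SimpleGraph (Fin v)) [DecidableRel G.Adj]
    (φ : (Fin v → X) → ℝ) (n : ℕ) (Q : Fin n → Fin n → ℝ) (x : Fin n → X) : ℝ :=
  (∑ i ∈ Finset.univ.filter (fun i : Fin v → Fin n => Function.Injective i),
      φ (x ∘ i) * edgeProd G (fun a b => Q (i a) (i b))) / (n : ℝ) ^ v

/-- The inhomogeneous V-statistic `V_n(X)` (sum over all indices). -/
def Vstat {X : Type*} {v : ℕ} (G : SimpleGraph (Fin v)) [DecidableRel G.Adj]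
    (φ : (Fin v → X) → ℝ) (n : ℕ) (Q : Fin n → Fin n → ℝ) (x : Fin n → X) : ℝ :=
  (∑ i : Fin v → Fin n, φ (x ∘ i) * edgeProd G (fun a b => Q (i a) (i b))) / (n : ℝ) ^ v

open Classical in
/-- Kullback-Leibler divergence `D(ν | ρ) ∈ [0,∞]`. -/
def KLdiv {α : Type*} [MeasurableSpace α] (ν ρ : Measure α) : ℝ≥0∞ :=
  if ν ≪ ρ ∧ Integrable (llr ν ρ) ν then ENNReal.ofReal (∫ a, llr ν ρ a ∂ν) else ⊤

open Classical in
/-- `ν` itself if it is a probability measure, junk value `0` otherwise. -/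
def probOr {α : Type*} [MeasurableSpace α] (ν : Measure α) : Measure α :=
  if IsProbabilityMeasure ν then ν else 0

instance {α : Type*} [MeasurableSpace α] (ν : Measure α) : SigmaFinite (probOr ν) := by
  unfold probOr
  split_ifs with h
  · haveI := h; infer_instance
  · infer_instance

/-- `v`-fold product of a (probability) measure. -/
def piProb {α : Type*} [MeasurableSpace α] (v : ℕ) (ν : Measure α) : Measure (Fin v → α) :=
  Measure.pi fun _ => probOr ν

/-- The functional `T_{W,φ}(ν) = E[φ(B₁,…,B_v) ∏_{(a,b) ∈ E(H)} W(A_a,A_b)]`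
for `(A_a,B_a)` i.i.d. with law `ν`. -/
def TWphi {X : Type*} [MeasurableSpace X] {v : ℕ} (G : SimpleGraph (Fin v))
    [DecidableRel G.Adj] (W : ℝ → ℝ → ℝ) (φ : (Fin v → X) → ℝ)
    (ν : Measure (ℝ × X)) : ℝ :=
  ∫ z : Fin v → ℝ × X,
    φ (fun a => (z a).2) * edgeProd G (fun a b => W (z a).1 (z b).1) ∂(piProb v ν)

/-- Membership in `𝒯ℳ`: probability measures on `[0,1] × 𝒳` whose first marginal
is uniform on `[0,1]`. -/
def inTM {X : Type*} [MeasurableSpace X] (ν : Measure (ℝ × X)) : Prop :=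
  IsProbabilityMeasure ν ∧ ν.map Prod.fst = unif01

/-- The rate function `I₀(t) = inf { D(ν|ρ) : ν ∈ 𝒯ℳ, D(ν|ρ) < ∞, T_{W,φ}(ν) = t }`. -/
def rate0 {X : Type*} [MeasurableSpace X] {v : ℕ} (G : SimpleGraph (Fin v))
    [DecidableRel G.Adj] (W : ℝ → ℝ → ℝ) (φ : (Fin v → X) → ℝ) (μ : Measure X)
    (t : ℝ) : ℝ≥0∞ :=
  ⨅ ν : {ν : Measure (ℝ × X) //
      inTM ν ∧ KLdiv ν (unif01.prod μ) ≠ ⊤ ∧ TWphi G W φ ν = t},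
    KLdiv ν.1 (unif01.prod μ)

/-- Tail assumption (T): `E_μ[e^{λ ψ(X)^p}] < ∞` for all `λ > 0`; for `p = ∞`
it means `ψ` is bounded. -/
def TailCond {X : Type*} [MeasurableSpace X] (μ : Measure X) (ψ : X → ℝ)
    (p : ℝ≥0∞) : Prop :=
  if p = ⊤ then ∃ C : ℝ, ∀ x, ψ x ≤ C
  else ∀ lam : ℝ, 0 < lam →
    ∫⁻ x, ENNReal.ofReal (Real.exp (lam * ψ x ^ p.toReal)) ∂μ < ⊤

/-- A sequence of random elements `T n` defined on probability spaces `(Ω n, P n)`,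
taking values in a topological space `E`, satisfies a large deviation principle at
speed `n` with good rate function `I`. -/
def SatisfiesLDP {E : Type*} [TopologicalSpace E] {Ω : ℕ → Type*}
    [∀ n, MeasurableSpace (Ω n)] (P : ∀ n, Measure (Ω n)) (T : ∀ n, Ω n → E)
    (I : E → ℝ≥0∞) : Prop :=
  (∀ c : ℝ≥0∞, c ≠ ⊤ → IsCompact {x | I x ≤ c}) ∧
  ∀ F : Set E, MeasurableSet[borel E] F →
    (-(⨅ x ∈ interior F, (I x : EReal)) ≤
      Filter.atTop.liminf fun n : ℕ =>
        (((n : ℝ)⁻¹ : ℝ) : EReal) * ENNReal.log (P n {ω | T n ω ∈ F})) ∧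
    (Filter.atTop.limsup (fun n : ℕ =>
        (((n : ℝ)⁻¹ : ℝ) : EReal) * ENNReal.log (P n {ω | T n ω ∈ F})) ≤
      -(⨅ x ∈ closure F, (I x : EReal)))

end

namespace LDPaux

/-- Hölder with at most `D` factors on a probability space. -/
theorem holder_le {α ι : Type*} [MeasurableSpace α] (μ : Measure α) [IsProbabilityMeasure μ]
    (s : Finset ι) (D : ℕ) (hD : 1 ≤ D) (hs : s.card ≤ D) (f : ι → α → ℝ≥0∞)
    (hf : ∀ i ∈ s, Measurable (f i)) :
    ∫⁻ a, ∏ i ∈ s, (f i a) ^ (1/(D:ℝ)) ∂μ ≤ ∏ i ∈ s, (∫⁻ a, f i a ∂μ) ^ (1/(D:ℝ)) := by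
  have hD0 : (0:ℝ) < D := by exact_mod_cast hD
  have h := ENNReal.lintegral_mul_prod_norm_pow_le (μ := μ) s (g := fun _ => 1) (f := f)
    aemeasurable_const (fun i hi => (hf i hi).aemeasurable) (1 - s.card / (D:ℝ))
    (p := fun _ => 1/(D:ℝ)) (by simp; field_simp; ring)
    (by rw [sub_nonneg, div_le_one hD0]; exact_mod_cast hs) (fun _ _ => by positivity)
  simpa using h

theorem finner {ι J : Type*} [Fintype J] [DecidableEq J] {Y : J → Type*}
    [∀ j, MeasurableSpace (Y j)] (μ : ∀ j, Measure (Y j)) [∀ j, IsProbabilityMeasure (μ j)]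
    (I : Finset ι) (S : ι → Finset J) (D : ℕ) (hD : 1 ≤ D)
    (hdeg : ∀ j, (I.filter (fun i => j ∈ S i)).card ≤ D)
    (g : ι → (∀ j, Y j) → ℝ≥0∞) (hg : ∀ i ∈ I, Measurable (g i))
    (hdep : ∀ i ∈ I, ∀ j, j ∉ S i → ∀ z y, g i (Function.update z j y) = g i z) :
    ∫⁻ z, ∏ i ∈ I, g i z ∂Measure.pi μ ≤
      ∏ i ∈ I, (∫⁻ z, g i z ^ (D:ℝ) ∂Measure.pi μ) ^ (1/(D:ℝ)) := by
  classical
  have hD0 : (0:ℝ) < D := by exact_mod_cast hD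
  have hgm : ∀ i ∈ I, Measurable (fun z => g i z ^ (D:ℝ)) := fun i hi => (hg i hi).pow_const _
  have key : ∀ s : Finset J, ∀ z,
      (∫⋯∫⁻_s, (fun z => ∏ i ∈ I, g i z) ∂μ) z ≤
        ∏ i ∈ I, ((∫⋯∫⁻_s, (fun z => g i z ^ (D:ℝ)) ∂μ) z) ^ (1/(D:ℝ)) := by
    intro s
    induction s using Finset.induction_on with
    | empty =>
      intro z
      simp only [lmarginal_empty]
      apply le_of_eq
      refine Finset.prod_congr rfl fun i _ => ?_
      rw [← ENNReal.rpow_mul, mul_one_div_cancel hD0.ne', ENNReal.rpow_one]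
    | insert j s hj ih =>
      intro z
      rw [lmarginal_insert _ (Finset.measurable_prod _ hg) hj]
      calc ∫⁻ y, (∫⋯∫⁻_s, (fun z => ∏ i ∈ I, g i z) ∂μ) (Function.update z j y) ∂μ j
          ≤ ∫⁻ y, ∏ i ∈ I, ((∫⋯∫⁻_s, (fun z => g i z ^ (D:ℝ)) ∂μ) (Function.update z j y))
              ^ (1/(D:ℝ)) ∂μ j := lintegral_mono fun y => ih _
        _ = ∫⁻ y, (∏ i ∈ I.filter (fun i => j ∈ S i),
              ((∫⋯∫⁻_s, (fun z => g i z ^ (D:ℝ)) ∂μ) (Function.update z j y)) ^ (1/(D:ℝ))) *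
              (∏ i ∈ I.filter (fun i => ¬ j ∈ S i),
              ((∫⋯∫⁻_s, (fun z => g i z ^ (D:ℝ)) ∂μ) z) ^ (1/(D:ℝ))) ∂μ j := by
            refine lintegral_congr fun y => ?_
            rw [← Finset.prod_filter_mul_prod_filter_not I (fun i => j ∈ S i)]
            congr 1
            refine Finset.prod_congr rfl fun i hi => ?_
            rw [Finset.mem_filter] at hi
            congr 1
            rw [lmarginal_update_of_notMem (hgm i hi.1) hj]
            congr 1
            funext w
            simp only [Function.comp]
            rw [hdep i hi.1 j hi.2]
        _ = (∫⁻ y, (∏ i ∈ I.filter (fun i => j ∈ S i),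
              ((∫⋯∫⁻_s, (fun z => g i z ^ (D:ℝ)) ∂μ) (Function.update z j y)) ^ (1/(D:ℝ))) ∂μ j) *
              (∏ i ∈ I.filter (fun i => ¬ j ∈ S i),
              ((∫⋯∫⁻_s, (fun z => g i z ^ (D:ℝ)) ∂μ) z) ^ (1/(D:ℝ))) := by
            rw [lintegral_mul_const]
            refine Finset.measurable_prod _ fun i hi => ?_
            exact (((hgm i (Finset.mem_filter.1 hi).1).lmarginal μ).comp
              (measurable_update z)).pow_const _
        _ ≤ (∏ i ∈ I.filter (fun i => j ∈ S i),
              ((∫⋯∫⁻_(insert j s), (fun z => g i z ^ (D:ℝ)) ∂μ) z) ^ (1/(D:ℝ))) *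
              (∏ i ∈ I.filter (fun i => ¬ j ∈ S i),
              ((∫⋯∫⁻_(insert j s), (fun z => g i z ^ (D:ℝ)) ∂μ) z) ^ (1/(D:ℝ))) := by
            refine mul_le_mul' ?_ (le_of_eq ?_)
            · refine (holder_le (μ j) _ D hD (hdeg j) (fun i y =>
                (∫⋯∫⁻_s, (fun z => g i z ^ (D:ℝ)) ∂μ) (Function.update z j y)) ?_).trans
                (le_of_eq ?_)
              · intro i hi
                exact ((hgm i (Finset.mem_filter.1 hi).1).lmarginal μ).comp (measurable_update z)
              · refine Finset.prod_congr rfl fun i hi => ?_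
                rw [lmarginal_insert _ (hgm i (Finset.mem_filter.1 hi).1) hj]
            · refine Finset.prod_congr rfl fun i hi => ?_
              rw [Finset.mem_filter] at hi
              congr 1
              rw [lmarginal_insert _ (hgm i hi.1) hj]
              have : ∀ y, (∫⋯∫⁻_s, (fun z => g i z ^ (D:ℝ)) ∂μ) (Function.update z j y)
                  = (∫⋯∫⁻_s, (fun z => g i z ^ (D:ℝ)) ∂μ) z := by
                intro y
                rw [lmarginal_update_of_notMem (hgm i hi.1) hj]
                congr 1
                funext w
                simp only [Function.comp]
                rw [hdep i hi.1 j hi.2]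
              simp only [this, lintegral_const, measure_univ, mul_one]
        _ = _ := Finset.prod_filter_mul_prod_filter_not I (fun i => j ∈ S i) _
  by_cases hne : Nonempty (∀ j, Y j)
  · obtain ⟨z0⟩ := hne
    have h := key Finset.univ z0
    simpa only [← lintegral_eq_lmarginal_univ] using h
  · rw [not_nonempty_iff] at hne
    have := (IsProbabilityMeasure.ne_zero (Measure.pi μ))
    exact absurd (Measure.eq_zero_of_isEmpty _) this

end LDPaux

namespace LDPaux

theorem enorm_finset_prod {ι : Type*} (s : Finset ι) (f : ι → ℝ) :
    ‖∏ i ∈ s, f i‖ₑ = ∏ i ∈ s, ‖f i‖ₑ := by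
  classical
  induction s using Finset.induction_on with
  | empty => simp
  | insert a s ha ih => rw [Finset.prod_insert ha, Finset.prod_insert ha, enorm_mul, ih]

theorem pair_mp {v : ℕ} {Ω : Type*} [MeasurableSpace Ω] (ν : Measure Ω) [IsProbabilityMeasure ν]
    (a b : Fin v) (hab : a ≠ b) :
    MeasurePreserving (fun z : Fin v → Ω => (z a, z b)) (Measure.pi fun _ => ν) (ν.prod ν) := by
  refine ⟨by fun_prop, ?_⟩
  have hind := ProbabilityTheory.iIndepFun_pi (μ := fun _ : Fin v => ν) (X := fun _ => id)
    (fun _ => aemeasurable_id)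
  have h2 := hind.indepFun hab
  have := (ProbabilityTheory.indepFun_iff_map_prod_eq_prod_map_map
    (measurable_pi_apply a).aemeasurable (measurable_pi_apply b).aemeasurable).1 h2
  refine Eq.trans this ?_
  have e : ∀ c : Fin v, (Measure.pi fun _ => ν).map (fun z : Fin v → Ω => z c) = ν := fun c =>
    (measurePreserving_eval (fun _ : Fin v => ν) c).map_eq
  rw [e a, e b]

theorem ker_mp {v : ℕ} {Ω : Type*} [MeasurableSpace Ω] (ν : Measure Ω) [IsProbabilityMeasure ν]
    (α : Ω → ℝ) (hα : MeasurePreserving α ν unif01)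
    (a b : Fin v) (hab : a ≠ b) :
    MeasurePreserving (fun z : Fin v → Ω => (α (z a), α (z b))) (Measure.pi fun _ => ν)
      (unif01.prod unif01) :=
  (hα.prod hα).comp (pair_mp ν a b hab)

/-- every vertex is in at most `d` edges -/
def Deg {v : ℕ} (E : Finset (Fin v × Fin v)) (d : ℕ) : Prop :=
  (∀ a, (E.filter (fun e => a = e.1 ∨ a = e.2)).card ≤ d) ∧ ∀ e ∈ E, e.1 < e.2

theorem Deg.ne {v : ℕ} {E : Finset (Fin v × Fin v)} {d : ℕ} (h : Deg E d) {e} (he : e ∈ E) :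
    e.1 ≠ e.2 := (h.2 e he).ne

theorem prodKer_meas {v : ℕ} {Ω : Type*} [MeasurableSpace Ω] (α : Ω → ℝ) (hα : Measurable α)
    (E : Finset (Fin v × Fin v)) (κ : Fin v × Fin v → ℝ → ℝ → ℝ)
    (hκ : ∀ e ∈ E, Measurable (Function.uncurry (κ e))) :
    Measurable (fun z : Fin v → Ω => ∏ e ∈ E, κ e (α (z e.1)) (α (z e.2))) := by
  refine Finset.measurable_prod _ fun e he => ?_
  exact (hκ e he).comp (f := fun z : Fin v → Ω => (α (z e.1), α (z e.2))) (by fun_prop)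

theorem ker_lp {v : ℕ} {Ω : Type*} [MeasurableSpace Ω] (ν : Measure Ω) [IsProbabilityMeasure ν]
    (α : Ω → ℝ) (hα : MeasurePreserving α ν unif01)
    (E : Finset (Fin v × Fin v)) (d : ℕ) (hd : 1 ≤ d) (hE : Deg E d)
    (κ : Fin v × Fin v → ℝ → ℝ → ℝ) (hκ : ∀ e ∈ E, Measurable (Function.uncurry (κ e)))
    (q : ℝ≥0∞) (hq : 1 ≤ q) :
    eLpNorm (fun z : Fin v → Ω => ∏ e ∈ E, κ e (α (z e.1)) (α (z e.2))) q (Measure.pi fun _ => ν)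
      ≤ ∏ e ∈ E, kerNorm (κ e) (q * d) := by
  have hd0 : (d : ℝ≥0∞) ≠ 0 := by simp; omega
  have hd0' : (d : ℝ) ≠ 0 := by simp; omega
  by_cases hqt : q = ⊤
  · subst hqt
    rw [ENNReal.top_mul hd0, eLpNorm_exponent_top]
    refine eLpNormEssSup_le_of_ae_enorm_bound ?_
    have : ∀ e ∈ E, ∀ᵐ z ∂(Measure.pi fun _ : Fin v => ν),
        ‖κ e (α (z e.1)) (α (z e.2))‖ₑ ≤ kerNorm (κ e) ⊤ := by
      intro e he
      have h1 : ∀ᵐ w ∂(unif01.prod unif01), ‖κ e w.1 w.2‖ₑ ≤ kerNorm (κ e) ⊤ := by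
        unfold kerNorm
        rw [eLpNorm_exponent_top]
        exact ae_le_eLpNormEssSup (f := fun z : ℝ × ℝ => κ e z.1 z.2)
      exact (ker_mp ν α hα e.1 e.2 (hE.ne he)).quasiMeasurePreserving.ae h1
    rw [← Finset.eventually_all] at this
    filter_upwards [this] with z hz
    rw [enorm_finset_prod]
    exact Finset.prod_le_prod' fun e he => hz e he
  · have hq0 : q ≠ 0 := (zero_lt_one.trans_le hq).ne'
    have hqr : 0 < q.toReal := ENNReal.toReal_pos hq0 hqt
    have hqd : (q * d).toReal = q.toReal * d := by simp
    rw [eLpNorm_eq_lintegral_rpow_enorm_toReal hq0 hqt]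
    have hk : ∀ e ∈ E, (∫⁻ z : Fin v → Ω, (‖κ e (α (z e.1)) (α (z e.2))‖ₑ ^ q.toReal) ^ (d:ℝ)
        ∂(Measure.pi fun _ => ν)) ^ (1/(d:ℝ)) = (kerNorm (κ e) (q * d)) ^ q.toReal := by
      intro e he
      unfold kerNorm
      rw [eLpNorm_eq_lintegral_rpow_enorm_toReal (by simp [hq0]; omega)
        (ENNReal.mul_ne_top hqt (by simp)), hqd]
      rw [← (ker_mp ν α hα e.1 e.2 (hE.ne he)).lintegral_comp
        (f := fun z : ℝ × ℝ => ‖κ e z.1 z.2‖ₑ ^ (q.toReal * d))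
        (by have := hκ e he
            exact (this.enorm).pow_const _)]
      rw [← ENNReal.rpow_mul]
      have : 1 / (q.toReal * d) * q.toReal = 1 / (d:ℝ) := by field_simp
      rw [this]
      simp only [ENNReal.rpow_mul]
    calc _ ≤ (∏ e ∈ E, (kerNorm (κ e) (q * d)) ^ q.toReal) ^ (1 / q.toReal) := by
          refine ENNReal.rpow_le_rpow ?_ (by positivity)
          rw [← Finset.prod_congr rfl hk]
          simp_rw [enorm_finset_prod, ← ENNReal.prod_rpow_of_nonneg hqr.le]
          refine finner (fun _ : Fin v => ν) E (fun e => {e.1, e.2}) d hd ?_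
            (fun e (z : Fin v → Ω) => ‖κ e (α (z e.1)) (α (z e.2))‖ₑ ^ q.toReal) ?_ ?_
          · intro j
            simpa using hE.1 j
          · intro e he
            have := (hκ e he).comp (f := fun z : Fin v → Ω => (α (z e.1), α (z e.2)))
              (by have := hα.measurable; fun_prop)
            exact this.enorm.pow_const _
          · intro e he j hj z y
            simp only [Finset.mem_insert, Finset.mem_singleton, not_or] at hj
            simp [Function.update_of_ne (Ne.symm hj.1), Function.update_of_ne (Ne.symm hj.2)]
      _ = _ := by
          rw [ENNReal.prod_rpow_of_nonneg hqr.le, ← ENNReal.rpow_mul, mul_one_div_cancel hqr.ne',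
            ENNReal.rpow_one]

/-- Hölder: the key analytic estimate. -/
theorem ker_holder {v : ℕ} {Ω : Type*} [MeasurableSpace Ω] (ν : Measure Ω)
    [IsProbabilityMeasure ν]
    (α : Ω → ℝ) (hα : MeasurePreserving α ν unif01)
    (E : Finset (Fin v × Fin v)) (d : ℕ) (hd : 1 ≤ d) (hE : Deg E d)
    (κ : Fin v × Fin v → ℝ → ℝ → ℝ) (hκ : ∀ e ∈ E, Measurable (Function.uncurry (κ e)))
    (p q : ℝ≥0∞) (hpq : p⁻¹ + q⁻¹ = 1) (hq : 1 ≤ q)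
    (h : (Fin v → Ω) → ℝ) (hh : Measurable h) :
    eLpNorm (fun z : Fin v → Ω => h z * ∏ e ∈ E, κ e (α (z e.1)) (α (z e.2))) 1
      (Measure.pi fun _ => ν)
      ≤ eLpNorm h p (Measure.pi fun _ => ν) * ∏ e ∈ E, kerNorm (κ e) (q * d) := by
  have : ENNReal.HolderTriple p q 1 := ⟨by simpa using hpq⟩
  have h1 := eLpNorm_smul_le_mul_eLpNorm (p := p) (q := q) (r := 1)
    (μ := Measure.pi fun _ : Fin v => ν) (φ := h)
    (prodKer_meas α hα.measurable E κ hκ).aestronglyMeasurable hh.aestronglyMeasurable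
  refine (le_of_eq ?_).trans (h1.trans ?_)
  · rfl
  · exact mul_le_mul' le_rfl (ker_lp ν α hα E d hd hE κ hκ q hq)

end LDPaux

namespace LDPaux

/-- cut-norm bound for a kernel -/
def CutB (w : ℝ → ℝ → ℝ) (δ : ℝ) : Prop :=
  ∀ S T : Set ℝ, MeasurableSet S → MeasurableSet T →
    |∫ z, S.indicator (fun _ => (1:ℝ)) z.1 * T.indicator (fun _ => (1:ℝ)) z.2 * w z.1 z.2
      ∂(unif01.prod unif01)| ≤ δ

theorem half_cut {Ω Ω₂ : Type*} [MeasurableSpace Ω] [MeasurableSpace Ω₂] (ν : Measure Ω)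
    [IsProbabilityMeasure ν] (ν₂ : Measure Ω₂) [IsProbabilityMeasure ν₂]
    (α : Ω → ℝ) (hα : MeasurePreserving α ν unif01) (Γ : Ω → ℝ) (hΓ : Measurable Γ)
    (hΓ1 : ∀ z, |Γ z| ≤ 1) (w : ℝ × Ω₂ → ℝ) (hw : Measurable w)
    (hwi : Integrable w (unif01.prod ν₂)) :
    ∃ S : Set ℝ, MeasurableSet S ∧
      |∫ z, Γ z.1 * w (α z.1, z.2) ∂(ν.prod ν₂)| ≤
        ∫ z, (2 * S.indicator (fun _ => (1:ℝ)) z.1 - 1) * w z ∂(unif01.prod ν₂) := by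
  set k : ℝ → ℝ := fun x => ∫ y, w (x, y) ∂ν₂ with hk
  have hkm : Measurable k := (hw.stronglyMeasurable.integral_prod_right').measurable
  have hki : Integrable k unif01 := hwi.integral_prod_left
  have hmp : MeasurePreserving (fun z : Ω × Ω₂ => (α z.1, z.2)) (ν.prod ν₂) (unif01.prod ν₂) :=
    hα.prod (MeasurePreserving.id ν₂)
  have hwi2 : Integrable (fun z : Ω × Ω₂ => w (α z.1, z.2)) (ν.prod ν₂) :=
    hmp.integrable_comp_of_integrable hwi
  have hIntg : Integrable (fun z : Ω × Ω₂ => Γ z.1 * w (α z.1, z.2)) (ν.prod ν₂) :=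
    hwi2.bdd_mul (c := 1) (hΓ.comp measurable_fst).aestronglyMeasurable (ae_of_all _ fun z => hΓ1 z.1)
  refine ⟨{x | 0 ≤ k x}, measurableSet_le measurable_const hkm, ?_⟩
  have hSm : MeasurableSet {x | 0 ≤ k x} := measurableSet_le measurable_const hkm
  rw [integral_prod _ hIntg]
  have h1 : ∀ x, ∫ y, Γ (x, y).1 * w (α (x, y).1, (x, y).2) ∂ν₂ = Γ x * k (α x) := by
    intro x; simp only [hk]; rw [← integral_const_mul]
  simp_rw [h1]
  have hint2 : Integrable (fun z : ℝ × Ω₂ =>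
      (2 * ({x | 0 ≤ k x}.indicator (fun _ => (1:ℝ)) z.1) - 1) * w z) (unif01.prod ν₂) := by
    refine hwi.bdd_mul (c := 1) ?_ (ae_of_all _ fun z => ?_)
    · exact (((measurable_const.indicator hSm).comp measurable_fst).const_mul 2
        |>.sub_const 1).aestronglyMeasurable
    · by_cases h : z.1 ∈ {x | 0 ≤ k x}
      · rw [indicator_of_mem h]; norm_num
      · rw [indicator_of_notMem h]; norm_num
  rw [integral_prod _ hint2]
  have h2 : ∀ x, ∫ y, (2 * ({x | 0 ≤ k x}.indicator (fun _ => (1:ℝ)) (x, y).1) - 1) * w (x, y) ∂ν₂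
      = |k x| := by
    intro x
    change ∫ y, (2 * {x | 0 ≤ k x}.indicator (fun _ => (1:ℝ)) x - 1) * w (x, y) ∂ν₂ = _
    rw [integral_const_mul]
    change _ * k x = _
    by_cases h : 0 ≤ k x
    · rw [indicator_of_mem (by exact h), abs_of_nonneg h]; ring
    · rw [indicator_of_notMem (by exact h), abs_of_neg (not_le.1 h)]; ring
  simp_rw [h2]
  rw [← hα.map_eq, integral_map hα.measurable.aemeasurable
    (by exact hkm.abs.aestronglyMeasurable)]
  refine (abs_integral_le_integral_abs).trans ?_
  have hka : Integrable (fun x => |k (α x)|) ν :=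
    (hα.integrable_comp_of_integrable hki).abs
  refine integral_mono_of_nonneg (ae_of_all _ fun x => abs_nonneg _) hka (ae_of_all _ fun x => ?_)
  simp only [abs_mul]
  exact mul_le_of_le_one_left (abs_nonneg _) (hΓ1 x)

theorem cut_le {Ω : Type*} [MeasurableSpace Ω] (ν : Measure Ω)
    [IsProbabilityMeasure ν]
    (α : Ω → ℝ) (hα : MeasurePreserving α ν unif01) (Γ₁ Γ₂ : Ω → ℝ) (hΓ₁ : Measurable Γ₁)
    (hΓ₂ : Measurable Γ₂) (hΓ₁1 : ∀ z, |Γ₁ z| ≤ 1) (hΓ₂1 : ∀ z, |Γ₂ z| ≤ 1)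
    (w : ℝ → ℝ → ℝ) (hw : Measurable (Function.uncurry w))
    (hwi : Integrable (Function.uncurry w) (unif01.prod unif01)) (δ : ℝ) (hδ : CutB w δ) :
    |∫ z, Γ₁ z.1 * Γ₂ z.2 * w (α z.1) (α z.2) ∂(ν.prod ν)| ≤ 4 * δ := by
  have hαm := hα.measurable
  have hmp : MeasurePreserving (fun z : ℝ × Ω => (z.1, α z.2)) (unif01.prod ν)
      (unif01.prod unif01) := (MeasurePreserving.id _).prod hα
  obtain ⟨S, hS, h1⟩ := half_cut ν ν α hα Γ₁ hΓ₁ hΓ₁1 (fun z => Γ₂ z.2 * w z.1 (α z.2))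
    (by
      refine (hΓ₂.comp measurable_snd).mul ?_
      exact hw.comp (f := fun z : ℝ × Ω => (z.1, α z.2)) (by fun_prop))
    (by
      refine Integrable.bdd_mul (c := 1) (hmp.integrable_comp_of_integrable hwi)
        (hΓ₂.comp measurable_snd).aestronglyMeasurable
        (ae_of_all _ fun z => hΓ₂1 z.2))
  set s : ℝ → ℝ := fun x => 2 * S.indicator (fun _ => (1:ℝ)) x - 1 with hs
  have hsm : Measurable s := ((measurable_const.indicator hS).const_mul 2).sub_const 1
  have hs1 : ∀ x, |s x| ≤ 1 := by
    intro x
    by_cases h : x ∈ S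
    · simp only [hs]; rw [indicator_of_mem h]; norm_num
    · simp only [hs]; rw [indicator_of_notMem h]; norm_num
  have hwsi : Integrable (fun z : ℝ × ℝ => s z.2 * w z.2 z.1) (unif01.prod unif01) := by
    refine Integrable.bdd_mul (c := 1) hwi.swap (hsm.comp measurable_snd).aestronglyMeasurable (ae_of_all _ fun z => hs1 z.2)
  obtain ⟨T, hT, h2⟩ := half_cut ν unif01 α hα Γ₂ hΓ₂ hΓ₂1 (fun z => s z.2 * w z.2 z.1)
    (by
      refine (hsm.comp measurable_snd).mul ?_
      exact hw.comp (f := fun z : ℝ × ℝ => (z.2, z.1)) (by fun_prop)) hwsi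
  have e1 : ∫ z, s z.1 * (Γ₂ z.2 * w z.1 (α z.2)) ∂(unif01.prod ν)
      = ∫ z, Γ₂ z.1 * (s z.2 * w z.2 (α z.1)) ∂(ν.prod unif01) := by
    rw [← integral_prod_swap]
    refine integral_congr_ae (ae_of_all _ fun z => ?_)
    simp only [Prod.fst_swap, Prod.snd_swap]; ring
  have e2 : ∫ z, (2 * T.indicator (fun _ => (1:ℝ)) z.1 - 1) * (s z.2 * w z.2 z.1)
      ∂(unif01.prod unif01) =
      ∫ z, s z.1 * (2 * T.indicator (fun _ => (1:ℝ)) z.2 - 1) * w z.1 z.2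
      ∂(unif01.prod unif01) := by
    rw [← integral_prod_swap]
    refine integral_congr_ae (ae_of_all _ fun z => ?_)
    simp only [Prod.fst_swap, Prod.snd_swap]; ring
  have hind : ∀ A B : Set ℝ, MeasurableSet A → MeasurableSet B → Integrable
      (fun z : ℝ × ℝ => A.indicator (fun _ => (1:ℝ)) z.1 * B.indicator (fun _ => (1:ℝ)) z.2 *
        w z.1 z.2) (unif01.prod unif01) := by
    intro A B hA hB
    refine Integrable.bdd_mul (c := 1) hwi ?_ (ae_of_all _ fun z => ?_)
    · exact (((measurable_const.indicator hA).comp measurable_fst).mul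
        ((measurable_const.indicator hB).comp measurable_snd)).aestronglyMeasurable
    · by_cases h : z.1 ∈ A <;> by_cases h' : z.2 ∈ B <;> simp [h, h']
  have e3 : ∫ z, s z.1 * (2 * T.indicator (fun _ => (1:ℝ)) z.2 - 1) * w z.1 z.2
      ∂(unif01.prod unif01) ≤ 4 * δ := by
    have : ∀ z : ℝ × ℝ, s z.1 * (2 * T.indicator (fun _ => (1:ℝ)) z.2 - 1) * w z.1 z.2 =
      (S.indicator (fun _ => (1:ℝ)) z.1 * T.indicator (fun _ => (1:ℝ)) z.2 * w z.1 z.2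
      + Sᶜ.indicator (fun _ => (1:ℝ)) z.1 * Tᶜ.indicator (fun _ => (1:ℝ)) z.2 * w z.1 z.2)
      - (S.indicator (fun _ => (1:ℝ)) z.1 * Tᶜ.indicator (fun _ => (1:ℝ)) z.2 * w z.1 z.2
      + Sᶜ.indicator (fun _ => (1:ℝ)) z.1 * T.indicator (fun _ => (1:ℝ)) z.2 * w z.1 z.2) := by
      intro z
      by_cases h : z.1 ∈ S <;> by_cases h' : z.2 ∈ T <;> simp [hs, h, h'] <;> ring
    simp_rw [this]
    rw [integral_sub, integral_add, integral_add]
    · have a1 := abs_le.1 (hδ S T hS hT)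
      have a2 := abs_le.1 (hδ Sᶜ Tᶜ hS.compl hT.compl)
      have a3 := abs_le.1 (hδ S Tᶜ hS hT.compl)
      have a4 := abs_le.1 (hδ Sᶜ T hS.compl hT)
      linarith [a1.1, a1.2, a2.2, a3.1, a4.1]
    all_goals first
      | exact hind _ _ (by first | exact hS | exact hS.compl) (by first | exact hT | exact hT.compl)
      | exact (hind _ _ (by first | exact hS | exact hS.compl)
          (by first | exact hT | exact hT.compl)).add
          (hind _ _ (by first | exact hS | exact hS.compl)
            (by first | exact hT | exact hT.compl))
  have e0 : ∫ z, Γ₁ z.1 * Γ₂ z.2 * w (α z.1) (α z.2) ∂(ν.prod ν) =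
      ∫ z, Γ₁ z.1 * (Γ₂ z.2 * w (α z.1) (α z.2)) ∂(ν.prod ν) := by
    simp_rw [mul_assoc]
  rw [e0]
  calc _ ≤ _ := h1
    _ = _ := e1
    _ ≤ _ := le_abs_self _
    _ ≤ _ := h2
    _ = _ := e2
    _ ≤ _ := e3

theorem resample {J Ω : Type*} [Fintype J] [DecidableEq J] [MeasurableSpace Ω]
    (μ : J → Measure Ω) [∀ j, IsProbabilityMeasure (μ j)] (a : J) (ν : Measure Ω)
    [IsProbabilityMeasure ν] :
    MeasurePreserving (fun zx : (J → Ω) × Ω => Function.update zx.1 a zx.2)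
      ((Measure.pi μ).prod ν) (Measure.pi (Function.update μ a ν)) := by
  have hinst : ∀ j, IsProbabilityMeasure (Function.update μ a ν j) := by
    intro j
    by_cases h : j = a
    · subst h; simpa
    · rw [Function.update_of_ne h]; infer_instance
  have hm : Measurable (fun zx : (J → Ω) × Ω => Function.update zx.1 a zx.2) := by
    rw [measurable_pi_iff]
    intro j
    by_cases h : j = a
    · subst h; simpa using measurable_snd
    · simp only [Function.update_of_ne h]; fun_prop
  refine ⟨hm, ?_⟩
  symm
  refine Measure.pi_eq fun s hs => ?_
  rw [Measure.map_apply hm (MeasurableSet.univ_pi hs)]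
  have : (fun zx : (J → Ω) × Ω => Function.update zx.1 a zx.2) ⁻¹' (Set.univ.pi s) =
      (Set.univ.pi (Function.update s a Set.univ)) ×ˢ s a := by
    ext ⟨z, x⟩
    simp only [mem_preimage, Set.mem_pi, mem_univ, forall_true_left, mem_prod]
    constructor
    · intro h
      refine ⟨fun j => ?_, by simpa using h a⟩
      by_cases hj : j = a
      · subst hj; simp
      · have := h j
        rw [Function.update_of_ne hj] at this ⊢; exact this
    · rintro ⟨h1, h2⟩ j
      by_cases hj : j = a
      · subst hj; simpa
      · have := h1 j
        rw [Function.update_of_ne hj] at this ⊢; exact this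
  rw [this, Measure.prod_prod, Measure.pi_pi]
  rw [← Finset.mul_prod_erase Finset.univ _ (Finset.mem_univ a),
    ← Finset.mul_prod_erase Finset.univ (fun i => (Function.update μ a ν i) (s i))
      (Finset.mem_univ a)]
  simp only [Function.update_self, measure_univ, one_mul]
  rw [mul_comm]
  congr 1
  refine Finset.prod_congr rfl fun j hj => ?_
  have := Finset.ne_of_mem_erase hj
  rw [Function.update_of_ne this, Function.update_of_ne this]

theorem resample_same {J Ω : Type*} [Fintype J] [DecidableEq J] [MeasurableSpace Ω]
    (ν : Measure Ω) [IsProbabilityMeasure ν] (a : J)  :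
    MeasurePreserving (fun zx : (J → Ω) × Ω => Function.update zx.1 a zx.2)
      ((Measure.pi fun _ => ν).prod ν) (Measure.pi fun _ => ν) := by
  have := resample (fun _ : J => ν) a ν
  rwa [Function.update_eq_self] at this

theorem resample2 {J Ω : Type*} [Fintype J] [DecidableEq J] [MeasurableSpace Ω]
    (ν : Measure Ω) [IsProbabilityMeasure ν] (a b : J)  :
    MeasurePreserving (fun zx : (J → Ω) × (Ω × Ω) =>
        Function.update (Function.update zx.1 a zx.2.1) b zx.2.2)
      ((Measure.pi fun _ => ν).prod (ν.prod ν)) (Measure.pi fun _ => ν) := by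
  have h1 := (resample_same ν a).prod (MeasurePreserving.id ν)
  have h2 := (resample_same ν b).comp h1
  have h3 := h2.comp (MeasurePreserving.symm _ (measurePreserving_prodAssoc
    (Measure.pi fun _ : J => ν) ν ν))
  exact h3

theorem pair_cut {J Ω : Type*} [Fintype J] [DecidableEq J] [MeasurableSpace Ω]
    (ν : Measure Ω) [IsProbabilityMeasure ν] (α : Ω → ℝ) (hα : MeasurePreserving α ν unif01)
    (a b : J) (hab : a ≠ b) (Γ₁ Γ₂ : (J → Ω) → ℝ) (hΓ₁ : Measurable Γ₁)
    (hΓ₂ : Measurable Γ₂) (hΓ₁1 : ∀ z, |Γ₁ z| ≤ 1) (hΓ₂1 : ∀ z, |Γ₂ z| ≤ 1)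
    (hi₁ : ∀ z x, Γ₁ (Function.update z b x) = Γ₁ z)
    (hi₂ : ∀ z x, Γ₂ (Function.update z a x) = Γ₂ z)
    (w : ℝ → ℝ → ℝ) (hw : Measurable (Function.uncurry w))
    (hwi : Integrable (Function.uncurry w) (unif01.prod unif01)) (δ : ℝ) (hδ : CutB w δ) :
    |∫ z, Γ₁ z * Γ₂ z * w (α (z a)) (α (z b)) ∂(Measure.pi fun _ => ν)| ≤ 4 * δ := by
  have hmp := resample2 ν a b
  have hαm := hα.measurable
  have hF : Measurable (fun z : J → Ω => Γ₁ z * Γ₂ z * w (α (z a)) (α (z b))) :=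
    (hΓ₁.mul hΓ₂).mul (hw.comp (f := fun z : J → Ω => (α (z a), α (z b))) (by fun_prop))
  rw [← hmp.map_eq, integral_map hmp.measurable.aemeasurable hF.aestronglyMeasurable]
  have hG : ∀ zx : (J → Ω) × (Ω × Ω),
      Γ₁ (Function.update (Function.update zx.1 a zx.2.1) b zx.2.2) *
        Γ₂ (Function.update (Function.update zx.1 a zx.2.1) b zx.2.2) *
        w (α (Function.update (Function.update zx.1 a zx.2.1) b zx.2.2 a))
          (α (Function.update (Function.update zx.1 a zx.2.1) b zx.2.2 b)) =
      Γ₁ (Function.update zx.1 a zx.2.1) * Γ₂ (Function.update zx.1 b zx.2.2) *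
        w (α zx.2.1) (α zx.2.2) := by
    intro zx
    rw [hi₁, Function.update_comm hab, hi₂, Function.update_self]
    rw [Function.update_of_ne hab.symm, Function.update_self]
  simp_rw [hG]
  have hm1 : Measurable (fun zx : (J → Ω) × Ω => Function.update zx.1 a zx.2) :=
    (resample_same ν a).measurable
  have hm2 : Measurable (fun zx : (J → Ω) × Ω => Function.update zx.1 b zx.2) :=
    (resample_same ν b).measurable
  have hmpw : MeasurePreserving (fun zx : (J → Ω) × (Ω × Ω) => (α zx.2.1, α zx.2.2))
      ((Measure.pi fun _ => ν).prod (ν.prod ν)) (unif01.prod unif01) :=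
    (hα.prod hα).comp measurePreserving_snd
  have hIntg : Integrable (fun zx : (J → Ω) × (Ω × Ω) => Γ₁ (Function.update zx.1 a zx.2.1) *
      Γ₂ (Function.update zx.1 b zx.2.2) * w (α zx.2.1) (α zx.2.2))
      ((Measure.pi fun _ => ν).prod (ν.prod ν)) := by
    refine Integrable.bdd_mul (c := 1) (hmpw.integrable_comp_of_integrable hwi) ?_
      (ae_of_all _ fun z => ?_)
    · refine Measurable.aestronglyMeasurable (Measurable.mul ?_ ?_)
      · exact hΓ₁.comp (hm1.comp (g := fun zx : (J → Ω) × Ω => Function.update zx.1 a zx.2)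
          (f := fun zx : (J → Ω) × (Ω × Ω) => (zx.1, zx.2.1)) (by fun_prop))
      · exact hΓ₂.comp (hm2.comp (g := fun zx : (J → Ω) × Ω => Function.update zx.1 b zx.2)
          (f := fun zx : (J → Ω) × (Ω × Ω) => (zx.1, zx.2.2)) (by fun_prop))
    · rw [norm_mul]
      exact mul_le_one₀ (hΓ₁1 _) (norm_nonneg _) (hΓ₂1 _)
  rw [integral_prod _ hIntg]
  have hb : ∀ z : J → Ω, ‖∫ xy : Ω × Ω, Γ₁ (Function.update z a xy.1) *
      Γ₂ (Function.update z b xy.2) * w (α xy.1) (α xy.2) ∂(ν.prod ν)‖ ≤ 4 * δ := by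
    intro z
    exact cut_le ν α hα (fun x => Γ₁ (Function.update z a x)) (fun x => Γ₂ (Function.update z b x))
      (hΓ₁.comp (measurable_update z)) (hΓ₂.comp (measurable_update z)) (fun _ => hΓ₁1 _)
      (fun _ => hΓ₂1 _) w hw hwi δ hδ
  have := norm_integral_le_of_norm_le_const (μ := Measure.pi fun _ : J => ν) (ae_of_all _ hb)
  simpa using this

end LDPaux

namespace LDPaux

theorem abs_finprod_le_one {ι : Type*} (s : Finset ι) (f : ι → ℝ) (h : ∀ i ∈ s, |f i| ≤ 1) :
    |∏ i ∈ s, f i| ≤ 1 := by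
  rw [Finset.abs_prod]
  exact Finset.prod_le_one (fun _ _ => abs_nonneg _) h

/-- truncated kernel -/
noncomputable def trunc (K : ℝ) (w : ℝ → ℝ → ℝ) : ℝ → ℝ → ℝ := fun x y => if |w x y| ≤ K then w x y else 0

theorem trunc_meas (K : ℝ) (w : ℝ → ℝ → ℝ) (hw : Measurable (Function.uncurry w)) :
    Measurable (Function.uncurry (trunc K w)) := by
  have : Function.uncurry (trunc K w) = fun z =>
      if |Function.uncurry w z| ≤ K then Function.uncurry w z else 0 := by
    ext z; rfl
  rw [this]
  exact Measurable.ite (measurableSet_le hw.abs measurable_const) hw measurable_const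

theorem trunc_le (K : ℝ) (hK : 0 ≤ K) (w : ℝ → ℝ → ℝ) (x y : ℝ) : |trunc K w x y| ≤ K := by
  unfold trunc
  split_ifs with h
  · exact h
  · simpa using hK

theorem good_part {v : ℕ} {Ω : Type*} [MeasurableSpace Ω] (ν : Measure Ω)
    [IsProbabilityMeasure ν]
    (α : Ω → ℝ) (hα : MeasurePreserving α ν unif01)
    (E : Finset (Fin v × Fin v)) (hE : ∀ e ∈ E, e.1 < e.2)
    (κ : Fin v × Fin v → ℝ → ℝ → ℝ) (hκ : ∀ e ∈ E, Measurable (Function.uncurry (κ e)))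
    (e0 : Fin v × Fin v) (he0 : e0 ∉ E) (he0' : e0.1 < e0.2) (w : ℝ → ℝ → ℝ)
    (hw : Measurable (Function.uncurry w))
    (hwi : Integrable (Function.uncurry w) (unif01.prod unif01)) (δ : ℝ) (hδ : CutB w δ)
    (f : Fin v → Ω → ℝ) (hf : ∀ a, Measurable (f a)) (hf1 : ∀ a z, |f a z| ≤ 1)
    (K : ℝ) (hK : 0 < K) (hκK : ∀ e ∈ E, ∀ x y, |κ e x y| ≤ K) :
    |∫ z : Fin v → Ω, (∏ a, f a (z a)) * ((∏ e ∈ E, κ e (α (z e.1)) (α (z e.2))) *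
      w (α (z e0.1)) (α (z e0.2))) ∂(Measure.pi fun _ => ν)| ≤ 4 * K ^ E.card * δ := by
  classical
  have hαm := hα.measurable
  set κ' : Fin v × Fin v → ℝ → ℝ → ℝ := fun e x y => κ e x y / K with hκ'
  have hκ'm : ∀ e ∈ E, Measurable (Function.uncurry (κ' e)) := fun e he =>
    (hκ e he).div_const K
  have hκ'1 : ∀ e ∈ E, ∀ x y, |κ' e x y| ≤ 1 := by
    intro e he x y
    simp only [hκ', abs_div, abs_of_pos hK]
    exact (div_le_one hK).2 (hκK e he x y)
  set b := e0.2
  set a := e0.1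
  set Γ₁ : (Fin v → Ω) → ℝ := fun z => (∏ c ∈ Finset.univ.erase b, f c (z c)) *
    ∏ e ∈ E.filter (fun e => ¬ (e.1 = b ∨ e.2 = b)), κ' e (α (z e.1)) (α (z e.2)) with hΓ₁
  set Γ₂ : (Fin v → Ω) → ℝ := fun z => f b (z b) *
    ∏ e ∈ E.filter (fun e => e.1 = b ∨ e.2 = b), κ' e (α (z e.1)) (α (z e.2)) with hΓ₂
  have hm1 : Measurable Γ₁ := by
    refine Measurable.mul ?_ (prodKer_meas α hαm _ κ' fun e he => hκ'm e (Finset.mem_filter.1 he).1)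
    exact Finset.measurable_prod _ fun c _ => (hf c).comp (measurable_pi_apply c)
  have hm2 : Measurable Γ₂ := by
    refine Measurable.mul ?_ (prodKer_meas α hαm _ κ' fun e he => hκ'm e (Finset.mem_filter.1 he).1)
    exact (hf b).comp (measurable_pi_apply b)
  have key := pair_cut ν α hα a b he0'.ne Γ₁ Γ₂ hm1 hm2 ?_ ?_ ?_ ?_ w hw hwi δ hδ
  · have e1 : ∀ z : Fin v → Ω, (∏ a, f a (z a)) * ((∏ e ∈ E, κ e (α (z e.1)) (α (z e.2))) *
      w (α (z e0.1)) (α (z e0.2))) = K ^ E.card * (Γ₁ z * Γ₂ z * w (α (z a)) (α (z b))) := by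
      intro z
      rw [← Finset.prod_erase_mul Finset.univ _ (Finset.mem_univ b)]
      have : ∏ e ∈ E, κ e (α (z e.1)) (α (z e.2)) =
          K ^ E.card * ∏ e ∈ E, κ' e (α (z e.1)) (α (z e.2)) := by
        rw [← Finset.prod_const, ← Finset.prod_mul_distrib]
        refine Finset.prod_congr rfl fun e _ => ?_
        simp only [hκ']; field_simp
      rw [this, ← Finset.prod_filter_mul_prod_filter_not E (fun e => e.1 = b ∨ e.2 = b)]
      simp only [hΓ₁, hΓ₂]
      ring
    refine (le_of_eq (congrArg abs (integral_congr_ae (ae_of_all _ e1)))).trans ?_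
    rw [integral_const_mul, abs_mul, abs_of_pos (by positivity)]
    calc _ ≤ K ^ E.card * (4 * δ) := mul_le_mul_of_nonneg_left key (by positivity)
      _ = _ := by ring
  · intro z
    simp only [hΓ₁, abs_mul]
    refine mul_le_one₀ (abs_finprod_le_one _ _ fun c _ => hf1 _ _) (abs_nonneg _)
      (abs_finprod_le_one _ _ fun e he => hκ'1 e (Finset.mem_filter.1 he).1 _ _)
  · intro z
    simp only [hΓ₂, abs_mul]
    refine mul_le_one₀ (hf1 _ _) (abs_nonneg _)
      (abs_finprod_le_one _ _ fun e he => hκ'1 e (Finset.mem_filter.1 he).1 _ _)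
  · intro z x
    simp only [hΓ₁]
    congr 1
    · refine Finset.prod_congr rfl fun c hc => ?_
      rw [Function.update_of_ne (Finset.ne_of_mem_erase hc)]
    · refine Finset.prod_congr rfl fun e he => ?_
      have := (Finset.mem_filter.1 he).2
      rw [not_or] at this
      rw [Function.update_of_ne this.1, Function.update_of_ne this.2]
  · intro z x
    simp only [hΓ₂]
    rw [Function.update_of_ne he0'.ne']
    congr 1
    refine Finset.prod_congr rfl fun e he => ?_
    obtain ⟨heE, heb⟩ := Finset.mem_filter.1 he
    have hlt := hE e heE
    have h1 : e.1 ≠ a := by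
      intro h
      rcases heb with hb | hb
      · exact he0'.ne (h.symm.trans hb)
      · exact he0 ((Prod.ext h hb : e = e0) ▸ heE)
    have h2 : e.2 ≠ a := by
      intro h
      rcases heb with hb | hb
      · rw [hb, h] at hlt; exact lt_asymm hlt he0'
      · exact he0'.ne (h.symm.trans hb)
    rw [Function.update_of_ne h1, Function.update_of_ne h2]

theorem kerNorm_one_le (w : ℝ → ℝ → ℝ) (hw : Measurable (Function.uncurry w)) {s : ℝ≥0∞}
    (hs : 1 ≤ s) : kerNorm w 1 ≤ kerNorm w s := by
  unfold kerNorm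
  exact eLpNorm_le_eLpNorm_of_exponent_le hs hw.aestronglyMeasurable

theorem ker_integrable (w : ℝ → ℝ → ℝ) (hw : Measurable (Function.uncurry w)) {s : ℝ≥0∞}
    (hs : 1 ≤ s) (h : kerNorm w s ≠ ⊤) : Integrable (Function.uncurry w) (unif01.prod unif01) := by
  refine memLp_one_iff_integrable.1 ⟨hw.aestronglyMeasurable, ?_⟩
  exact lt_of_le_of_lt (kerNorm_one_le w hw hs) h.lt_top

theorem one_le_qd {q : ℝ≥0∞} (hq : 1 ≤ q) {d : ℕ} (hd : 1 ≤ d) : 1 ≤ q * (d : ℝ≥0∞) :=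
  hq.trans (le_mul_of_one_le_right' (by exact_mod_cast hd))

/-- measure of the set where kernel is large -/
theorem ker_markov {v : ℕ} {Ω : Type*} [MeasurableSpace Ω] (ν : Measure Ω)
    [IsProbabilityMeasure ν]
    (α : Ω → ℝ) (hα : MeasurePreserving α ν unif01) (w : ℝ → ℝ → ℝ)
    (hw : Measurable (Function.uncurry w)) (a b : Fin v) (hab : a ≠ b) (K : ℝ) (hK : 0 < K) :
    (Measure.pi fun _ : Fin v => ν) {z | K < |w (α (z a)) (α (z b))|} ≤
      kerNorm w 1 / ENNReal.ofReal K := by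
  have h1 := (ker_mp ν α hα a b hab).measure_preimage
    (s := {z : ℝ × ℝ | K < |w z.1 z.2|}) (measurableSet_lt measurable_const hw.abs).nullMeasurableSet
  refine (le_of_eq h1).trans ?_
  have h2 := meas_ge_le_lintegral_div (μ := unif01.prod unif01)
    (f := fun z : ℝ × ℝ => ‖w z.1 z.2‖ₑ) hw.enorm.aemeasurable
    (ε := ENNReal.ofReal K) (by simpa using hK) (by simp)
  unfold kerNorm
  rw [eLpNorm_one_eq_lintegral_enorm]
  refine (measure_mono ?_).trans h2
  intro z hz
  simp only [mem_ofPred_eq] at hz ⊢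
  rw [← ofReal_norm]
  exact ENNReal.ofReal_le_ofReal hz.le

theorem one_edge {v : ℕ} {Ω : Type*} [MeasurableSpace Ω] (ν : Measure Ω)
    [IsProbabilityMeasure ν]
    (α : Ω → ℝ) (hα : MeasurePreserving α ν unif01)
    (E : Finset (Fin v × Fin v)) (d : ℕ) (hd : 1 ≤ d) (hE : Deg E d)
    (κ : Fin v × Fin v → ℝ → ℝ → ℝ) (hκ : ∀ e ∈ E, Measurable (Function.uncurry (κ e)))
    (p q : ℝ≥0∞) (hpq : p⁻¹ + q⁻¹ = 1) (hq : 1 ≤ q) (hp0 : 1 ≤ p) (hp : p ≠ ⊤)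
    (C : ℝ≥0) (hC : ∀ e ∈ E, kerNorm (κ e) (q * d) ≤ C)
    (e0 : Fin v × Fin v) (he0 : e0 ∈ E) (δ : ℝ) (hδ0 : 0 ≤ δ) (hδ : CutB (κ e0) δ)
    (f : Fin v → Ω → ℝ) (hf : ∀ a, Measurable (f a)) (hf1 : ∀ a z, |f a z| ≤ 1)
    (K : ℝ) (hK : 0 < K) :
    |∫ z : Fin v → Ω, (∏ a, f a (z a)) * (∏ e ∈ E, κ e (α (z e.1)) (α (z e.2)))
      ∂(Measure.pi fun _ => ν)| ≤ 4 * K ^ (E.erase e0).card * δ +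
      ((E.card * (C / ENNReal.ofReal K)) ^ (1 / p.toReal) * C ^ E.card).toReal := by
  classical
  have hαm := hα.measurable
  set π := (Measure.pi fun _ : Fin v => ν)
  set F : (Fin v → Ω) → ℝ := fun z => (∏ a, f a (z a)) * (∏ e ∈ E, κ e (α (z e.1)) (α (z e.2)))
  have hfm : Measurable (fun z : Fin v → Ω => ∏ a, f a (z a)) :=
    Finset.measurable_prod _ fun c _ => (hf c).comp (measurable_pi_apply c)
  set G : (Fin v → Ω) → ℝ := fun z => (∏ a, f a (z a)) * ((∏ e ∈ E.erase e0,
    trunc K (κ e) (α (z e.1)) (α (z e.2))) * κ e0 (α (z e0.1)) (α (z e0.2))) with hG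
  set B : Set (Fin v → Ω) := ⋃ e ∈ E, {z | K < |κ e (α (z e.1)) (α (z e.2))|} with hB
  set B' : Set (Fin v → Ω) := ⋃ e ∈ E.erase e0, {z | K < |κ e (α (z e.1)) (α (z e.2))|} with hB'
  have hBm : MeasurableSet B' := by
    refine Finset.measurableSet_biUnion _ fun e he => measurableSet_lt measurable_const ?_
    exact ((hκ e (Finset.mem_of_mem_erase he)).comp (f := fun z : Fin v → Ω => (α (z e.1), α (z e.2)))
      (by fun_prop)).abs
  have hBB : B' ⊆ B := by
    refine biUnion_subset_biUnion_left fun e he => Finset.mem_of_mem_erase he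
  set h : (Fin v → Ω) → ℝ := B'.indicator (fun z => ∏ a, f a (z a)) with hh
  have hhm : Measurable h := hfm.indicator hBm
  have hcase : ∀ z, F z = G z + h z * ∏ e ∈ E, κ e (α (z e.1)) (α (z e.2)) := by
    intro z
    by_cases hz : z ∈ B'
    · have : G z = 0 := by
        simp only [hB', mem_iUnion, mem_ofPred_eq, exists_prop] at hz
        obtain ⟨e, he, hz⟩ := hz
        have h0 : trunc K (κ e) (α (z e.1)) (α (z e.2)) = 0 := by
          unfold trunc; rw [if_neg (not_le.2 hz)]
        simp only [hG]
        rw [Finset.prod_eq_zero he h0]; ring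
      rw [this, hh, indicator_of_mem hz]; simp [F]
    · rw [hh, indicator_of_notMem hz, zero_mul, add_zero]
      simp only [hG, F]
      rw [← Finset.prod_erase_mul E _ he0]
      congr 2
      refine Finset.prod_congr rfl fun e he => ?_
      have : |κ e (α (z e.1)) (α (z e.2))| ≤ K := by
        by_contra hc
        exact hz (mem_biUnion he (not_le.1 hc))
      unfold trunc; rw [if_pos this]
  have hqd := one_le_qd hq hd
  have hkf : ∀ e ∈ E, kerNorm (κ e) (q * d) ≠ ⊤ := fun e he =>
    ne_top_of_le_ne_top ENNReal.coe_ne_top (hC e he)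
  have hwi := ker_integrable (κ e0) (hκ e0 he0) hqd (hkf e0 he0)
  have hPK : ∏ e ∈ E, kerNorm (κ e) (q * d) ≤ C ^ E.card := by
    rw [← Finset.prod_const]; exact Finset.prod_le_prod' hC
  have hhole := ker_holder ν α hα E d hd hE κ hκ p q hpq hq h hhm
  have hp00 : p ≠ 0 := (zero_lt_one.trans_le hp0).ne'
  have hpr : 0 < p.toReal := ENNReal.toReal_pos hp00 hp
  have hhn : eLpNorm h p π ≤ (E.card * (C / ENNReal.ofReal K)) ^ (1 / p.toReal) := by
    have h1 : eLpNorm h p π ≤ eLpNorm (B'.indicator fun _ => (1:ℝ)) p π := by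
      refine eLpNorm_mono fun z => ?_
      simp only [hh]
      by_cases hz : z ∈ B'
      · rw [indicator_of_mem hz, indicator_of_mem hz]
        rw [norm_one]
        exact abs_finprod_le_one Finset.univ (fun a => f a (z a)) fun a _ => hf1 _ _
      · rw [indicator_of_notMem hz, indicator_of_notMem hz]
    refine h1.trans ?_
    rw [eLpNorm_indicator_const hBm hp00 hp]
    simp only [enorm_one, one_mul]
    refine ENNReal.rpow_le_rpow ?_ (by positivity)
    refine (measure_mono hBB).trans ((measure_biUnion_finset_le _ _).trans ?_)
    rw [← nsmul_eq_mul]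
    refine Finset.sum_le_card_nsmul _ _ _ fun e he => ?_
    refine (ker_markov ν α hα (κ e) (hκ e he) e.1 e.2 (hE.ne he) K hK).trans ?_
    gcongr
    exact (kerNorm_one_le _ (hκ e he) hqd).trans (hC e he)
  have hfin : (E.card * ((C : ℝ≥0∞) / ENNReal.ofReal K)) ^ (1 / p.toReal) * (C : ℝ≥0∞) ^ E.card ≠ ⊤ := by
    refine ENNReal.mul_ne_top (ENNReal.rpow_ne_top_of_nonneg (by positivity) ?_) (by simp)
    exact ENNReal.mul_ne_top (by simp) (ENNReal.div_ne_top (by simp) (by simpa using hK))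
  have hle : eLpNorm (fun z : Fin v → Ω => h z * ∏ e ∈ E, κ e (α (z e.1)) (α (z e.2))) 1 π ≤
      (E.card * ((C : ℝ≥0∞) / ENNReal.ofReal K)) ^ (1 / p.toReal) * (C : ℝ≥0∞) ^ E.card :=
    hhole.trans (mul_le_mul' hhn hPK)
  have hint2 : Integrable (fun z : Fin v → Ω => h z * ∏ e ∈ E, κ e (α (z e.1)) (α (z e.2))) π := by
    refine memLp_one_iff_integrable.1 ⟨?_, lt_of_le_of_lt hle hfin.lt_top⟩
    exact (hhm.mul (prodKer_meas α hαm E κ hκ)).aestronglyMeasurable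
  have hGm : Integrable G π := by
    have hw' : Integrable (fun z : Fin v → Ω => κ e0 (α (z e0.1)) (α (z e0.2))) π :=
      (ker_mp ν α hα e0.1 e0.2 (hE.ne he0)).integrable_comp_of_integrable hwi
    have : G = fun z => ((∏ a, f a (z a)) * (∏ e ∈ E.erase e0,
      trunc K (κ e) (α (z e.1)) (α (z e.2)))) * κ e0 (α (z e0.1)) (α (z e0.2)) := by
      ext z; simp only [hG]; ring
    rw [this]
    refine hw'.bdd_mul (c := K ^ (E.erase e0).card) ?_ (ae_of_all _ fun z => ?_)
    · exact (hfm.mul (prodKer_meas α hαm _ _ fun e he => trunc_meas K _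
        (hκ e (Finset.mem_of_mem_erase he)))).aestronglyMeasurable
    · rw [norm_mul, ← one_mul (K ^ _)]
      refine mul_le_mul (abs_finprod_le_one _ _ fun a _ => hf1 _ _) ?_ (norm_nonneg _) zero_le_one
      rw [Real.norm_eq_abs, Finset.abs_prod, ← Finset.prod_const]
      exact Finset.prod_le_prod (fun _ _ => abs_nonneg _) fun e _ => trunc_le K hK.le _ _ _
  change |∫ z, F z ∂π| ≤ _
  simp_rw [hcase]
  rw [integral_add hGm hint2]
  refine (abs_add_le _ _).trans (add_le_add ?_ ?_)
  · refine good_part ν α hα (E.erase e0) (fun e he => hE.2 e (Finset.mem_of_mem_erase he))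
      (fun e => trunc K (κ e)) (fun e he => trunc_meas K _ (hκ e (Finset.mem_of_mem_erase he)))
      e0 (Finset.notMem_erase _ _) (hE.2 e0 he0) (κ e0) (hκ e0 he0) hwi δ hδ f hf hf1 K hK
      (fun e _ => trunc_le K hK.le _)
  · refine (abs_integral_le_integral_abs).trans ?_
    rw [← ENNReal.ofReal_le_iff_le_toReal hfin]
    refine le_trans (le_of_eq ?_) hle
    rw [eLpNorm_one_eq_lintegral_enorm, ← ofReal_integral_norm_eq_lintegral_enorm hint2]
    rfl

end LDPaux

namespace LDPaux

theorem ker_int {v : ℕ} {Ω : Type*} [MeasurableSpace Ω] (ν : Measure Ω)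
    [IsProbabilityMeasure ν]
    (α : Ω → ℝ) (hα : MeasurePreserving α ν unif01)
    (E : Finset (Fin v × Fin v)) (d : ℕ) (hd : 1 ≤ d) (hE : Deg E d)
    (κ : Fin v × Fin v → ℝ → ℝ → ℝ) (hκ : ∀ e ∈ E, Measurable (Function.uncurry (κ e)))
    (p q : ℝ≥0∞) (hpq : p⁻¹ + q⁻¹ = 1) (hq : 1 ≤ q)
    (hC : ∀ e ∈ E, kerNorm (κ e) (q * d) ≠ ⊤)
    (h : (Fin v → Ω) → ℝ) (hh : Measurable h) (hhp : eLpNorm h p (Measure.pi fun _ => ν) ≠ ⊤) :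
    Integrable (fun z : Fin v → Ω => h z * ∏ e ∈ E, κ e (α (z e.1)) (α (z e.2)))
      (Measure.pi fun _ => ν) := by
  refine memLp_one_iff_integrable.1 ⟨?_, ?_⟩
  · exact (hh.mul (prodKer_meas α hα.measurable E κ hκ)).aestronglyMeasurable
  · exact lt_of_le_of_lt (ker_holder ν α hα E d hd hE κ hκ p q hpq hq h hh)
      (ENNReal.mul_ne_top hhp (ENNReal.prod_ne_top hC)).lt_top

theorem ker_bound {v : ℕ} {Ω : Type*} [MeasurableSpace Ω] (ν : Measure Ω)
    [IsProbabilityMeasure ν]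
    (α : Ω → ℝ) (hα : MeasurePreserving α ν unif01)
    (E : Finset (Fin v × Fin v)) (d : ℕ) (hd : 1 ≤ d) (hE : Deg E d)
    (w : ℝ → ℝ → ℝ) (hw : Measurable (Function.uncurry w))
    (p q : ℝ≥0∞) (hpq : p⁻¹ + q⁻¹ = 1) (hq : 1 ≤ q) (C : ℝ≥0)
    (hC : kerNorm w (q * d) ≤ C)
    (h : (Fin v → Ω) → ℝ) (hh : Measurable h) (hhp : eLpNorm h p (Measure.pi fun _ => ν) ≠ ⊤) :
    |∫ z : Fin v → Ω, h z * ∏ e ∈ E, w (α (z e.1)) (α (z e.2)) ∂(Measure.pi fun _ => ν)| ≤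
      (eLpNorm h p (Measure.pi fun _ => ν)).toReal * C ^ E.card := by
  have hIntg := ker_int ν α hα E d hd hE (fun _ => w) (fun _ _ => hw) p q hpq hq
    (fun _ _ => ne_top_of_le_ne_top ENNReal.coe_ne_top hC) h hh hhp
  have hle := ker_holder ν α hα E d hd hE (fun _ => w) (fun _ _ => hw) p q hpq hq h hh
  refine (abs_integral_le_integral_abs).trans ?_
  have hfin : eLpNorm h p (Measure.pi fun _ => ν) * (C:ℝ≥0∞) ^ E.card ≠ ⊤ :=
    ENNReal.mul_ne_top hhp (by simp)
  have h2 : eLpNorm (fun z : Fin v → Ω => h z * ∏ e ∈ E, w (α (z e.1)) (α (z e.2))) 1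
      (Measure.pi fun _ => ν) ≤ eLpNorm h p (Measure.pi fun _ => ν) * (C:ℝ≥0∞) ^ E.card := by
    refine hle.trans (mul_le_mul' le_rfl ?_)
    rw [← Finset.prod_const]; exact Finset.prod_le_prod' fun _ _ => hC
  have h3 : (eLpNorm h p (Measure.pi fun _ => ν)).toReal * (C:ℝ) ^ E.card =
      (eLpNorm h p (Measure.pi fun _ => ν) * (C:ℝ≥0∞) ^ E.card).toReal := by simp
  rw [h3, ← ENNReal.ofReal_le_iff_le_toReal hfin]
  refine le_trans (le_of_eq ?_) h2
  rw [eLpNorm_one_eq_lintegral_enorm, ← ofReal_integral_norm_eq_lintegral_enorm hIntg]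
  rfl

theorem kerNorm_sub_le (w₁ w₂ : ℝ → ℝ → ℝ) (h₁ : Measurable (Function.uncurry w₁))
    (h₂ : Measurable (Function.uncurry w₂)) {s : ℝ≥0∞} (hs : 1 ≤ s) :
    kerNorm (fun x y => w₁ x y - w₂ x y) s ≤ kerNorm w₁ s + kerNorm w₂ s := by
  unfold kerNorm
  exact eLpNorm_sub_le h₁.aestronglyMeasurable h₂.aestronglyMeasurable hs

theorem telescope {v : ℕ} {Ω : Type*} [MeasurableSpace Ω] (ν : Measure Ω)
    [IsProbabilityMeasure ν]
    (α : Ω → ℝ) (hα : MeasurePreserving α ν unif01)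
    (E : Finset (Fin v × Fin v)) (d : ℕ) (hd : 1 ≤ d) (hE : Deg E d)
    (p q : ℝ≥0∞) (hpq : p⁻¹ + q⁻¹ = 1) (hq : 1 ≤ q) (hp0 : 1 ≤ p) (hp : p ≠ ⊤)
    (C : ℝ≥0) (W₁ W₂ : ℝ → ℝ → ℝ) (hW₁ : Measurable (Function.uncurry W₁))
    (hW₂ : Measurable (Function.uncurry W₂)) (hC₁ : kerNorm W₁ (q * d) ≤ C)
    (hC₂ : kerNorm W₂ (q * d) ≤ C)
    (δ : ℝ) (hδ : CutB (fun x y => W₁ x y - W₂ x y) δ)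
    (f : Fin v → Ω → ℝ) (hf : ∀ a, Measurable (f a)) (hf1 : ∀ a z, |f a z| ≤ 1)
    (K : ℝ) (hK : 1 ≤ K) (hδ0 : 0 ≤ δ) (A : Finset (Fin v × Fin v)) (hA : A ⊆ E) :
    |∫ z : Fin v → Ω, (∏ a, f a (z a)) * (∏ e ∈ E, (if e ∈ A then W₁ else W₂)
        (α (z e.1)) (α (z e.2))) ∂(Measure.pi fun _ => ν) -
      ∫ z : Fin v → Ω, (∏ a, f a (z a)) * (∏ e ∈ E, W₂ (α (z e.1)) (α (z e.2)))
      ∂(Measure.pi fun _ => ν)| ≤ A.card * (4 * K ^ E.card * δ +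
      ((E.card * (((2 * C : ℝ≥0) : ℝ≥0∞) / ENNReal.ofReal K)) ^ (1 / p.toReal) *
        ((2 * C : ℝ≥0) : ℝ≥0∞) ^ E.card).toReal) := by
  classical
  have hqd := one_le_qd hq hd
  have hC2 : (C : ℝ≥0∞) ≤ ((2 * C : ℝ≥0) : ℝ≥0∞) := by
    rw [ENNReal.coe_le_coe]; exact le_mul_of_one_le_left (by positivity) (by norm_num)
  have hfm : Measurable (fun z : Fin v → Ω => ∏ a, f a (z a)) :=
    Finset.measurable_prod _ fun c _ => (hf c).comp (measurable_pi_apply c)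
  have hfp : eLpNorm (fun z : Fin v → Ω => ∏ a, f a (z a)) p (Measure.pi fun _ => ν) ≠ ⊤ := by
    refine (MemLp.of_bound hfm.aestronglyMeasurable 1 (ae_of_all _ fun z => ?_)).2.ne
    exact abs_finprod_le_one _ _ fun _ _ => hf1 _ _
  induction A using Finset.induction_on with
  | empty =>
    have h0 : ∀ e : Fin v × Fin v, (if e ∈ (∅ : Finset (Fin v × Fin v)) then W₁ else W₂) = W₂ :=
      fun e => if_neg (Finset.notMem_empty e)
    rw [integral_congr_ae (g := fun z : Fin v → Ω => (∏ a, f a (z a)) *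
      (∏ e ∈ E, W₂ (α (z e.1)) (α (z e.2)))) (ae_of_all _ fun z => congrArg _
        (Finset.prod_congr rfl fun e _ => congrFun (congrFun (h0 e) _) _)), sub_self, abs_zero,
      Finset.card_empty, Nat.cast_zero, zero_mul]
  | insert e0 A he ih =>
    have ih := ih ((Finset.subset_insert _ _).trans hA)
    have he0 : e0 ∈ E := hA (Finset.mem_insert_self _ _)
    have hIntg : ∀ B : Finset (Fin v × Fin v), Integrable (fun z : Fin v → Ω =>
        (∏ a, f a (z a)) * (∏ e ∈ E, (if e ∈ B then W₁ else W₂)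
        (α (z e.1)) (α (z e.2)))) (Measure.pi fun _ => ν) := by
      intro B
      refine ker_int ν α hα E d hd hE (fun e => if e ∈ B then W₁ else W₂) ?_ p q hpq hq ?_ _ hfm hfp
      · intro e _
        change Measurable (Function.uncurry (if e ∈ B then W₁ else W₂))
        by_cases h : e ∈ B
        · rw [if_pos h]; exact hW₁
        · rw [if_neg h]; exact hW₂
      · intro e _
        change kerNorm (if e ∈ B then W₁ else W₂) (q * d) ≠ ⊤
        by_cases h : e ∈ B
        · rw [if_pos h]
          exact ne_top_of_le_ne_top ENNReal.coe_ne_top hC₁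
        · rw [if_neg h]
          exact ne_top_of_le_ne_top ENNReal.coe_ne_top hC₂
    set κ : Fin v × Fin v → ℝ → ℝ → ℝ := fun e => if e = e0 then (fun x y => W₁ x y - W₂ x y)
      else if e ∈ A then W₁ else W₂ with hκ
    have hcases : ∀ e, κ e = (fun x y => W₁ x y - W₂ x y) ∨ κ e = W₁ ∨ κ e = W₂ := by
      intro e
      by_cases h1 : e = e0
      · exact Or.inl (if_pos h1)
      · by_cases h2 : e ∈ A
        · exact Or.inr (Or.inl ((if_neg h1).trans (if_pos h2)))
        · exact Or.inr (Or.inr ((if_neg h1).trans (if_neg h2)))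
    have hdiff : ∀ z : Fin v → Ω, (∏ a, f a (z a)) * (∏ e ∈ E, (if e ∈ insert e0 A then W₁ else W₂)
        (α (z e.1)) (α (z e.2))) - (∏ a, f a (z a)) * (∏ e ∈ E, (if e ∈ A then W₁ else W₂)
        (α (z e.1)) (α (z e.2))) = (∏ a, f a (z a)) * ∏ e ∈ E, κ e (α (z e.1)) (α (z e.2)) := by
      intro z
      rw [← mul_sub]
      congr 1
      rw [← Finset.prod_erase_mul E _ he0, ← Finset.prod_erase_mul E _ he0,
        ← Finset.prod_erase_mul E _ he0]
      have e1 : ∏ x ∈ E.erase e0, (if x ∈ insert e0 A then W₁ else W₂) (α (z x.1)) (α (z x.2)) =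
          ∏ x ∈ E.erase e0, κ x (α (z x.1)) (α (z x.2)) := by
        refine Finset.prod_congr rfl fun e h => ?_
        have := Finset.ne_of_mem_erase h
        have k1 : κ e = if e ∈ A then W₁ else W₂ := if_neg this
        rw [k1]
        by_cases hh : e ∈ A
        · rw [if_pos hh, if_pos (Finset.mem_insert_of_mem hh)]
        · rw [if_neg hh, if_neg fun h' => (Finset.mem_insert.1 h').elim this hh]
      have e2 : ∏ x ∈ E.erase e0, (if x ∈ A then W₁ else W₂) (α (z x.1)) (α (z x.2)) =
          ∏ x ∈ E.erase e0, κ x (α (z x.1)) (α (z x.2)) := by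
        refine Finset.prod_congr rfl fun e h => ?_
        have := Finset.ne_of_mem_erase h
        have k1 : κ e = if e ∈ A then W₁ else W₂ := if_neg this
        rw [k1]
      rw [e1, e2]
      have h0 : κ e0 = fun x y => W₁ x y - W₂ x y := if_pos rfl
      rw [h0, if_pos (Finset.mem_insert_self _ _), if_neg he]
      ring
    have hone := one_edge ν α hα E d hd hE κ ?_ p q hpq hq hp0 hp (2 * C) ?_ e0 he0 δ hδ0 ?_ f hf
      hf1 K (by linarith)
    · have hI := hIntg (insert e0 A)
      have hI2 := hIntg A
      have e3 : (∫ z : Fin v → Ω, (∏ a, f a (z a)) * (∏ e ∈ E, (if e ∈ insert e0 A then W₁ else W₂)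
        (α (z e.1)) (α (z e.2))) ∂(Measure.pi fun _ => ν)) =
        (∫ z : Fin v → Ω, (∏ a, f a (z a)) * ∏ e ∈ E, κ e (α (z e.1)) (α (z e.2))
          ∂(Measure.pi fun _ => ν)) + ∫ z : Fin v → Ω, (∏ a, f a (z a)) *
          (∏ e ∈ E, (if e ∈ A then W₁ else W₂) (α (z e.1)) (α (z e.2)))
          ∂(Measure.pi fun _ => ν) := by
        rw [← integral_congr_ae (ae_of_all _ hdiff), integral_sub hI hI2]; ring
      rw [e3, Finset.card_insert_of_notMem he]
      have hKc : K ^ (E.erase e0).card ≤ K ^ E.card :=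
        pow_le_pow_right₀ hK (Finset.card_le_card (Finset.erase_subset _ _))
      have h5 : 4 * K ^ (E.erase e0).card * δ ≤ 4 * K ^ E.card * δ := by gcongr
      rw [Nat.cast_add, Nat.cast_one, add_sub_assoc, add_mul, one_mul, add_comm (_ * _)]
      refine (abs_add_le _ _).trans (add_le_add ?_ ih)
      refine hone.trans ?_
      linarith
    · intro e _
      rcases hcases e with h | h | h <;> rw [h]
      · exact hW₁.sub hW₂
      · exact hW₁
      · exact hW₂
    · intro e _
      rcases hcases e with h | h | h <;> rw [h]
      · refine (kerNorm_sub_le W₁ W₂ hW₁ hW₂ hqd).trans ((add_le_add hC₁ hC₂).trans ?_)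
        push_cast; rw [two_mul]
      · exact hC₁.trans hC2
      · exact hC₂.trans hC2
    · have h0 : κ e0 = fun x y => W₁ x y - W₂ x y := if_pos rfl
      rw [h0]; exact hδ

theorem count_aux1 (a b : ℝ) (ha : 0 < a) : a * (b / a) = b := by field_simp

theorem count_aux2 (c b : ℝ) (hc : 0 < c) : c * (b / (2 * c) + b / (2 * c)) = b := by
  field_simp; ring

theorem count_aux3 (c η x ε : ℝ) (hc : 0 ≤ c) (hη : 0 < η) (hx : x < η)
    (he : (c + 1) * (η + η) = ε) : c * (η + x) ≤ ε := by
  have := mul_le_mul_of_nonneg_left hx.le hc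
  nlinarith

theorem count.{u} {v : ℕ} 
    (E : Finset (Fin v × Fin v)) (d : ℕ) (hd : 1 ≤ d) (hE : Deg E d)
    (p q : ℝ≥0∞) (hpq : p⁻¹ + q⁻¹ = 1) (hq : 1 ≤ q) (hp0 : 1 ≤ p) (hp : p ≠ ⊤)
    (C : ℝ≥0) (ε : ℝ) (hε : 0 < ε) : ∃ δ > 0, ∀ W₁ W₂ : ℝ → ℝ → ℝ,
    Measurable (Function.uncurry W₁) → Measurable (Function.uncurry W₂) →
    kerNorm W₁ (q * d) ≤ C → kerNorm W₂ (q * d) ≤ C →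
    CutB (fun x y => W₁ x y - W₂ x y) δ → ∀ (Ω : Type u) [MeasurableSpace Ω] (ν : Measure Ω)
    [IsProbabilityMeasure ν] (α : Ω → ℝ), MeasurePreserving α ν unif01 → 
    ∀ f : Fin v → Ω → ℝ, (∀ a, Measurable (f a)) → (∀ a z, |f a z| ≤ 1) → 
    |∫ z : Fin v → Ω, (∏ a, f a (z a)) * (∏ e ∈ E, W₁ (α (z e.1)) (α (z e.2)))
        ∂(Measure.pi fun _ => ν) -
      ∫ z : Fin v → Ω, (∏ a, f a (z a)) * (∏ e ∈ E, W₂ (α (z e.1)) (α (z e.2)))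
      ∂(Measure.pi fun _ => ν)| ≤ ε := by
  set η : ℝ := ε / (2 * (E.card + 1)) with hη
  have hη0 : 0 < η := by positivity
  have hp00 : p ≠ 0 := (zero_lt_one.trans_le hp0).ne'
  have hpr : 0 < p.toReal := ENNReal.toReal_pos hp00 hp
  have hlim : Tendsto (fun K : ℝ => (E.card * ((2 * C : ℝ) / K)) ^ (1 / p.toReal) *
      (2 * C : ℝ) ^ E.card) atTop (nhds 0) := by
    have h1 : Tendsto (fun K : ℝ => (E.card * ((2 * C : ℝ) / K))) atTop (nhds 0) := by
      have := (tendsto_const_nhds (x := (2 * C : ℝ)) (f := atTop)).div_atTop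
        (tendsto_id (α := ℝ) (x := atTop))
      simpa using this.const_mul (E.card : ℝ)
    have h2 := h1.rpow_const (p := 1 / p.toReal) (Or.inr (by positivity))
    rw [Real.zero_rpow (by positivity)] at h2
    simpa using h2.mul_const ((2 * C : ℝ) ^ E.card)
  obtain ⟨K, hK, hK1⟩ := ((hlim.eventually (gt_mem_nhds hη0)).and (eventually_ge_atTop 1)).exists
  have hK0 : 0 < K := by linarith
  have hK4 : 0 < 4 * K ^ E.card := by positivity
  have hδp : 0 < η / (4 * K ^ E.card) := by positivity
  have hηε : ((E.card : ℝ) + 1) * (η + η) = ε := count_aux2 _ _ (by positivity)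
  refine ⟨η / (4 * K ^ E.card), hδp, ?_⟩
  intro W₁ W₂ hW₁ hW₂ hC₁ hC₂ hcut Ω _ ν _ α hα f hf hf1
  have := telescope ν α hα E d hd hE p q hpq hq hp0 hp C W₁ W₂ hW₁ hW₂ hC₁ hC₂ _ hcut f hf hf1 K hK1
    hδp.le E subset_rfl
  have e1 : ∀ z : Fin v → Ω, ∏ e ∈ E, (if e ∈ E then W₁ else W₂) (α (z e.1)) (α (z e.2)) =
      ∏ e ∈ E, W₁ (α (z e.1)) (α (z e.2)) := fun z =>
    Finset.prod_congr rfl fun e he => by rw [if_pos he]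
  have e4 : ∫ z : Fin v → Ω, (∏ a, f a (z a)) * (∏ e ∈ E, (if e ∈ E then W₁ else W₂)
        (α (z e.1)) (α (z e.2))) ∂(Measure.pi fun _ => ν) =
      ∫ z : Fin v → Ω, (∏ a, f a (z a)) * (∏ e ∈ E, W₁ (α (z e.1)) (α (z e.2)))
        ∂(Measure.pi fun _ => ν) :=
    integral_congr_ae (ae_of_all _ fun z => congrArg _ (e1 z))
  rw [e4] at this
  refine this.trans ?_
  have e2 : 4 * K ^ E.card * (η / (4 * K ^ E.card)) = η := count_aux1 _ _ hK4
  rw [e2]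
  have e3 : ((E.card * (((2 * C : ℝ≥0) : ℝ≥0∞) / ENNReal.ofReal K)) ^ (1 / p.toReal) *
        ((2 * C : ℝ≥0) : ℝ≥0∞) ^ E.card).toReal = (E.card * ((2 * C : ℝ) / K)) ^ (1 / p.toReal) *
      (2 * C : ℝ) ^ E.card := by
    rw [ENNReal.toReal_mul, ← ENNReal.toReal_rpow, ENNReal.toReal_mul, ENNReal.toReal_div,
      ENNReal.toReal_ofReal hK0.le, ENNReal.toReal_pow]
    simp
  rw [e3]
  exact count_aux3 _ _ _ _ (Nat.cast_nonneg _) hη0 hK hηε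

end LDPaux

namespace LDPaux

/-- the polynomial attached to finite-rank data -/
noncomputable def Poly {v k m : ℕ} (E : Finset (Fin v × Fin v)) (κ : Fin k → Fin k → ℝ)
    (g : (Fin v → Fin m) → ℝ) (M : Fin k × Fin m → ℝ) : ℝ :=
  ∑ s : Fin v → Fin k × Fin m, (g (fun a => (s a).2) * ∏ e ∈ E, κ (s e.1).1 (s e.2).1) *
    ∏ a, M (s a)

theorem Poly_cont {v k m : ℕ} (E : Finset (Fin v × Fin v)) (κ : Fin k → Fin k → ℝ)
    (g : (Fin v → Fin m) → ℝ) : Continuous (Poly E κ g) := by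
  unfold Poly
  fun_prop

theorem finite_decomp {v : ℕ} {Ω : Type*} {m : ℕ} (y : Ω → Fin m)
    (g : (Fin v → Fin m) → ℝ) (z : Fin v → Ω) :
    g (fun a => y (z a)) = ∑ s : Fin v → Fin m, g s *
      ∏ a, (y ⁻¹' {s a}).indicator (fun _ => (1:ℝ)) (z a) := by
  classical
  rw [Finset.sum_eq_single (fun a => y (z a))]
  · rw [Finset.prod_eq_one, mul_one]
    intro a _
    exact indicator_of_mem (s := y ⁻¹' {y (z a)}) rfl (fun _ => (1:ℝ))
  · intro s _ hs
    have : ∃ a, s a ≠ y (z a) := by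
      by_contra h
      push Not at h
      exact hs (funext h)
    obtain ⟨a, ha⟩ := this
    rw [Finset.prod_eq_zero (Finset.mem_univ a), mul_zero]
    exact indicator_of_notMem (s := y ⁻¹' {s a}) (fun h => ha (Eq.symm h)) (fun _ => (1:ℝ))
  · intro h; exact absurd (Finset.mem_univ _) h

theorem pi_ind_integral {v : ℕ} {Ω : Type*} [MeasurableSpace Ω] (ν : Measure Ω)
    [IsProbabilityMeasure ν] (A : Fin v → Set Ω) (hA : ∀ a, MeasurableSet (A a)) :
    ∫ z : Fin v → Ω, ∏ a, (A a).indicator (fun _ => (1:ℝ)) (z a) ∂(Measure.pi fun _ => ν) =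
      ∏ a, ν.real (A a) := by
  rw [integral_fintype_prod_eq_prod (fun a => (A a).indicator (fun _ => (1:ℝ)))]
  refine Finset.prod_congr rfl fun a _ => ?_
  rw [integral_indicator (hA a)]
  simp

theorem push {v k m : ℕ} {Ω : Type*} [MeasurableSpace Ω] (ν : Measure Ω)
    [IsProbabilityMeasure ν] (c : Ω → Fin k) (hc : Measurable c) (y : Ω → Fin m)
    (hy : Measurable y) (E : Finset (Fin v × Fin v)) (κ : Fin k → Fin k → ℝ)
    (g : (Fin v → Fin m) → ℝ) :
    ∫ z : Fin v → Ω, g (fun a => y (z a)) * ∏ e ∈ E, κ (c (z e.1)) (c (z e.2))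
      ∂(Measure.pi fun _ => ν) =
    Poly E κ g (fun ij => ν.real {ω | c ω = ij.1 ∧ y ω = ij.2}) := by
  classical
  have hm : ∀ ij : Fin k × Fin m, MeasurableSet {ω | c ω = ij.1 ∧ y ω = ij.2} := fun ij =>
    (hc (measurableSet_singleton ij.1)).inter (hy (measurableSet_singleton ij.2))
  have key : ∀ z : Fin v → Ω, g (fun a => y (z a)) * ∏ e ∈ E, κ (c (z e.1)) (c (z e.2)) =
      ∑ s : Fin v → Fin k × Fin m, (g (fun a => (s a).2) * ∏ e ∈ E, κ (s e.1).1 (s e.2).1) *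
        ∏ a, {ω | c ω = (s a).1 ∧ y ω = (s a).2}.indicator (fun _ => (1:ℝ)) (z a) := by
    intro z
    rw [Finset.sum_eq_single (fun a => (c (z a), y (z a)))]
    · rw [Finset.prod_eq_one (f := fun a => indicator _ _ (z a)), mul_one]
      intro a _
      exact indicator_of_mem (s := {ω | c ω = c (z a) ∧ y ω = y (z a)}) ⟨rfl, rfl⟩ (fun _ => (1:ℝ))
    · intro s _ hs
      have : ∃ a, s a ≠ (c (z a), y (z a)) := by
        by_contra h
        push Not at h
        exact hs (funext h)
      obtain ⟨a, ha⟩ := this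
      rw [Finset.prod_eq_zero (f := fun a => indicator _ _ (z a)) (Finset.mem_univ a), mul_zero]
      exact indicator_of_notMem (s := {ω | c ω = (s a).1 ∧ y ω = (s a).2})
        (fun h => ha (Prod.ext h.1.symm h.2.symm)) (fun _ => (1:ℝ))
    · intro h; exact absurd (Finset.mem_univ _) h
  rw [integral_congr_ae (ae_of_all _ key), integral_finset_sum]
  · unfold Poly
    refine Finset.sum_congr rfl fun s _ => ?_
    rw [integral_const_mul, pi_ind_integral ν (fun a => {ω | c ω = (s a).1 ∧ y ω = (s a).2})
      (fun a => hm (s a))]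
  · intro s _
    refine Integrable.const_mul ?_ _
    refine Integrable.of_bound (C := 1) ?_ (ae_of_all _ fun z => ?_)
    · refine (Finset.measurable_prod _ fun a _ => ?_).aestronglyMeasurable
      exact (measurable_const.indicator (hm (s a))).comp (measurable_pi_apply a)
    · refine abs_finprod_le_one _ _ fun a _ => ?_
      by_cases h : z a ∈ {ω | c ω = (s a).1 ∧ y ω = (s a).2}
      · rw [indicator_of_mem h]; simp
      · rw [indicator_of_notMem h]; simp

theorem count_fin.{u} {v : ℕ}
    (E : Finset (Fin v × Fin v)) (d : ℕ) (hd : 1 ≤ d) (hE : Deg E d)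
    (p q : ℝ≥0∞) (hpq : p⁻¹ + q⁻¹ = 1) (hq : 1 ≤ q) (hp0 : 1 ≤ p) (hp : p ≠ ⊤)
    (C : ℝ≥0) {m : ℕ} (g : (Fin v → Fin m) → ℝ) (ε : ℝ) (hε : 0 < ε) :
    ∃ δ > 0, ∀ W₁ W₂ : ℝ → ℝ → ℝ,
    Measurable (Function.uncurry W₁) → Measurable (Function.uncurry W₂) →
    kerNorm W₁ (q * d) ≤ C → kerNorm W₂ (q * d) ≤ C →
    CutB (fun x y => W₁ x y - W₂ x y) δ → ∀ (Ω : Type u) [MeasurableSpace Ω] (ν : Measure Ω)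
    [IsProbabilityMeasure ν] (α : Ω → ℝ), MeasurePreserving α ν unif01 →
    ∀ y : Ω → Fin m, Measurable y →
    |∫ z : Fin v → Ω, g (fun a => y (z a)) * (∏ e ∈ E, W₁ (α (z e.1)) (α (z e.2)))
        ∂(Measure.pi fun _ => ν) -
      ∫ z : Fin v → Ω, g (fun a => y (z a)) * (∏ e ∈ E, W₂ (α (z e.1)) (α (z e.2)))
      ∂(Measure.pi fun _ => ν)| ≤ ε := by
  set G : ℝ := ∑ s, |g s| with hG
  have hG0 : 0 ≤ G := Finset.sum_nonneg fun _ _ => abs_nonneg _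
  obtain ⟨δ, hδ, H⟩ := count.{u} E d hd hE p q hpq hq hp0 hp C (ε / (G + 1)) (by positivity)
  refine ⟨δ, hδ, ?_⟩
  intro W₁ W₂ hW₁ hW₂ hC₁ hC₂ hcut Ω _ ν _ α hα y hy
  have hfm : ∀ (s : Fin v → Fin m) (a : Fin v),
      Measurable ((y ⁻¹' {s a}).indicator (fun _ => (1:ℝ))) := fun s a =>
    measurable_const.indicator (hy (measurableSet_singleton _))
  have hf1 : ∀ (s : Fin v → Fin m) (a : Fin v) (z : Ω),
      |(y ⁻¹' {s a}).indicator (fun _ => (1:ℝ)) z| ≤ 1 := by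
    intro s a z
    by_cases h : z ∈ y ⁻¹' {s a}
    · rw [indicator_of_mem h]; simp
    · rw [indicator_of_notMem h]; simp
  have hfm' : ∀ s : Fin v → Fin m, Measurable (fun z : Fin v → Ω =>
      ∏ a, (y ⁻¹' {s a}).indicator (fun _ => (1:ℝ)) (z a)) := fun s =>
    Finset.measurable_prod _ fun c _ => (hfm s c).comp (measurable_pi_apply c)
  have hfp : ∀ s : Fin v → Fin m, eLpNorm (fun z : Fin v → Ω =>
      ∏ a, (y ⁻¹' {s a}).indicator (fun _ => (1:ℝ)) (z a)) p (Measure.pi fun _ => ν) ≠ ⊤ := by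
    intro s
    refine (MemLp.of_bound (hfm' s).aestronglyMeasurable 1 (ae_of_all _ fun z => ?_)).2.ne
    exact abs_finprod_le_one _ _ fun _ _ => hf1 _ _ _
  have hexp : ∀ W : ℝ → ℝ → ℝ, Measurable (Function.uncurry W) → kerNorm W (q * d) ≤ C →
      ∫ z : Fin v → Ω, g (fun a => y (z a)) * (∏ e ∈ E, W (α (z e.1)) (α (z e.2)))
        ∂(Measure.pi fun _ => ν) = ∑ s : Fin v → Fin m, g s * ∫ z : Fin v → Ω,
        (∏ a, (y ⁻¹' {s a}).indicator (fun _ => (1:ℝ)) (z a)) *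
          (∏ e ∈ E, W (α (z e.1)) (α (z e.2))) ∂(Measure.pi fun _ => ν) := by
    intro W hW hC
    simp_rw [← integral_const_mul]
    rw [← integral_finset_sum]
    · refine integral_congr_ae (ae_of_all _ fun z => ?_)
      simp only
      rw [finite_decomp y g z, Finset.sum_mul]
      refine Finset.sum_congr rfl fun s _ => by ring
    · intro s _
      exact (ker_int ν α hα E d hd hE (fun _ => W) (fun _ _ => hW) p q hpq hq
        (fun _ _ => ne_top_of_le_ne_top ENNReal.coe_ne_top hC) _ (hfm' s) (hfp s)).const_mul _
  rw [hexp W₁ hW₁ hC₁, hexp W₂ hW₂ hC₂, ← Finset.sum_sub_distrib]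
  refine (Finset.abs_sum_le_sum_abs _ _).trans ?_
  calc _ ≤ ∑ s, |g s| * (ε / (G + 1)) := by
        refine Finset.sum_le_sum fun s _ => ?_
        rw [← mul_sub, abs_mul]
        refine mul_le_mul_of_nonneg_left ?_ (abs_nonneg _)
        exact H W₁ W₂ hW₁ hW₂ hC₁ hC₂ hcut Ω ν α hα _ (hfm s) (hf1 s)
    _ = G * (ε / (G + 1)) := by rw [← Finset.sum_mul]
    _ ≤ (G + 1) * (ε / (G + 1)) := by gcongr; linarith
    _ = ε := by field_simp

end LDPaux

open scoped ENNReal NNReal symmDiff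

namespace LDPaux

/-- finite-rank functions -/
def FR {J S : Type*} [MeasurableSpace S] (f : (J → S) → ℝ) : Prop :=
  ∃ (k : ℕ) (c : S → Fin k), Measurable c ∧ ∃ g : (J → Fin k) → ℝ, f = fun z => g (fun a => c (z a))

theorem common_ref {S : Type*} [MeasurableSpace S] {k₁ k₂ : ℕ} (c₁ : S → Fin k₁) (c₂ : S → Fin k₂)
    (h₁ : Measurable c₁) (h₂ : Measurable c₂) :
    ∃ (k : ℕ) (c : S → Fin k) (π₁ : Fin k → Fin k₁) (π₂ : Fin k → Fin k₂), Measurable c ∧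
      (∀ x, π₁ (c x) = c₁ x) ∧ ∀ x, π₂ (c x) = c₂ x := by
  refine ⟨k₁ * k₂, fun x => finProdFinEquiv (c₁ x, c₂ x), fun i => (finProdFinEquiv.symm i).1,
    fun i => (finProdFinEquiv.symm i).2, ?_, ?_, ?_⟩
  · exact (measurable_of_finite (f := finProdFinEquiv)).comp (h₁.prodMk h₂)
  · intro x; simp
  · intro x; simp

theorem FR.add {J S : Type*} [MeasurableSpace S] {f₁ f₂ : (J → S) → ℝ} (h₁ : FR f₁) (h₂ : FR f₂) :
    FR (f₁ + f₂) := by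
  obtain ⟨k₁, c₁, m₁, g₁, rfl⟩ := h₁
  obtain ⟨k₂, c₂, m₂, g₂, rfl⟩ := h₂
  obtain ⟨k, c, π₁, π₂, hc, e₁, e₂⟩ := common_ref c₁ c₂ m₁ m₂
  refine ⟨k, c, hc, fun s => g₁ (fun a => π₁ (s a)) + g₂ (fun a => π₂ (s a)), ?_⟩
  ext z
  simp [e₁, e₂]

theorem FR.meas {J S : Type*} [Finite J] [MeasurableSpace S] {f : (J → S) → ℝ} (h : FR f) :
    Measurable f := by
  obtain ⟨k, c, m, g, rfl⟩ := h
  have : Measurable (fun z : J → S => fun a => c (z a)) := by fun_prop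
  exact (measurable_of_finite g).comp this

/-- finite-rank sets -/
def FRS (J S : Type*) [MeasurableSpace S] : Set (Set (J → S)) :=
  {A | ∃ (k : ℕ) (c : S → Fin k), Measurable c ∧ ∃ B : Set (J → Fin k),
    A = {z | (fun a => c (z a)) ∈ B}}

theorem FRS_ring (J S : Type*) [MeasurableSpace S] : IsSetRing (FRS J S) where
  empty_mem := by
    refine ⟨1, fun _ => 0, measurable_const, ∅, ?_⟩
    ext; simp
  union_mem := by
    rintro _ _ ⟨k₁, c₁, m₁, B₁, rfl⟩ ⟨k₂, c₂, m₂, B₂, rfl⟩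
    obtain ⟨k, c, π₁, π₂, hc, e₁, e₂⟩ := common_ref c₁ c₂ m₁ m₂
    refine ⟨k, c, hc, {s | (fun a => π₁ (s a)) ∈ B₁ ∨ (fun a => π₂ (s a)) ∈ B₂}, ?_⟩
    ext z; simp [e₁, e₂]
  sdiff_mem := by
    rintro _ _ ⟨k₁, c₁, m₁, B₁, rfl⟩ ⟨k₂, c₂, m₂, B₂, rfl⟩
    obtain ⟨k, c, π₁, π₂, hc, e₁, e₂⟩ := common_ref c₁ c₂ m₁ m₂
    refine ⟨k, c, hc, {s | (fun a => π₁ (s a)) ∈ B₁ ∧ ¬ (fun a => π₂ (s a)) ∈ B₂}, ?_⟩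
    ext z; simp [e₁, e₂]

theorem FRS_gen (J S : Type*) [Finite J] [MeasurableSpace S] :
    (MeasurableSpace.pi : MeasurableSpace (J → S)) = MeasurableSpace.generateFrom (FRS J S) := by
  classical
  apply le_antisymm
  · refine iSup_le fun a => ?_
    rintro _ ⟨s, hs, rfl⟩
    refine MeasurableSpace.measurableSet_generateFrom ?_
    refine ⟨2, fun x => if x ∈ s then 1 else 0, ?_, {t | t a = 1}, ?_⟩
    · exact Measurable.ite hs measurable_const measurable_const
    · ext z
      by_cases h : z a ∈ s <;> simp [h]
  · refine MeasurableSpace.generateFrom_le ?_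
    rintro _ ⟨k, c, m, B, rfl⟩
    have : Measurable (fun z : J → S => fun a => c (z a)) := by fun_prop
    exact this (Set.toFinite B).measurableSet

theorem dense_Lp {J S : Type*} [Finite J] [MeasurableSpace S] (π : Measure (J → S))
    [IsFiniteMeasure π] (p : ℝ≥0∞) (hp : p ≠ ⊤) (hp0 : p ≠ 0) (f : (J → S) → ℝ) (hf : MemLp f p π) (ε : ℝ≥0∞)
    (hε : ε ≠ 0) : ∃ g, eLpNorm (f - g) p π ≤ ε ∧ FR g := by
  refine MemLp.induction_dense hp FR ?_ (fun f g hf hg => hf.add hg)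
    (fun f hf => hf.meas.aestronglyMeasurable) hf hε
  intro c s hs _ ε hε
  obtain ⟨η, hη0, hη⟩ : ∃ η : ℝ≥0∞, 0 < η ∧ ‖c‖ₑ * η ^ (1 / p.toReal) ≤ ε := by
    have h1 : Tendsto (fun η : ℝ≥0∞ => ‖c‖ₑ * η ^ (1 / p.toReal)) (nhds 0) (nhds 0) := by
      have h2 : Tendsto (fun η : ℝ≥0∞ => η ^ (1 / p.toReal)) (nhds 0) (nhds 0) := by
        have := (ENNReal.continuous_rpow_const (y := 1 / p.toReal)).tendsto 0
        rwa [ENNReal.zero_rpow_of_pos (by have := ENNReal.toReal_pos hp0 hp; positivity)] at this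
      have := ENNReal.Tendsto.const_mul (a := ‖c‖ₑ) h2 (Or.inr (by simp))
      simpa using this
    have h3 := (h1.mono_left (nhdsWithin_le_nhds (s := Ioi 0))).eventually
      (ge_mem_nhds (pos_iff_ne_zero.2 hε))
    obtain ⟨η, h4, h5⟩ := (h3.and self_mem_nhdsWithin).exists
    exact ⟨η, h5, h4⟩
  obtain ⟨t, ht, htε⟩ := exists_measure_symmDiff_lt_of_generateFrom_isSetRing (μ := π)
    (FRS_ring J S) ⟨{univ}, countable_singleton _, by
      rintro _ rfl
      exact ⟨1, fun _ => 0, measurable_const, univ, by ext; simp⟩, by simp⟩ (FRS_gen J S) hs hη0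
  have htm : MeasurableSet t := by rw [FRS_gen J S]; exact MeasurableSpace.measurableSet_generateFrom ht
  refine ⟨t.indicator fun _ => c, ?_, ?_⟩
  · have h1 : eLpNorm ((t.indicator fun _ => c) - s.indicator fun _ => c) p π ≤
        eLpNorm ((t ∆ s).indicator fun _ => c) p π := by
      refine eLpNorm_mono fun z => ?_
      by_cases h1 : z ∈ t <;> by_cases h2 : z ∈ s <;> simp [h1, h2, Set.mem_symmDiff, indicator]
    refine h1.trans ?_
    rw [eLpNorm_indicator_const (htm.symmDiff hs) hp0 hp]
    refine le_trans ?_ hη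
    gcongr
  · classical
    obtain ⟨k, y, hy, B, rfl⟩ := ht
    refine ⟨k, y, hy, B.indicator fun _ => c, ?_⟩
    ext z
    rfl

theorem dense_bdd {J S : Type*} [Finite J] [MeasurableSpace S] (π : Measure (J → S))
    [IsFiniteMeasure π] (f : (J → S) → ℝ) (hf : Measurable f)
    (K : ℝ) (hK : ∀ z, |f z| ≤ K) (hK0 : 0 ≤ K) (ε : ℝ≥0∞) (hε : ε ≠ 0) :
    ∃ (k : ℕ) (c : S → Fin k) (g : (J → Fin k) → ℝ), Measurable c ∧ (∀ s, |g s| ≤ K) ∧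
      eLpNorm (fun z => f z - g (fun a => c (z a))) 1 π ≤ ε := by
  have hfp : MemLp f 1 π := MemLp.of_bound hf.aestronglyMeasurable K (ae_of_all _ hK)
  obtain ⟨_, h1, k, c, hc, g, rfl⟩ := dense_Lp π 1 (by simp) (by simp) f hfp ε hε
  refine ⟨k, c, fun s => max (-K) (min (g s) K), hc, ?_, ?_⟩
  · intro s
    rw [abs_le]
    exact ⟨le_max_left _ _, max_le (by linarith) (min_le_right _ _)⟩
  · refine le_trans (eLpNorm_mono fun z => ?_) h1
    simp only [Pi.sub_apply, Real.norm_eq_abs]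
    have h2 := abs_le.1 (hK z)
    set a := f z
    set b := g fun a => c (z a)
    rcases le_total b K with h3 | h3
    · rw [min_eq_left h3]
      rcases le_total (-K) b with h4 | h4
      · rw [max_eq_right h4]
      · rw [max_eq_left h4, abs_of_nonneg (by linarith), abs_of_nonneg (by linarith)]
        linarith
    · rw [min_eq_right h3, max_eq_right (by linarith), abs_of_nonpos (by linarith),
        abs_of_nonpos (by linarith)]
      linarith

end LDPaux

namespace LDPaux

theorem CutB_of_L1 (w : ℝ → ℝ → ℝ) (hw : Measurable (Function.uncurry w)) (δ : ℝ) (hδ : 0 ≤ δ)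
    (h : kerNorm w 1 ≤ ENNReal.ofReal δ) : CutB w δ := by
  intro S T hS hT
  have hi := ker_integrable w hw le_rfl (ne_top_of_le_ne_top ENNReal.ofReal_ne_top h)
  have h1 : ∫ z, |w z.1 z.2| ∂(unif01.prod unif01) ≤ δ := by
    have := integral_norm_eq_lintegral_enorm (μ := unif01.prod unif01)
      (f := fun z : ℝ × ℝ => w z.1 z.2) hw.aestronglyMeasurable
    simp only [Real.norm_eq_abs] at this
    rw [this]
    refine ENNReal.toReal_le_of_le_ofReal hδ ?_
    unfold kerNorm at h
    rwa [eLpNorm_one_eq_lintegral_enorm] at h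
  refine le_trans ?_ h1
  rw [← Real.norm_eq_abs]
  refine norm_integral_le_of_norm_le hi.abs (ae_of_all _ fun z => ?_)
  rw [norm_mul, norm_mul]
  have a1 : ‖S.indicator (fun _ => (1:ℝ)) z.1‖ ≤ 1 := by
    by_cases hz : z.1 ∈ S <;> simp [hz]
  have a2 : ‖T.indicator (fun _ => (1:ℝ)) z.2‖ ≤ 1 := by
    by_cases hz : z.2 ∈ T <;> simp [hz]
  calc _ ≤ 1 * 1 * ‖w z.1 z.2‖ := by gcongr
    _ = _ := by simp [Function.uncurry]

/-- the finite sigma-algebra generated by a partition -/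
noncomputable def cm {k : ℕ} (c : ℝ → Fin k) : MeasurableSpace (ℝ × ℝ) :=
  MeasurableSpace.comap (fun z : ℝ × ℝ => (c z.1, c z.2)) inferInstance

theorem cond_cut {k : ℕ} (c : ℝ → Fin k) (hc : Measurable c) (D : ℝ → ℝ → ℝ)
    (hD : Measurable (Function.uncurry D))
    (hDi : Integrable (Function.uncurry D) (unif01.prod unif01)) (δ : ℝ) (hδ : CutB D δ) :
    eLpNorm ((unif01.prod unif01)[Function.uncurry D | cm c]) 1 (unif01.prod unif01) ≤
      ENNReal.ofReal (k ^ 2 * δ) := by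
  set u2 := unif01.prod unif01 with hu2
  have hcc : Measurable (fun z : ℝ × ℝ => (c z.1, c z.2)) :=
    (hc.comp measurable_fst).prodMk (hc.comp measurable_snd)
  have hmle : cm c ≤ Prod.instMeasurableSpace := hcc.comap_le
  have hsm : StronglyMeasurable[cm c] (u2[Function.uncurry D | cm c]) := stronglyMeasurable_condExp
  obtain ⟨g, hg, hgc⟩ : ∃ h : Fin k × Fin k → ℝ, StronglyMeasurable h ∧
      u2[Function.uncurry D | cm c] = h ∘ (fun z : ℝ × ℝ => (c z.1, c z.2)) := hsm.exists_eq_measurable_comp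
  set s : ℝ × ℝ → ℝ := fun z => SignType.sign (g (c z.1, c z.2)) with hs
  have hsg : ∀ ij, |((SignType.sign (g ij) : SignType) : ℝ)| ≤ 1 := by
    intro ij
    rcases lt_trichotomy (g ij) 0 with h | h | h
    · simp [sign_neg h]
    · simp [h]
    · simp [sign_pos h]
  have hs1 : ∀ z, ‖s z‖ ≤ 1 := fun z => hsg _
  have hsmeas : StronglyMeasurable[cm c] s := by
    have : Measurable[cm c] (fun z : ℝ × ℝ => (c z.1, c z.2)) := comap_measurable _
    exact ((measurable_of_finite
      (fun ij : Fin k × Fin k => ((SignType.sign (g ij) : SignType) : ℝ))).comp this).stronglyMeasurable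
  have hsD : Integrable (s * Function.uncurry D) u2 :=
    hDi.bdd_mul (hsmeas.mono hmle).aestronglyMeasurable (ae_of_all _ hs1)
  have h1 := condExp_mul_of_stronglyMeasurable_left (m := cm c) (μ := u2) hsmeas hsD hDi
  have h2 := integral_condExp (μ := u2) (f := s * Function.uncurry D) hmle
  rw [integral_congr_ae h1] at h2
  have h3 : ∫ z, |(u2[Function.uncurry D | cm c]) z| ∂u2 = ∫ z, (s * Function.uncurry D) z ∂u2 := by
    rw [← h2]
    refine integral_congr_ae (ae_of_all _ fun z => ?_)
    simp only [Pi.mul_apply, hs]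
    have : (u2[Function.uncurry D | cm c]) z = g (c z.1, c z.2) := by rw [hgc]; rfl
    rw [this, mul_comm]
    exact (self_mul_sign _).symm
  have h4 : ∫ z, (s * Function.uncurry D) z ∂u2 ≤ k ^ 2 * δ := by
    have e : ∀ z : ℝ × ℝ, (s * Function.uncurry D) z = ∑ ij : Fin k × Fin k,
        ((SignType.sign (g ij) : SignType) : ℝ) *
          ((c ⁻¹' {ij.1}).indicator (fun _ => (1:ℝ)) z.1 *
          (c ⁻¹' {ij.2}).indicator (fun _ => (1:ℝ)) z.2 * D z.1 z.2) := by
      intro z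
      rw [Finset.sum_eq_single (c z.1, c z.2)]
      · simp [hs, Function.uncurry]
      · rintro ⟨i, j⟩ - hij
        by_cases h1 : c z.1 = i
        · by_cases h2 : c z.2 = j
          · exact absurd (by rw [h1, h2]) hij
          · simp [h2]
        · simp [h1]
      · simp
    rw [integral_congr_ae (ae_of_all _ e), integral_finsetSum]
    · refine (Finset.sum_le_sum (g := fun _ => δ) fun ij _ => ?_).trans ?_
      · rw [integral_const_mul]
        refine (le_abs_self _).trans ?_
        rw [abs_mul]
        have := hδ (c ⁻¹' {ij.1}) (c ⁻¹' {ij.2}) (hc (measurableSet_singleton _))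
          (hc (measurableSet_singleton _))
        calc _ ≤ 1 * δ := mul_le_mul (hsg _) this (abs_nonneg _) zero_le_one
          _ = δ := one_mul _
      · simp [Fintype.card_prod]; ring_nf; rfl
    · intro ij _
      refine Integrable.const_mul ?_ _
      refine hDi.bdd_mul (c := 1) (f := fun z : ℝ × ℝ => (c ⁻¹' {ij.1}).indicator (fun _ => (1:ℝ)) z.1 *
          (c ⁻¹' {ij.2}).indicator (fun _ => (1:ℝ)) z.2) ?_ (ae_of_all _ fun z => ?_)
      · refine Measurable.aestronglyMeasurable ?_
        refine Measurable.mul ?_ ?_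
        · exact (measurable_const.indicator (hc (measurableSet_singleton _))).comp measurable_fst
        · exact (measurable_const.indicator (hc (measurableSet_singleton _))).comp measurable_snd
      · by_cases h1 : c z.1 = ij.1 <;> by_cases h2 : c z.2 = ij.2 <;> simp [h1, h2]
  rw [eLpNorm_one_eq_lintegral_enorm]
  have h5 := integral_norm_eq_lintegral_enorm (μ := u2)
      (f := u2[Function.uncurry D | cm c]) integrable_condExp.aestronglyMeasurable
  simp only [Real.norm_eq_abs] at h5
  rw [h3] at h5
  rw [← ENNReal.ofReal_toReal (a := ∫⁻ z, ‖(u2[Function.uncurry D | cm c]) z‖ₑ ∂u2), ← h5]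
  · exact ENNReal.ofReal_le_ofReal h4
  · exact (integrable_condExp (m := cm c) (μ := u2) (f := Function.uncurry D)).2.ne

/-- Fatou for L¹ convergent sequences -/
theorem fatou_L1 {Ω : Type*} [MeasurableSpace Ω] (π : Measure Ω) (f : ℕ → Ω → ℝ) (g : Ω → ℝ)
    (hf : ∀ n, AEStronglyMeasurable (f n) π) (hg : AEStronglyMeasurable g π)
    (h : Tendsto (fun n => eLpNorm (f n - g) 1 π) atTop (nhds 0)) (s : ℝ≥0∞) (C : ℝ≥0∞)
    (hC : ∀ᶠ n in atTop, eLpNorm (f n) s π ≤ C) : eLpNorm g s π ≤ C := by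
  obtain ⟨ns, hns, hlim⟩ := (tendstoInMeasure_of_tendsto_eLpNorm one_ne_zero hf hg h).exists_seq_tendsto_ae
  refine (Lp.eLpNorm_lim_le_liminf_eLpNorm (f := fun i => f (ns i)) (fun n => hf _) g hlim).trans ?_
  refine liminf_le_of_frequently_le' ?_
  exact (hns.tendsto_atTop.eventually hC).frequently

theorem norm_approx (W : ℝ → ℝ → ℝ) (hW : Measurable (Function.uncurry W)) (hW1 : kerNorm W 1 ≠ ⊤)
    (s : ℝ≥0∞) (hs : 1 ≤ s) (C : ℝ≥0∞) (hC : C ≠ ⊤) (w : ℕ → ℝ → ℝ → ℝ)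
    (hw : ∀ n, Measurable (Function.uncurry (w n)))
    (hws : ∀ᶠ n in atTop, kerNorm (w n) s ≤ C)
    (hcut : ∀ δ > 0, ∀ᶠ n in atTop, CutB (fun x y => w n x y - W x y) δ) (ε : ℝ≥0∞) (hε : ε ≠ 0) :
    ∃ (k : ℕ) (c : ℝ → Fin k) (κ : Fin k → Fin k → ℝ), Measurable c ∧
      kerNorm (fun x y => κ (c x) (c y)) s ≤ C ∧
      kerNorm (fun x y => W x y - κ (c x) (c y)) 1 ≤ ε := by
  set u2 := unif01.prod unif01 with hu2
  have hWi := ker_integrable W hW le_rfl hW1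
  obtain ⟨_, h1, k, c, hc, g, rfl⟩ := dense_Lp (Measure.pi fun _ : Fin 2 => unif01) 1 (by simp)
    (by simp) (fun z => W (z 0) (z 1)) (by
      exact (memLp_one_iff_integrable.2 hWi).comp_measurePreserving
        (measurePreserving_finTwoArrow unif01)) (ε / 2) (by simpa using hε)
  have hcc : Measurable (fun z : ℝ × ℝ => (c z.1, c z.2)) :=
    (hc.comp measurable_fst).prodMk (hc.comp measurable_snd)
  have hmle : cm c ≤ Prod.instMeasurableSpace := hcc.comap_le
  have hsm : StronglyMeasurable[cm c] (u2[Function.uncurry W | cm c]) := stronglyMeasurable_condExp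
  obtain ⟨κ, hκ, hκc⟩ : ∃ h : Fin k × Fin k → ℝ, StronglyMeasurable h ∧
      u2[Function.uncurry W | cm c] = h ∘ (fun z : ℝ × ℝ => (c z.1, c z.2)) := hsm.exists_eq_measurable_comp
  set G : ℝ × ℝ → ℝ := fun z => g (fun a : Fin 2 => c (![z.1, z.2] a)) with hG
  have hGm : StronglyMeasurable[cm c] G := by
    have h1 : Measurable[cm c] (fun z : ℝ × ℝ => (c z.1, c z.2)) := comap_measurable _
    have : G = (fun ij : Fin k × Fin k => g ![ij.1, ij.2]) ∘ (fun z : ℝ × ℝ => (c z.1, c z.2)) := by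
      ext z
      simp only [hG, Function.comp]
      congr 1
      ext a
      fin_cases a <;> rfl
    rw [this]
    exact ((measurable_of_finite (fun ij : Fin k × Fin k => g ![ij.1, ij.2])).comp h1).stronglyMeasurable
  have hGm' := (hGm.mono hmle)
  have h2 : eLpNorm (Function.uncurry W - G) 1 u2 ≤ ε / 2 := by
    refine le_trans (le_of_eq ?_) h1
    rw [← eLpNorm_comp_measurePreserving (hW.aestronglyMeasurable.sub hGm'.aestronglyMeasurable)
      (measurePreserving_finTwoArrow unif01)]
    congr 1
    ext z
    simp only [hG, Function.comp, Pi.sub_apply]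
    congr 2
    ext a
    fin_cases a <;> rfl
  have hGi : Integrable G u2 := by
    by_cases he : ε = ⊤
    · obtain ⟨B, hB⟩ : ∃ B, ∀ z, ‖G z‖ ≤ B := by
        refine ⟨∑ s, |g s|, fun z => ?_⟩
        exact Finset.single_le_sum (f := fun s => |g s|) (fun _ _ => abs_nonneg _) (Finset.mem_univ _)
      exact Integrable.of_bound hGm'.aestronglyMeasurable B (ae_of_all _ hB)
    · have : Integrable (Function.uncurry W - G) u2 :=
        memLp_one_iff_integrable.1 ⟨hW.aestronglyMeasurable.sub hGm'.aestronglyMeasurable,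
          h2.trans_lt (ENNReal.div_lt_top he (by simp))⟩
      have h3 := hWi.sub this
      simpa using h3
  refine ⟨k, c, fun i j => κ (i, j), hc, ?_, ?_⟩
  · have hk : kerNorm (fun x y => κ (c x, c y)) s = eLpNorm (u2[Function.uncurry W | cm c]) s u2 := by
      rw [hκc]; rfl
    rw [hk]
    refine fatou_L1 u2 (fun n => u2[Function.uncurry (w n) | cm c]) _
      (fun n => integrable_condExp.aestronglyMeasurable) integrable_condExp.aestronglyMeasurable ?_ s C ?_
    · rw [ENNReal.tendsto_nhds_zero]
      intro η hη
      obtain ⟨δ, hδ, hδη⟩ : ∃ δ > 0, ENNReal.ofReal (k ^ 2 * δ) ≤ η := by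
        rcases eq_or_ne η ⊤ with h | h
        · exact ⟨1, one_pos, h ▸ le_top⟩
        · refine ⟨η.toReal / (k ^ 2 + 1), div_pos (ENNReal.toReal_pos hη.ne' h) (by positivity), ?_⟩
          refine ENNReal.ofReal_le_of_le_toReal ?_
          rw [mul_div_assoc', div_le_iff₀ (by positivity)]
          nlinarith [ENNReal.toReal_nonneg (a := η)]
      filter_upwards [hcut δ hδ, hws] with n hn hn2
      have hwi := ker_integrable (w n) (hw n) hs (ne_top_of_le_ne_top hC hn2)
      have := cond_cut c hc (fun x y => w n x y - W x y) ((hw n).sub hW) (hwi.sub hWi) δ hn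
      refine le_trans (le_of_eq ?_) (this.trans hδη)
      refine eLpNorm_congr_ae ?_
      exact (condExp_sub hwi hWi (cm c)).symm
    · filter_upwards [hws] with n hn
      exact (eLpNorm_condExp_le_eLpNorm _ hs).trans hn
  · have hk : kerNorm (fun x y => W x y - κ (c x, c y)) 1 =
        eLpNorm (Function.uncurry W - u2[Function.uncurry W | cm c]) 1 u2 := by
      rw [hκc]; rfl
    rw [hk]
    have e1 : eLpNorm (Function.uncurry W - u2[Function.uncurry W | cm c]) 1 u2 =
        eLpNorm ((Function.uncurry W - G) + u2[G - Function.uncurry W | cm c]) 1 u2 := by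
      refine eLpNorm_congr_ae ?_
      have h3 := condExp_sub hGi hWi (cm c)
      have h4 : u2[G | cm c] = G := condExp_of_stronglyMeasurable hmle hGm hGi
      rw [h4] at h3
      filter_upwards [h3] with z hz
      simp only [Pi.add_apply, Pi.sub_apply, hz]
      ring
    rw [e1]
    refine (eLpNorm_add_le (hW.aestronglyMeasurable.sub hGm'.aestronglyMeasurable)
      integrable_condExp.aestronglyMeasurable le_rfl).trans ?_
    rw [← ENNReal.add_halves ε]
    refine add_le_add h2 ((eLpNorm_condExp_le_eLpNorm _ le_rfl).trans ?_)
    rw [← eLpNorm_neg]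
    simpa using h2

theorem norm_limit (W : ℝ → ℝ → ℝ) (hW : Measurable (Function.uncurry W)) (hW1 : kerNorm W 1 ≠ ⊤)
    (s : ℝ≥0∞) (hs : 1 ≤ s) (C : ℝ≥0∞) (hC : C ≠ ⊤) (w : ℕ → ℝ → ℝ → ℝ)
    (hw : ∀ n, Measurable (Function.uncurry (w n)))
    (hws : ∀ᶠ n in atTop, kerNorm (w n) s ≤ C)
    (hcut : ∀ δ > 0, ∀ᶠ n in atTop, CutB (fun x y => w n x y - W x y) δ) : kerNorm W s ≤ C := by
  have := fun n : ℕ => norm_approx W hW hW1 s hs C hC w hw hws hcut ((n : ℝ≥0∞) + 1)⁻¹ (by simp)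
  choose k c κ hc h1 h2 using this
  have hm : ∀ n, AEStronglyMeasurable (fun z : ℝ × ℝ => κ n (c n z.1) (c n z.2)) (unif01.prod unif01) := by
    intro n
    have := hc n
    have hcc : Measurable (fun z : ℝ × ℝ => (c n z.1, c n z.2)) := by fun_prop
    exact ((measurable_of_finite (fun ij : Fin (k n) × Fin (k n) => κ n ij.1 ij.2)).comp hcc).aestronglyMeasurable
  refine fatou_L1 (unif01.prod unif01) (fun n z => κ n (c n z.1) (c n z.2)) _ hm
    hW.aestronglyMeasurable ?_ s C (Eventually.of_forall h1)
  refine tendsto_of_tendsto_of_tendsto_of_le_of_le tendsto_const_nhds (h := fun n : ℕ => ((n : ℝ≥0∞) + 1)⁻¹)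
    ?_ (fun n => zero_le) (fun n => ?_)
  · have := (tendsto_add_atTop_iff_nat 1).2 ENNReal.tendsto_inv_nat_nhds_zero
    simpa using this
  · rw [← eLpNorm_neg]
    refine le_trans (le_of_eq ?_) (h2 n)
    unfold kerNorm
    congr 1
    ext z
    simp [Function.uncurry]

end LDPaux

namespace LDPaux

/-- Variational (Donsker-Varadhan) form of an entropy bound. -/
def EntL {Ω : Type*} [MeasurableSpace Ω] (ν ρ : Measure Ω) (c : ℝ) : Prop :=
  ∀ g : Ω → ℝ, Measurable g → (∃ B, ∀ x, |g x| ≤ B) →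
    ∫ x, g x ∂ν ≤ c + Real.log (∫ x, Real.exp (g x) ∂ρ)

theorem bint {Ω : Type*} [MeasurableSpace Ω] (ν : Measure Ω) [IsFiniteMeasure ν] {g : Ω → ℝ}
    (hg : Measurable g) (hB : ∃ B, ∀ x, |g x| ≤ B) : Integrable g ν := by
  obtain ⟨B, hB⟩ := hB
  exact Integrable.of_bound hg.aestronglyMeasurable B (ae_of_all _ hB)

theorem bexp {Ω : Type*} {g : Ω → ℝ} (hB : ∃ B, ∀ x, |g x| ≤ B) :
    ∃ B, ∀ x, |Real.exp (g x)| ≤ B := by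
  obtain ⟨B, hB⟩ := hB
  refine ⟨Real.exp B, fun x => ?_⟩
  rw [abs_of_pos (Real.exp_pos _)]
  exact Real.exp_le_exp.2 ((le_abs_self _).trans (hB x))

theorem exp_int_bounds {Ω : Type*} [MeasurableSpace Ω] (ν : Measure Ω) [IsProbabilityMeasure ν]
    {g : Ω → ℝ} (hg : Measurable g) {B : ℝ} (hB : ∀ x, |g x| ≤ B) :
    Real.exp (-B) ≤ ∫ x, Real.exp (g x) ∂ν ∧ ∫ x, Real.exp (g x) ∂ν ≤ Real.exp B := by
  have hi := bint ν (Real.measurable_exp.comp hg) (bexp ⟨B, hB⟩)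
  constructor
  · have := integral_mono (μ := ν) (integrable_const (Real.exp (-B))) hi
      (fun x => Real.exp_le_exp.2 (abs_le.1 (hB x)).1)
    simpa using this
  · have := integral_mono (μ := ν) hi (integrable_const (Real.exp B))
      (fun x => Real.exp_le_exp.2 (abs_le.1 (hB x)).2)
    simpa using this

theorem EntL.mono {Ω : Type*} [MeasurableSpace Ω] {ν ρ : Measure Ω} {c c' : ℝ} (h : EntL ν ρ c)
    (hc : c ≤ c') : EntL ν ρ c' := fun g hg hB => (h g hg hB).trans (by linarith)

theorem EntL.map {Ω Ω' : Type*} [MeasurableSpace Ω] [MeasurableSpace Ω'] {ν ρ : Measure Ω} {c : ℝ}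
    (h : EntL ν ρ c) (f : Ω → Ω') (hf : Measurable f) : EntL (ν.map f) (ρ.map f) c := by
  intro g hg ⟨B, hB⟩
  rw [integral_map hf.aemeasurable hg.aestronglyMeasurable,
    integral_map (f := fun x => Real.exp (g x)) hf.aemeasurable
      (Real.measurable_exp.comp hg).aestronglyMeasurable]
  exact h (g ∘ f) (hg.comp hf) ⟨B, fun x => hB _⟩

theorem EntL_of_KL {Ω : Type*} [MeasurableSpace Ω] (ν ρ : Measure Ω) [IsProbabilityMeasure ν]
    [IsProbabilityMeasure ρ] (c : ℝ) (hc : 0 ≤ c) (h : KLdiv ν ρ ≤ ENNReal.ofReal c) :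
    EntL ν ρ c := by
  unfold KLdiv at h
  split_ifs at h with h1
  · obtain ⟨hac, hIntg⟩ := h1
    have hle : ∫ a, llr ν ρ a ∂ν ≤ c := (ENNReal.ofReal_le_ofReal_iff hc).1 h
    intro g hg hB
    have hgν := bint ν hg hB
    have hgρ := bint ρ (Real.measurable_exp.comp hg) (bexp hB)
    have h1 := integral_llr_tilted_right hac hgν hgρ hIntg
    have : IsProbabilityMeasure (ρ.tilted g) := isProbabilityMeasure_tilted hgρ
    have h2 := InformationTheory.integral_llr_add_sub_measure_univ_nonneg (μ := ν) (ν := ρ.tilted g)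
      (hac.trans (absolutelyContinuous_tilted hgρ)) (integrable_llr_tilted_right hac hgν hIntg hgρ)
    simp only [probReal_univ, add_sub_cancel_right] at h2
    linarith
  · simp at h

theorem EntL.ac {Ω : Type*} [MeasurableSpace Ω] {ν ρ : Measure Ω} [IsProbabilityMeasure ν]
    [IsProbabilityMeasure ρ] {c : ℝ} (h : EntL ν ρ c) (A : Set Ω) (hA : MeasurableSet A) (t : ℝ)
    (ht : 0 ≤ t) : t * ν.real A ≤ c + Real.log (1 + ρ.real A * (Real.exp t - 1)) := by
  have h1 := h (A.indicator fun _ => t) (measurable_const.indicator hA) ⟨t, fun x => by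
    by_cases hx : x ∈ A <;> simp [hx, abs_of_nonneg ht, ht]⟩
  have h2 : ∫ x, Real.exp (A.indicator (fun _ => t) x) ∂ρ = 1 + ρ.real A * (Real.exp t - 1) := by
    have : ∀ x, Real.exp (A.indicator (fun _ => t) x) =
        1 + A.indicator (fun _ => Real.exp t - 1) x := by
      intro x; by_cases hx : x ∈ A <;> simp [hx]
    rw [integral_congr_ae (ae_of_all _ this), integral_add (integrable_const _)
      ((integrable_const _).indicator hA), integral_indicator_const _ hA]
    simp
  rw [h2, integral_indicator_const _ hA] at h1
  simpa [mul_comm] using h1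

theorem EntL.nonneg {Ω : Type*} [MeasurableSpace Ω] {ν ρ : Measure Ω} [IsProbabilityMeasure ν]
    [IsProbabilityMeasure ρ] {c : ℝ} (h : EntL ν ρ c) : 0 ≤ c := by
  have := h.ac ∅ MeasurableSet.empty 0 le_rfl
  simpa using this

theorem EntL.absolutelyContinuous {Ω : Type*} [MeasurableSpace Ω] {ν ρ : Measure Ω}
    [IsProbabilityMeasure ν] [IsProbabilityMeasure ρ] {c : ℝ} (h : EntL ν ρ c) : ν ≪ ρ := by
  refine Measure.AbsolutelyContinuous.mk fun A hA h0 => ?_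
  have h1 : ρ.real A = 0 := by simp [Measure.real, h0]
  have h2 : ∀ t : ℝ, 0 ≤ t → t * ν.real A ≤ c := by
    intro t ht
    have := h.ac A hA t ht
    simpa [h1] using this
  have h3 : ν.real A = 0 := by
    by_contra hne
    have hpos : 0 < ν.real A := lt_of_le_of_ne measureReal_nonneg (Ne.symm hne)
    have := h2 ((c + 1) / ν.real A) (div_nonneg (by linarith [h.nonneg]) hpos.le)
    rw [div_mul_cancel₀ _ hne] at this
    linarith
  simpa [Measure.real, ENNReal.toReal_eq_zero_iff] using h3

theorem kl_trunc_nonneg {r K : ℝ} (hr : 0 ≤ r) (hK : 1 ≤ K) :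
    0 ≤ r * Real.log (max (Real.exp (-K)) (min r (Real.exp K))) + 1 - r := by
  have hKK : Real.exp (-K) ≤ Real.exp K := Real.exp_le_exp.2 (by linarith)
  rcases le_total r (Real.exp K) with h1 | h1
  · rw [min_eq_left h1]
    rcases le_total r (Real.exp (-K)) with h2 | h2
    · rw [max_eq_left h2, Real.log_exp]
      have h3 : r * (K + 1) ≤ 1 := by
        calc r * (K + 1) ≤ Real.exp (-K) * Real.exp K := by
              refine mul_le_mul h2 (Real.add_one_le_exp K) (by linarith) (Real.exp_pos _).le
          _ = 1 := by rw [← Real.exp_add]; simp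
      linarith
    · rw [max_eq_right h2]
      exact InformationTheory.klFun_nonneg hr
  · rw [min_eq_right h1, max_eq_right hKK, Real.log_exp]
    nlinarith

theorem EntL.KL_le {Ω : Type*} [MeasurableSpace Ω] {ν ρ : Measure Ω} [IsProbabilityMeasure ν]
    [IsProbabilityMeasure ρ] {c : ℝ} (h : EntL ν ρ c) : KLdiv ν ρ ≤ ENNReal.ofReal c := by
  have hac := h.absolutelyContinuous
  set r : Ω → ℝ := fun x => (ν.rnDeriv ρ x).toReal with hr
  have hrm : Measurable r := (Measure.measurable_rnDeriv ν ρ).ennreal_toReal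
  have hr0 : ∀ x, 0 ≤ r x := fun x => ENNReal.toReal_nonneg
  have hri : Integrable r ρ := Measure.integrable_toReal_rnDeriv
  set s : ℕ → Ω → ℝ := fun n x => max (Real.exp (-(n + 1 : ℝ))) (min (r x) (Real.exp (n + 1 : ℝ))) with hs
  have hs0 : ∀ n x, 0 < s n x := fun n x => lt_max_of_lt_left (Real.exp_pos _)
  have hsm : ∀ n, Measurable (s n) := fun n => measurable_const.max (hrm.min measurable_const)
  have hsb : ∀ n x, |Real.log (s n x)| ≤ n + 1 := by
    intro n x
    rw [abs_le]
    constructor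
    · rw [Real.le_log_iff_exp_le (hs0 n x)]
      exact le_max_left _ _
    · rw [Real.log_le_iff_le_exp (hs0 n x)]
      refine max_le (Real.exp_le_exp.2 (by linarith [(Nat.cast_nonneg n : (0:ℝ) ≤ n)])) (min_le_right _ _)
  have hlm : ∀ n, Measurable fun x => Real.log (s n x) := fun n => (hsm n).log
  have hb1 : ∀ n : ℕ, ∫ x, Real.log (s n x) ∂ν ≤ c + Real.log (1 + Real.exp (-(n + 1 : ℝ))) := by
    intro n
    refine (h _ (hlm n) ⟨_, hsb n⟩).trans ?_
    have h1 : ∫ x, Real.exp (Real.log (s n x)) ∂ρ ≤ 1 + Real.exp (-(n + 1 : ℝ)) := by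
      have h2 : ∫ x, r x ∂ρ = 1 := by
        have := Measure.integral_toReal_rnDeriv hac
        simpa using this
      have h3 : ∫ x, (r x + Real.exp (-(n + 1 : ℝ))) ∂ρ = 1 + Real.exp (-(n + 1 : ℝ)) := by
        rw [integral_add hri (integrable_const _), h2]; simp
      rw [← h3]
      refine integral_mono (bint ρ (Real.measurable_exp.comp (hlm n)) (bexp ⟨_, hsb n⟩))
        (hri.add (integrable_const _)) fun x => ?_
      simp only
      rw [Real.exp_log (hs0 n x)]
      refine max_le (by linarith [hr0 x]) ((min_le_left _ _).trans ?_)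
      linarith [Real.exp_pos (-(n + 1 : ℝ))]
    have h4 := (exp_int_bounds ρ (hlm n) (hsb n)).1
    have := Real.log_le_log (lt_of_lt_of_le (Real.exp_pos _) h4) h1
    linarith
  have hkl : InformationTheory.klDiv ν ρ ≤ ENNReal.ofReal c := by
    rw [InformationTheory.klDiv_eq_lintegral_klFun_of_ac hac]
    have hlim : ∀ x, Tendsto (fun n : ℕ => ENNReal.ofReal (r x * Real.log (s n x) + 1 - r x)) atTop
        (nhds (ENNReal.ofReal (InformationTheory.klFun (r x)))) := by
      intro x
      refine (ENNReal.continuous_ofReal.tendsto _).comp ?_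
      rcases (hr0 x).eq_or_lt with h0 | h0
      · simp only [← h0]
        simp [InformationTheory.klFun]
      · refine tendsto_const_nhds.congr' ?_
        have t1 : Tendsto (fun n : ℕ => Real.exp (n + 1 : ℝ)) atTop atTop :=
          Real.tendsto_exp_atTop.comp (tendsto_atTop_add_const_right _ _ tendsto_natCast_atTop_atTop)
        have t2 : Tendsto (fun n : ℕ => Real.exp (-(n + 1 : ℝ))) atTop (nhds 0) :=
          Real.tendsto_exp_neg_atTop_nhds_zero.comp
            (tendsto_atTop_add_const_right _ _ tendsto_natCast_atTop_atTop)
        filter_upwards [t1.eventually_ge_atTop (r x), t2.eventually_le_const h0] with n h1 h2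
        simp only [hs, min_eq_left h1, max_eq_right h2, InformationTheory.klFun]
    have hle : ∫⁻ x, ENNReal.ofReal (InformationTheory.klFun (r x)) ∂ρ ≤
        liminf (fun n : ℕ => ∫⁻ x, ENNReal.ofReal (r x * Real.log (s n x) + 1 - r x) ∂ρ) atTop := by
      calc _ = ∫⁻ x, liminf (fun n : ℕ => ENNReal.ofReal (r x * Real.log (s n x) + 1 - r x)) atTop ∂ρ := by
            exact lintegral_congr fun x => (hlim x).liminf_eq.symm
        _ ≤ _ := lintegral_liminf_le fun n => by
            have := hlm n
            fun_prop
    refine hle.trans ?_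
    have hval : ∀ n : ℕ, ∫⁻ x, ENNReal.ofReal (r x * Real.log (s n x) + 1 - r x) ∂ρ ≤
        ENNReal.ofReal (c + Real.log (1 + Real.exp (-(n + 1 : ℝ)))) := by
      intro n
      have i1 : Integrable (fun x => r x * Real.log (s n x)) ρ :=
        (integrable_toReal_rnDeriv_mul_iff hac).2 (bint ν (hlm n) ⟨_, hsb n⟩)
      rw [← ofReal_integral_eq_lintegral_ofReal (f := fun x => r x * Real.log (s n x) + 1 - r x) ((i1.add (integrable_const _)).sub hri)
        (ae_of_all _ fun x => kl_trunc_nonneg (hr0 x) (by linarith [(Nat.cast_nonneg n : (0:ℝ) ≤ n)]))]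
      refine ENNReal.ofReal_le_ofReal (le_trans (le_of_eq ?_) (hb1 n))
      have e1 : ∫ x, r x * Real.log (s n x) ∂ρ = ∫ x, Real.log (s n x) ∂ν :=
        integral_toReal_rnDeriv_mul hac
      have h2 : ∫ x, r x ∂ρ = 1 := by
        have := Measure.integral_toReal_rnDeriv hac
        simpa using this
      have e2 := integral_sub (i1.add (integrable_const (1:ℝ))) hri
      have e3 := integral_add i1 (integrable_const (1:ℝ))
      simp only [Pi.add_apply] at e2
      rw [e2, e3, e1, h2]
      simp
    have hlim2 : Tendsto (fun n : ℕ => ENNReal.ofReal (c + Real.log (1 + Real.exp (-(n + 1 : ℝ))))) atTop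
        (nhds (ENNReal.ofReal c)) := by
      refine (ENNReal.continuous_ofReal.tendsto _).comp ?_
      have t2 : Tendsto (fun n : ℕ => Real.exp (-(n + 1 : ℝ))) atTop (nhds 0) :=
          Real.tendsto_exp_neg_atTop_nhds_zero.comp
            (tendsto_atTop_add_const_right _ _ tendsto_natCast_atTop_atTop)
      have t3 := (t2.const_add 1).log (by norm_num)
      simpa using t3.const_add c
    calc _ ≤ liminf (fun n : ℕ => ENNReal.ofReal (c + Real.log (1 + Real.exp (-(n + 1 : ℝ))))) atTop :=
          liminf_le_liminf (Eventually.of_forall hval)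
      _ = _ := hlim2.liminf_eq
  have hne : InformationTheory.klDiv ν ρ ≠ ⊤ := ne_top_of_le_ne_top ENNReal.ofReal_ne_top hkl
  obtain ⟨_, hIntg⟩ := InformationTheory.klDiv_ne_top_iff.1 hne
  unfold KLdiv
  rw [if_pos ⟨hac, hIntg⟩]
  rw [InformationTheory.klDiv_of_ac_of_integrable hac hIntg] at hkl
  simpa using hkl

end LDPaux

namespace LDPaux

theorem EntL_pi_aux {J Ω : Type*} [Fintype J] [DecidableEq J] [MeasurableSpace Ω]
    (ν μ : J → Measure Ω) [∀ j, IsProbabilityMeasure (ν j)] [∀ j, IsProbabilityMeasure (μ j)]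
    (c : J → ℝ) (h : ∀ j, EntL (ν j) (μ j) (c j)) (s : Finset J) :
    EntL (Measure.pi (s.piecewise ν μ)) (Measure.pi μ) (∑ j ∈ s, c j) := by
  induction s using Finset.induction_on with
  | empty =>
    simp only [Finset.piecewise_empty, Finset.sum_empty, zero_add]
    intro g hg hB
    rw [zero_add]
    have hm : IsProbabilityMeasure (Measure.pi μ) := inferInstance
    have := EntL_of_KL (Measure.pi μ) (Measure.pi μ) 0 le_rfl (by
      unfold KLdiv
      have h1 : llr (Measure.pi μ) (Measure.pi μ) =ᵐ[Measure.pi μ] 0 := llr_self _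
      rw [if_pos ⟨Measure.AbsolutelyContinuous.rfl,
        (integrable_congr h1).2 (integrable_zero _ _ _)⟩, integral_congr_ae h1]
      simp) g hg hB
    simpa using this
  | insert a s ha ih =>
    have hp : ∀ j, IsProbabilityMeasure ((s.piecewise ν μ) j) := by
      intro j
      by_cases hj : j ∈ s
      · simp only [Finset.piecewise, hj, if_true]; infer_instance
      · simp only [Finset.piecewise, hj, if_false]; infer_instance
    intro g hg ⟨B, hB⟩
    rw [Finset.piecewise_insert, Finset.sum_insert ha]
    have r1 := resample (s.piecewise ν μ) a (ν a)
    have r2 := resample μ a (μ a)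
    rw [Function.update_eq_self] at r2
    have hup : Measurable (fun zx : (J → Ω) × Ω => g (Function.update zx.1 a zx.2)) :=
      hg.comp r1.measurable
    have e1 : ∫ z, g z ∂(Measure.pi (Function.update (s.piecewise ν μ) a (ν a))) =
        ∫ z, ∫ x, g (Function.update z a x) ∂(ν a) ∂(Measure.pi (s.piecewise ν μ)) := by
      rw [← r1.map_eq, integral_map r1.aemeasurable hg.aestronglyMeasurable, integral_prod]
      exact bint _ hup ⟨B, fun z => hB _⟩
    have e2 : ∫ z, Real.exp (g z) ∂(Measure.pi μ) =
        ∫ z, ∫ x, Real.exp (g (Function.update z a x)) ∂(μ a) ∂(Measure.pi μ) := by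
      have hx : Measurable fun z => Real.exp (g z) := Real.measurable_exp.comp hg
      conv_lhs => rw [← r2.map_eq]
      rw [integral_map r2.aemeasurable hx.aestronglyMeasurable, integral_prod]
      exact bint _ (Real.measurable_exp.comp hup) (bexp ⟨B, fun z => hB _⟩)
    set L : (J → Ω) → ℝ := fun z => Real.log (∫ x, Real.exp (g (Function.update z a x)) ∂(μ a)) with hL
    have hsec : ∀ z, Measurable fun x => g (Function.update z a x) := fun z =>
      hup.comp measurable_prodMk_left
    have hLb : ∀ z, |L z| ≤ B := by
      intro z
      have hb := exp_int_bounds (μ a) (hsec z) (B := B) (fun x => hB _)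
      have hpos := lt_of_lt_of_le (Real.exp_pos _) hb.1
      rw [abs_le]
      exact ⟨(Real.le_log_iff_exp_le hpos).2 hb.1, (Real.log_le_iff_le_exp hpos).2 hb.2⟩
    have hLm : Measurable L := by
      refine Measurable.log ?_
      exact (StronglyMeasurable.integral_prod_right'
        (Real.measurable_exp.comp hup).stronglyMeasurable).measurable
    have e3 : ∀ z, Real.exp (L z) = ∫ x, Real.exp (g (Function.update z a x)) ∂(μ a) := by
      intro z
      exact Real.exp_log (lt_of_lt_of_le (Real.exp_pos _)
        (exp_int_bounds (μ a) (hsec z) (B := B) (fun x => hB _)).1)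
    have e4 := ih L hLm ⟨B, hLb⟩
    simp only [e3] at e4
    rw [← e2] at e4
    rw [e1]
    have e5 : ∫ z, ∫ x, g (Function.update z a x) ∂(ν a) ∂(Measure.pi (s.piecewise ν μ)) ≤
        ∫ z, (c a + L z) ∂(Measure.pi (s.piecewise ν μ)) := by
      refine integral_mono ?_ ((integrable_const _).add (bint _ hLm ⟨B, hLb⟩)) ?_
      · have := (bint ((Measure.pi (s.piecewise ν μ)).prod (ν a)) hup ⟨B, fun z => hB _⟩)
        exact this.integral_prod_left
      · intro z
        exact h a _ (hsec z) ⟨B, fun x => hB _⟩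
    rw [integral_add (integrable_const _) (bint _ hLm ⟨B, hLb⟩)] at e5
    simp only [integral_const, probReal_univ, one_smul] at e5
    linarith

theorem EntL_pi {J Ω : Type*} [Fintype J] [MeasurableSpace Ω]
    (ν μ : J → Measure Ω) [∀ j, IsProbabilityMeasure (ν j)] [∀ j, IsProbabilityMeasure (μ j)]
    (c : J → ℝ) (h : ∀ j, EntL (ν j) (μ j) (c j)) :
    EntL (Measure.pi ν) (Measure.pi μ) (∑ j, c j) := by
  classical
  have := EntL_pi_aux ν μ c h Finset.univ
  rwa [Finset.piecewise_univ] at this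

theorem exp_convex {t h B : ℝ} (hB : 0 < B) (h0 : 0 ≤ h) (h1 : h ≤ B) :
    Real.exp (t * h) ≤ 1 + h / B * (Real.exp (t * B) - 1) := by
  have := convexOn_exp.2 (Set.mem_univ (t * B)) (Set.mem_univ 0)
    (show 0 ≤ h / B by positivity) (show 0 ≤ 1 - h / B from sub_nonneg.2 ((div_le_one hB).2 h1)) (by ring)
  simp only [smul_eq_mul, mul_zero, add_zero, Real.exp_zero, mul_one] at this
  have e : h / B * (t * B) = t * h := by field_simp
  rw [e] at this
  linarith

theorem EntL.mix {J Ω : Type*} [Fintype J] [MeasurableSpace Ω] {lam μ : Measure Ω}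
    [IsProbabilityMeasure lam] [IsProbabilityMeasure μ] {M : ℝ} (h : EntL lam μ M)
    (H : (J → Ω) → ℝ) (hH : Measurable H) (B : ℝ) (hB : 0 < B) (h0 : ∀ z, 0 ≤ H z)
    (h1 : ∀ z, H z ≤ B) (t : ℝ) (ht : 0 ≤ t) :
    t * ∫ z, H z ∂(Measure.pi fun _ : J => lam) ≤ Fintype.card J * M +
      (∫ z, H z ∂(Measure.pi fun _ : J => μ)) / B * Real.exp (t * B) := by
  have hP := EntL_pi (fun _ : J => lam) (fun _ => μ) (fun _ => M) (fun _ => h)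
  have hb : ∀ z, |t * H z| ≤ t * B := fun z => by
    rw [abs_of_nonneg (mul_nonneg ht (h0 z))]; exact mul_le_mul_of_nonneg_left (h1 z) ht
  have h2 := hP (fun z => t * H z) (hH.const_mul t) ⟨t * B, hb⟩
  rw [integral_const_mul] at h2
  simp only [Finset.sum_const, Finset.card_univ, nsmul_eq_mul] at h2
  have hHi := bint (Measure.pi fun _ : J => μ) hH ⟨B, fun z => by rw [abs_of_nonneg (h0 z)]; exact h1 z⟩
  have hI : 0 ≤ ∫ z, H z ∂(Measure.pi fun _ : J => μ) := integral_nonneg h0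
  have h3 : ∫ z, Real.exp (t * H z) ∂(Measure.pi fun _ : J => μ) ≤
      1 + (∫ z, H z ∂(Measure.pi fun _ : J => μ)) / B * (Real.exp (t * B) - 1) := by
    have e : ∫ z, (1 + H z / B * (Real.exp (t * B) - 1)) ∂(Measure.pi fun _ : J => μ) =
      1 + (∫ z, H z ∂(Measure.pi fun _ : J => μ)) / B * (Real.exp (t * B) - 1) := by
      rw [integral_add (integrable_const _) ((hHi.div_const _).mul_const _), integral_mul_const,
        integral_div]
      simp
    rw [← e]
    refine integral_mono (bint _ (Real.measurable_exp.comp (hH.const_mul t)) (bexp ⟨_, hb⟩))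
      ((integrable_const _).add ((hHi.div_const _).mul_const _)) fun z => ?_
    exact exp_convex hB (h0 z) (h1 z)
  have h4 := (exp_int_bounds (Measure.pi fun _ : J => μ) (hH.const_mul t) hb).1
  have h5 := Real.log_le_sub_one_of_pos (lt_of_lt_of_le (Real.exp_pos _) h4)
  have h6 : 0 ≤ (∫ z, H z ∂(Measure.pi fun _ : J => μ)) / B := div_nonneg hI hB.le
  nlinarith

theorem EntL.lint {Ω : Type*} [MeasurableSpace Ω] {ν ρ : Measure Ω} [IsProbabilityMeasure ν]
    [IsProbabilityMeasure ρ] {c : ℝ} (h : EntL ν ρ c) (g : Ω → ℝ) (hg : Measurable g)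
    (hg0 : ∀ x, 0 ≤ g x) (A : ℝ) (hA : ∫⁻ x, ENNReal.ofReal (Real.exp (g x)) ∂ρ ≤
      ENNReal.ofReal (Real.exp A)) :
    ∫⁻ x, ENNReal.ofReal (g x) ∂ν ≤ ENNReal.ofReal (c + A) := by
  have hgn : ∀ n : ℕ, Measurable fun x => min (g x) n := fun n => hg.min measurable_const
  have hgb : ∀ n : ℕ, ∀ x, |min (g x) n| ≤ n := fun n x => by
    rw [abs_of_nonneg (le_min (hg0 x) (Nat.cast_nonneg n))]; exact min_le_right _ _
  have h1 : ∀ n : ℕ, ∫⁻ x, ENNReal.ofReal (min (g x) n) ∂ν ≤ ENNReal.ofReal (c + A) := by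
    intro n
    rw [← ofReal_integral_eq_lintegral_ofReal (bint ν (hgn n) ⟨_, hgb n⟩)
      (ae_of_all _ fun x => le_min (hg0 x) (Nat.cast_nonneg n))]
    refine ENNReal.ofReal_le_ofReal ((h _ (hgn n) ⟨_, hgb n⟩).trans ?_)
    have h2 := (exp_int_bounds ρ (hgn n) (hgb n)).1
    have h3 : ∫ x, Real.exp (min (g x) n) ∂ρ ≤ Real.exp A := by
      rw [← ENNReal.ofReal_le_ofReal_iff (Real.exp_pos _).le, ofReal_integral_eq_lintegral_ofReal
        (f := fun x => Real.exp (min (g x) n)) (bint ρ (Real.measurable_exp.comp (hgn n)) (bexp ⟨_, hgb n⟩))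
        (ae_of_all _ fun x => (Real.exp_pos _).le)]
      refine le_trans (lintegral_mono fun x => ?_) hA
      exact ENNReal.ofReal_le_ofReal (Real.exp_le_exp.2 (min_le_left _ _))
    have := (Real.log_le_iff_le_exp (lt_of_lt_of_le (Real.exp_pos _) h2)).2 h3
    linarith
  have h2 : ∀ x, Tendsto (fun n : ℕ => ENNReal.ofReal (min (g x) n)) atTop
      (nhds (ENNReal.ofReal (g x))) := by
    intro x
    refine tendsto_const_nhds.congr' ?_
    filter_upwards [tendsto_natCast_atTop_atTop.eventually_ge_atTop (g x)] with n hn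
    rw [min_eq_left hn]
  calc _ = ∫⁻ x, liminf (fun n : ℕ => ENNReal.ofReal (min (g x) n)) atTop ∂ν :=
        lintegral_congr fun x => (h2 x).liminf_eq.symm
    _ ≤ _ := lintegral_liminf_le fun n => (hgn n).ennreal_ofReal
    _ ≤ _ := liminf_le_of_frequently_le' (Frequently.of_forall h1)

/-- the conditional laws -/
noncomputable def condLaw {X : Type*} [MeasurableSpace X] {n : ℕ} (ι : ℝ → Fin n)
    (ν : Measure (ℝ × X)) (l : Fin n) : Measure X :=
  (n : ℝ≥0∞) • (ν.restrict {z | ι z.1 = l}).map Prod.snd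

theorem condLaw_apply {X : Type*} [MeasurableSpace X] {n : ℕ} (ι : ℝ → Fin n)
    (ν : Measure (ℝ × X)) (l : Fin n) (A : Set X) (hA : MeasurableSet A) :
    condLaw ι ν l A = n * ν {z | ι z.1 = l ∧ z.2 ∈ A} := by
  unfold condLaw
  rw [Measure.smul_apply, Measure.map_apply measurable_snd hA,
    Measure.restrict_apply (measurable_snd hA), smul_eq_mul]
  congr 2
  ext z
  simp [and_comm]

theorem condLaw_prob {X : Type*} [MeasurableSpace X] {n : ℕ} (ι : ℝ → Fin n)
    (hι : Measurable ι) (hιu : ∀ l, unif01 {a | ι a = l} = (n : ℝ≥0∞)⁻¹) (hn : n ≠ 0)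
    (ν : Measure (ℝ × X)) (hν : inTM ν) (l : Fin n) : IsProbabilityMeasure (condLaw ι ν l) := by
  constructor
  rw [condLaw_apply _ _ _ _ MeasurableSet.univ]
  have : ν {z : ℝ × X | ι z.1 = l ∧ z.2 ∈ univ} = unif01 {a | ι a = l} := by
    have hm : MeasurableSet {a | ι a = l} := hι (measurableSet_singleton l)
    rw [← hν.2, Measure.map_apply measurable_fst hm]
    simp [preimage]
  rw [this, hιu]
  exact ENNReal.mul_inv_cancel (by simpa using hn) (by simp)

theorem condLaw_sum {X : Type*} [MeasurableSpace X] {n : ℕ} (ι : ℝ → Fin n)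
    (hι : Measurable ι) (hιu : ∀ l, unif01 {a | ι a = l} = (n : ℝ≥0∞)⁻¹) (hn : n ≠ 0)
    (ν : Measure (ℝ × X)) (hν : inTM ν) (μ : Measure X) [IsProbabilityMeasure μ] (D : ℝ)
    (h : EntL ν (unif01.prod μ) D) (F : Fin n → X → ℝ) (hF : ∀ l, Measurable (F l))
    (hB : ∀ l, ∃ B, ∀ x, |F l x| ≤ B) :
    ∑ l, (∫ x, F l x ∂(condLaw ι ν l) - Real.log (∫ x, Real.exp (F l x) ∂μ)) ≤ n * D := by
  have hνp := hν.1
  have hn' : (n : ℝ) ≠ 0 := by exact_mod_cast hn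
  choose B hB using hB
  set Z : Fin n → ℝ := fun l => Real.log (∫ x, Real.exp (F l x) ∂μ) with hZ
  have hZp : ∀ l, 0 < ∫ x, Real.exp (F l x) ∂μ := fun l =>
    lt_of_lt_of_le (Real.exp_pos _) (exp_int_bounds μ (hF l) (hB l)).1
  set g : ℝ × X → ℝ := fun z => ∑ l, {z : ℝ × X | ι z.1 = l}.indicator (fun z => F l z.2 - Z l) z with hg
  have hms : ∀ l, MeasurableSet {z : ℝ × X | ι z.1 = l} := fun l =>
    (hι.comp measurable_fst) (measurableSet_singleton l)
  have hFm : ∀ l, Measurable fun z : ℝ × X => F l z.2 - Z l := fun l =>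
    ((hF l).comp measurable_snd).sub_const _
  have hFi : ∀ l, Integrable (fun z : ℝ × X => F l z.2 - Z l) ν := fun l =>
    bint ν (hFm l) ⟨B l + |Z l|, fun z => (abs_sub _ _).trans (add_le_add (hB l _) le_rfl)⟩
  have hgm : Measurable g := Finset.measurable_sum _ fun l _ => (hFm l).indicator (hms l)
  have hgv : ∀ z, g z = F (ι z.1) z.2 - Z (ι z.1) := by
    intro z
    simp only [hg]
    rw [Finset.sum_eq_single (ι z.1)]
    · simp
    · intro l _ hl
      rw [indicator_of_notMem]
      simpa using Ne.symm hl
    · simp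
  have hgb : ∃ B', ∀ z, |g z| ≤ B' := by
    refine ⟨∑ l, (B l + |Z l|), fun z => ?_⟩
    rw [hgv]
    refine (abs_sub _ _).trans ((add_le_add (hB _ _) le_rfl).trans ?_)
    exact Finset.single_le_sum (f := fun l => B l + |Z l|) (fun l _ => add_nonneg
      ((abs_nonneg _).trans (hB l z.2)) (abs_nonneg _)) (Finset.mem_univ _)
  have h1 := h g hgm hgb
  have h2 : ∫ z, Real.exp (g z) ∂(unif01.prod μ) = 1 := by
    rw [integral_prod (fun z => Real.exp (g z)) (bint _ (Real.measurable_exp.comp hgm) (bexp hgb))]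
    have : ∀ a, ∫ x, Real.exp (g (a, x)) ∂μ = 1 := by
      intro a
      simp only [hgv, Real.exp_sub]
      rw [integral_div, hZ]
      simp only
      rw [Real.exp_log (hZp _), div_self (hZp _).ne']
    simp [this]
  rw [h2, Real.log_one, add_zero] at h1
  have h3 : ∫ z, g z ∂ν = ∑ l, (n : ℝ)⁻¹ * (∫ x, F l x ∂(condLaw ι ν l) - Z l) := by
    simp only [hg]
    rw [integral_finsetSum _ fun l _ => (hFi l).indicator (hms l)]
    refine Finset.sum_congr rfl fun l _ => ?_
    have hpl := condLaw_prob ι hι hιu hn ν hν l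
    have e1 : ∫ x, F l x ∂(condLaw ι ν l) - Z l = ∫ x, (F l x - Z l) ∂(condLaw ι ν l) := by
      rw [integral_sub (bint _ (hF l) ⟨_, hB l⟩) (integrable_const _)]; simp
    rw [e1]
    unfold condLaw
    rw [integral_smul_measure, integral_map measurable_snd.aemeasurable
      ((hF l).sub_const _).aestronglyMeasurable, integral_indicator (hms l)]
    simp [hn']
  rw [h3, ← Finset.mul_sum] at h1
  have : (0:ℝ) < n := by exact_mod_cast Nat.pos_of_ne_zero hn
  rw [inv_mul_le_iff₀ this] at h1
  exact h1

theorem condLaw_ent {X : Type*} [MeasurableSpace X] {n : ℕ} (ι : ℝ → Fin n)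
    (hι : Measurable ι) (hιu : ∀ l, unif01 {a | ι a = l} = (n : ℝ≥0∞)⁻¹) (hn : n ≠ 0)
    (ν : Measure (ℝ × X)) (hν : inTM ν) (μ : Measure X) [IsProbabilityMeasure μ] (D : ℝ)
    (h : EntL ν (unif01.prod μ) D) :
    EntL (Measure.pi (condLaw ι ν)) (Measure.pi fun _ => μ) (n * D) := by
  have hp := condLaw_prob ι hι hιu hn ν hν
  set T := {F : X → ℝ // Measurable F ∧ ∃ B, ∀ x, |F x| ≤ B}
  set val : Fin n → T → ℝ := fun l F =>
    ∫ x, F.1 x ∂(condLaw ι ν l) - Real.log (∫ x, Real.exp (F.1 x) ∂μ) with hval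
  have key : ∀ F : Fin n → T, ∑ l, val l (F l) ≤ n * D := fun F =>
    condLaw_sum ι hι hιu hn ν hν μ D h (fun l => (F l).1) (fun l => (F l).2.1) (fun l => (F l).2.2)
  let zT : T := ⟨fun _ => 0, measurable_const, 0, by simp⟩
  have hz : ∀ l, val l zT = 0 := by intro l; simp [hval, zT]
  have hbdd : ∀ l, BddAbove (range (val l)) := by
    intro l
    refine ⟨n * D, ?_⟩
    rintro _ ⟨F, rfl⟩
    have := key (Function.update (fun _ => zT) l F)
    rw [Finset.sum_eq_single l] at this
    · simpa using this
    · intro j _ hj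
      rw [Function.update_of_ne hj, hz]
    · simp
  have hne : Nonempty T := ⟨zT⟩
  have hsum : ∑ l, (⨆ F, val l F) ≤ n * D := by
    refine le_of_forall_pos_le_add fun η hη => ?_
    have hnp : (0:ℝ) < n := by exact_mod_cast Nat.pos_of_ne_zero hn
    have : ∀ l, ∃ F, (⨆ F, val l F) - η / n < val l F := fun l =>
      exists_lt_of_lt_ciSup (by linarith [div_pos hη hnp])
    choose F hF using this
    have h2 := key F
    have h3 : ∑ l, ((⨆ F, val l F) - η / n) ≤ ∑ l, val l (F l) :=
      Finset.sum_le_sum fun l _ => (hF l).le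
    rw [Finset.sum_sub_distrib] at h3
    simp only [Finset.sum_const, Finset.card_univ, Fintype.card_fin, nsmul_eq_mul] at h3
    rw [mul_div_cancel₀ _ hnp.ne'] at h3
    linarith
  refine EntL.mono (EntL_pi (condLaw ι ν) (fun _ => μ) (fun l => ⨆ F, val l F) fun l => ?_) hsum
  intro g hg hB
  have := le_ciSup (hbdd l) ⟨g, hg, hB⟩
  simp only [hval] at this
  linarith

end LDPaux

namespace LDPaux

theorem prod_lint_le {J Ω : Type*} [Fintype J] [MeasurableSpace Ω]
    (μ : J → Measure Ω) [∀ j, IsProbabilityMeasure (μ j)] (f : J → Ω → ℝ≥0∞)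
    (hf : ∀ j, Measurable (f j)) :
    ∫⁻ z, ∏ j, f j (z j) ∂Measure.pi μ ≤ ∏ j, ∫⁻ x, f j x ∂(μ j) := by
  classical
  have h := finner μ Finset.univ (fun j => ({j} : Finset J)) 1 le_rfl (fun j => by
      have : (Finset.univ.filter (fun i : J => j ∈ ({i} : Finset J))) = {j} := by
        ext i; simp [eq_comm]
      rw [this]; simp) (fun j z => f j (z j)) (fun j _ => (hf j).comp (measurable_pi_apply j))
    (fun i _ j hj z y => by
      rw [Function.update_of_ne]
      intro h
      exact hj (by simp [h]))
  refine h.trans (le_of_eq (Finset.prod_congr rfl fun j _ => ?_))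
  simp only [Nat.cast_one, ENNReal.rpow_one, div_one]
  rw [← (measurePreserving_eval μ j).map_eq, lintegral_map (hf j) (measurable_pi_apply j)]

theorem inj_mp {K J Ω : Type*} [Fintype K] [Fintype J] [MeasurableSpace Ω] (μ : Measure Ω)
    [IsProbabilityMeasure μ] (i : K → J) (hi : Function.Injective i) :
    MeasurePreserving (fun x : J → Ω => x ∘ i) (Measure.pi fun _ => μ) (Measure.pi fun _ => μ) := by
  classical
  have hm : Measurable (fun x : J → Ω => x ∘ i) :=
    measurable_pi_lambda _ fun a => measurable_pi_apply (i a)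
  refine ⟨hm, ?_⟩
  refine (Measure.pi_eq fun s hs => ?_).symm
  rw [Measure.map_apply hm (MeasurableSet.univ_pi hs)]
  have : (fun x : J → Ω => x ∘ i) ⁻¹' (Set.univ.pi s) =
      Set.univ.pi (Function.extend i s (fun _ => Set.univ)) := by
    ext x
    simp only [Set.mem_preimage, Set.mem_pi, Set.mem_univ, true_imp_iff, Function.comp]
    constructor
    · intro h j
      by_cases hj : ∃ a, i a = j
      · obtain ⟨a, rfl⟩ := hj
        rw [hi.extend_apply]; exact h a
      · rw [Function.extend_apply' _ _ _ hj]; trivial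
    · intro h a
      have := h (i a)
      rwa [hi.extend_apply] at this
  rw [this, Measure.pi_pi]
  symm
  refine Fintype.prod_of_injective i hi _ _ (fun j hj => ?_) (fun a => ?_)
  · rw [Function.extend_apply' _ _ _ (by simpa using hj)]; simp
  · rw [hi.extend_apply]

theorem card_det {v n : ℕ} (a : Fin v) (S : Finset (Fin v → Fin n))
    (h : ∀ i ∈ S, ∀ i' ∈ S, (∀ b, b ≠ a → i b = i' b) → i = i') : S.card ≤ n ^ (v - 1) := by
  have h1 : S.card ≤ (Finset.univ : Finset ({b : Fin v // b ≠ a} → Fin n)).card := by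
    refine Finset.card_le_card_of_injOn (fun i b => i b.1) (fun _ _ => by simp) ?_
    intro i hi i' hi' hh
    exact h i hi i' hi' fun b hb => congrFun hh ⟨b, hb⟩
  refine h1.trans (le_of_eq ?_)
  rw [Finset.card_univ, Fintype.card_fun, Fintype.card_fin]
  congr 1
  rw [Fintype.card_subtype_compl]
  simp

theorem card_hit {v n : ℕ} (j : Fin n) :
    (((Finset.univ : Finset (Fin v → Fin n))).filter (fun i => ∃ a, i a = j)).card ≤
      v * n ^ (v - 1) := by
  have : ((Finset.univ : Finset (Fin v → Fin n))).filter (fun i => ∃ a, i a = j) ⊆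
      (Finset.univ : Finset (Fin v)).biUnion fun a => Finset.univ.filter (fun i => i a = j) := by
    intro i; simp
  refine (Finset.card_le_card this).trans ?_
  refine (Finset.card_biUnion_le_card_mul _ _ (n ^ (v-1)) fun a _ => ?_).trans (by simp)
  refine card_det a _ fun i hi i' hi' h => ?_
  simp only [Finset.mem_filter, Finset.mem_univ, true_and] at hi hi'
  ext b
  by_cases hb : b = a
  · rw [hb, hi, hi']
  · rw [h b hb]

theorem card_noninj {v n : ℕ} :
    (((Finset.univ : Finset (Fin v → Fin n))).filter (fun i => ¬ Function.Injective i)).card ≤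
      v ^ 2 * n ^ (v - 1) := by
  have : ((Finset.univ : Finset (Fin v → Fin n))).filter (fun i => ¬ Function.Injective i) ⊆
      (Finset.univ : Finset (Fin v × Fin v)).biUnion fun ab =>
        Finset.univ.filter (fun i => ab.1 ≠ ab.2 ∧ i ab.1 = i ab.2) := by
    intro i
    intro hi
    have h := (Finset.mem_filter.1 hi).2
    unfold Function.Injective at h
    push Not at h
    obtain ⟨a, b, h1, h2⟩ := h
    simp only [Finset.mem_filter, Finset.mem_univ, true_and, Finset.mem_biUnion, Prod.exists]
    exact ⟨a, b, h2, h1⟩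
  refine (Finset.card_le_card this).trans ?_
  refine (Finset.card_biUnion_le_card_mul _ _ (n ^ (v-1)) fun a _ => ?_).trans (by simp [sq])
  refine card_det a.1 _ fun i hi i' hi' h => ?_
  simp only [Finset.mem_filter, Finset.mem_univ, true_and] at hi hi'
  ext b
  by_cases hb : b = a.1
  · rw [hb, hi.2, hi'.2, h _ hi.1.symm]
  · rw [h b hb]

theorem exp_markov {Ω : Type*} [MeasurableSpace Ω] (P : Measure Ω) (F : Ω → ℝ) (hF : Measurable F)
    (a b : ℝ) (h : ∫⁻ x, ENNReal.ofReal (Real.exp (F x)) ∂P ≤ ENNReal.ofReal (Real.exp b)) :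
    P {x | a ≤ F x} ≤ ENNReal.ofReal (Real.exp (b - a)) := by
  have hm : Measurable fun x => ENNReal.ofReal (Real.exp (F x)) := (Real.measurable_exp.comp hF).ennreal_ofReal
  have h1 := mul_meas_ge_le_lintegral (μ := P) hm (ENNReal.ofReal (Real.exp a))
  have h2 : {x | a ≤ F x} = {x | ENNReal.ofReal (Real.exp a) ≤ ENNReal.ofReal (Real.exp (F x))} := by
    ext x
    simp only [mem_ofPred_eq]
    rw [ENNReal.ofReal_le_ofReal_iff (Real.exp_pos _).le, Real.exp_le_exp]
  rw [h2]
  have h3 := h1.trans h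
  rw [Real.exp_sub, ENNReal.ofReal_div_of_pos (Real.exp_pos _)]
  rw [ENNReal.le_div_iff_mul_le (Or.inl (by simp [Real.exp_pos])) (Or.inl (by simp)), mul_comm]
  exact h3

theorem chern_sum {Ω : Type*} [MeasurableSpace Ω] (μ : Measure Ω) [IsProbabilityMeasure μ] (n : ℕ)
    (f : Ω → ℝ) (hf : Measurable f) (t b η : ℝ) (ht : 0 < t)
    (h : ∫⁻ x, ENNReal.ofReal (Real.exp (t * f x)) ∂μ ≤ ENNReal.ofReal (Real.exp b)) :
    (Measure.pi fun _ : Fin n => μ) {x | n * η ≤ ∑ l, f (x l)} ≤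
      ENNReal.ofReal (Real.exp (n * (b - t * η))) := by
  have hF : Measurable fun x : Fin n → Ω => t * ∑ l, f (x l) := by fun_prop
  have h1 := exp_markov (Measure.pi fun _ : Fin n => μ) _ hF (t * (n * η)) (n * b) ?_
  · refine le_trans (measure_mono fun x hx => ?_) (h1.trans (le_of_eq ?_))
    · simp only [mem_ofPred_eq] at hx ⊢
      exact mul_le_mul_of_nonneg_left hx ht.le
    · congr 2; ring
  · have e : ∀ x : Fin n → Ω, ENNReal.ofReal (Real.exp (t * ∑ l, f (x l))) =
        ∏ l, ENNReal.ofReal (Real.exp (t * f (x l))) := by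
      intro x
      rw [← ENNReal.ofReal_prod_of_nonneg (fun _ _ => (Real.exp_pos _).le), ← Real.exp_sum,
        Finset.mul_sum]
    simp only [e]
    refine (prod_lint_le (fun _ : Fin n => μ) (fun _ x => ENNReal.ofReal (Real.exp (t * f x)))
      (fun _ => by fun_prop)).trans ?_
    refine (Finset.prod_le_prod' fun l _ => h).trans ?_
    simp only [Finset.prod_const, Finset.card_univ, Fintype.card_fin]
    rw [← ENNReal.ofReal_pow (Real.exp_pos _).le, ← Real.exp_nat_mul]

theorem chern_bdd {X : Type*} [MeasurableSpace X] (μ : Measure X) [IsProbabilityMeasure μ]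
    {v : ℕ} (hv : 1 ≤ v) (n : ℕ) (hn : 1 ≤ n) (H : (Fin v → X) → ℝ) (hH : Measurable H)
    (B : ℝ) (hB : 0 < B) (h0 : ∀ z, 0 ≤ H z) (h1 : ∀ z, H z ≤ B) (s θ : ℝ) (hs : 0 < s) 
    (hτ : (∫ z, H z ∂(Measure.pi fun _ => μ)) / B * Real.exp (s * v * B) ≤ 1) :
    (Measure.pi fun _ : Fin n => μ)
      {x | (n:ℝ) ^ v * θ ≤ ∑ i ∈ Finset.univ.filter (fun i : Fin v → Fin n => Function.Injective i),
        H (x ∘ i)} ≤ ENNReal.ofReal (Real.exp (n * (1 - s * θ))) := by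
  classical
  set I := Finset.univ.filter (fun i : Fin v → Fin n => Function.Injective i) with hI
  have hn0 : (0:ℝ) < n := by exact_mod_cast hn
  have hv0 : (0:ℝ) < v := by exact_mod_cast hv
  set r : ℝ := s / (n:ℝ) ^ (v-1) with hr
  have hr0 : 0 < r := by positivity
  have hcomp : ∀ i : Fin v → Fin n, Measurable fun x : Fin n → X => x ∘ i := fun i =>
    measurable_pi_lambda _ fun a => measurable_pi_apply (i a)
  have hHc : ∀ i : Fin v → Fin n, Measurable fun x : Fin n → X => H (x ∘ i) := fun i => hH.comp (hcomp i)
  have hF : Measurable fun x : Fin n → X => r * ∑ i ∈ I, H (x ∘ i) :=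
    (Finset.measurable_sum _ fun i _ => hHc i).const_mul _
  have hnv : (n:ℝ) ^ v = n * (n:ℝ)^(v-1) := by
    rw [← pow_succ', Nat.sub_add_cancel hv]
  have m := exp_markov (Measure.pi fun _ : Fin n => μ) _ hF (n * (s * θ)) n ?_
  · refine le_trans (measure_mono fun x hx => ?_) (m.trans (le_of_eq ?_))
    · simp only [mem_ofPred_eq] at hx ⊢
      refine le_trans (le_of_eq ?_) (mul_le_mul_of_nonneg_left hx hr0.le)
      rw [hnv, hr]; field_simp
    · congr 2; ring
  set D : ℕ := v * n ^ (v-1) with hD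
  have hD1 : 1 ≤ D := Nat.succ_le_of_lt (by positivity)
  have hD0 : (0:ℝ) < D := by exact_mod_cast hD1
  have e : ∀ x : Fin n → X, ENNReal.ofReal (Real.exp (r * ∑ i ∈ I, H (x ∘ i))) =
      ∏ i ∈ I, ENNReal.ofReal (Real.exp (r * H (x ∘ i))) := by
    intro x
    rw [← ENNReal.ofReal_prod_of_nonneg (fun _ _ => (Real.exp_pos _).le), ← Real.exp_sum,
      Finset.mul_sum]
  simp only [e]
  refine (finner (fun _ : Fin n => μ) I (fun i => Finset.univ.image i) D hD1 (fun j => ?_)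
    (fun i x => ENNReal.ofReal (Real.exp (r * H (x ∘ i))))
    (fun i _ => (Real.measurable_exp.comp ((hHc i).const_mul r)).ennreal_ofReal) ?_).trans ?_
  · refine (Finset.card_le_card ?_).trans (card_hit j)
    intro i
    simp
  · intro i _ j hj z y
    have : Function.update z j y ∘ i = z ∘ i := by
      ext a
      simp only [Function.comp]
      rw [Function.update_of_ne]
      intro h
      exact hj (by simp [← h])
    simp only [this]
  · have key : ∀ i ∈ I, ∫⁻ z, ENNReal.ofReal (Real.exp (r * H (z ∘ i))) ^ (D:ℝ)
        ∂(Measure.pi fun _ : Fin n => μ) ≤ ENNReal.ofReal (Real.exp 1) := by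
      intro i hi
      have hi' : Function.Injective i := by simpa [hI] using hi
      have mp := inj_mp μ i hi'
      have hme : Measurable fun y : Fin v → X => Real.exp (s * v * H y) :=
        Real.measurable_exp.comp (hH.const_mul _)
      have e2 : ∀ z : Fin n → X, ENNReal.ofReal (Real.exp (r * H (z ∘ i))) ^ (D:ℝ) =
          ENNReal.ofReal (Real.exp (s * v * H (z ∘ i))) := by
        intro z
        rw [ENNReal.ofReal_rpow_of_pos (Real.exp_pos _), ← Real.exp_mul]
        congr 2
        rw [hr, hD]; push_cast; field_simp
      simp only [e2]
      have e3 := mp.lintegral_comp hme.ennreal_ofReal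
      rw [e3]
      have hHi := bint (Measure.pi fun _ : Fin v => μ) hH ⟨B, fun z => by rw [abs_of_nonneg (h0 z)]; exact h1 z⟩
      have hb : ∀ z, |s * v * H z| ≤ s * v * B := fun z => by
        rw [abs_of_nonneg (mul_nonneg (by positivity) (h0 z))]
        exact mul_le_mul_of_nonneg_left (h1 z) (by positivity)
      rw [← ofReal_integral_eq_lintegral_ofReal (f := fun y => Real.exp (s * v * H y))
        (bint _ hme (bexp ⟨_, hb⟩)) (ae_of_all _ fun z => (Real.exp_pos _).le)]
      refine ENNReal.ofReal_le_ofReal ?_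
      have h3 : ∫ z, Real.exp (s * v * H z) ∂(Measure.pi fun _ : Fin v => μ) ≤
          1 + (∫ z, H z ∂(Measure.pi fun _ : Fin v => μ)) / B * (Real.exp (s * v * B) - 1) := by
        have e : ∫ z, (1 + H z / B * (Real.exp (s * v * B) - 1)) ∂(Measure.pi fun _ : Fin v => μ) =
          1 + (∫ z, H z ∂(Measure.pi fun _ : Fin v => μ)) / B * (Real.exp (s * v * B) - 1) := by
          rw [integral_add (integrable_const _) ((hHi.div_const _).mul_const _), integral_mul_const,
            integral_div]
          simp
        rw [← e]
        refine integral_mono (bint _ hme (bexp ⟨_, hb⟩))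
          ((integrable_const _).add ((hHi.div_const _).mul_const _)) fun z => ?_
        exact exp_convex hB (h0 z) (h1 z)
      have h4 : 0 ≤ (∫ z, H z ∂(Measure.pi fun _ : Fin v => μ)) / B :=
        div_nonneg (integral_nonneg h0) hB.le
      have h5 := Real.add_one_le_exp (1:ℝ)
      nlinarith
    refine (Finset.prod_le_prod' fun i hi => ENNReal.rpow_le_rpow (key i hi) (by positivity)).trans ?_
    rw [Finset.prod_const, ENNReal.ofReal_rpow_of_pos (Real.exp_pos _), ← Real.exp_mul,
      ← ENNReal.ofReal_pow (Real.exp_pos _).le, ← Real.exp_nat_mul]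
    refine ENNReal.ofReal_le_ofReal (Real.exp_le_exp.2 ?_)
    have hc : (I.card : ℝ) ≤ (n:ℝ)^v := by
      have : I.card ≤ n ^ v := (Finset.card_le_univ _).trans (by simp)
      exact_mod_cast this
    rw [one_mul, mul_one_div, div_le_iff₀ hD0]
    refine hc.trans ?_
    rw [hnv, hD]; push_cast
    refine mul_le_mul_of_nonneg_left ?_ hn0.le
    have : (1:ℝ) ≤ v := by exact_mod_cast hv
    nlinarith [pow_pos hn0 (v-1)]

end LDPaux

namespace LDPaux

/-- upper part of `Ψ` above level `K`. -/
noncomputable def hiP {X : Type*} (Ψ : X → ℝ) (K : ℝ) (x : X) : ℝ := if K < Ψ x then Ψ x else 0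

theorem hiP_meas {X : Type*} [MeasurableSpace X] {Ψ : X → ℝ} (h : Measurable Ψ) (K : ℝ) :
    Measurable (hiP Ψ K) :=
  Measurable.ite (measurableSet_lt measurable_const h) h measurable_const

theorem hiP_nonneg {X : Type*} {Ψ : X → ℝ} (h : ∀ x, 0 ≤ Ψ x) (K : ℝ) (x) : 0 ≤ hiP Ψ K x := by
  unfold hiP; split_ifs; exacts [h x, le_rfl]

theorem tail_trunc {X : Type*} [MeasurableSpace X] (μ : Measure X) [IsProbabilityMeasure μ]
    (Ψ : X → ℝ) (hΨ : Measurable Ψ) (hΨ0 : ∀ x, 0 ≤ Ψ x) (t : ℝ) (ht : 0 < t)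
    (hexp : ∫⁻ x, ENNReal.ofReal (Real.exp (t * Ψ x)) ∂μ < ⊤) :
    ∃ K : ℝ, 1 ≤ K ∧ ∫⁻ x, ENNReal.ofReal (Real.exp (t * hiP Ψ K x)) ∂μ ≤
      ENNReal.ofReal (Real.exp 1) := by
  have h : Tendsto (fun n : ℕ => ∫⁻ x, ENNReal.ofReal (Real.exp (t * hiP Ψ n x)) ∂μ) atTop
      (nhds (∫⁻ _, 1 ∂μ)) := by
    refine tendsto_lintegral_of_dominated_convergence
      (fun x => ENNReal.ofReal (Real.exp (t * Ψ x))) (fun n => ?_) (fun n => ae_of_all _ fun x => ?_)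
      hexp.ne (ae_of_all _ fun x => ?_)
    · exact (Real.measurable_exp.comp ((hiP_meas hΨ n).const_mul t)).ennreal_ofReal
    · refine ENNReal.ofReal_le_ofReal (Real.exp_le_exp.2 (mul_le_mul_of_nonneg_left ?_ ht.le))
      unfold hiP; split_ifs; exacts [le_rfl, hΨ0 x]
    · refine tendsto_const_nhds.congr' ?_
      filter_upwards [eventually_ge_atTop ⌈Ψ x⌉₊] with n hn
      have : ¬ ((n:ℝ) < Ψ x) := not_lt.2 (Nat.ceil_le.1 hn)
      simp [hiP, this]
  have h1 : ∫⁻ _ : X, (1:ℝ≥0∞) ∂μ < ENNReal.ofReal (Real.exp 1) := by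
    simp
  obtain ⟨n, hn, hn1⟩ := ((h.eventually (gt_mem_nhds h1)).and (eventually_ge_atTop 1)).exists
  exact ⟨n, by exact_mod_cast hn1, hn.le⟩

open Classical in
/-- truncated `φ`. -/
noncomputable def phK {X : Type*} {v : ℕ} (φ : (Fin v → X) → ℝ) (Ψ : X → ℝ) (K : ℝ)
    (x : Fin v → X) : ℝ := if ∀ a, Ψ (x a) ≤ K then φ x else 0

theorem phK_meas {X : Type*} [MeasurableSpace X] {v : ℕ} {φ : (Fin v → X) → ℝ} (hφ : Measurable φ)
    {Ψ : X → ℝ} (h : Measurable Ψ) (K : ℝ) : Measurable (phK φ Ψ K) := by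
  refine Measurable.ite ?_ hφ measurable_const
  have : {x : Fin v → X | ∀ a, Ψ (x a) ≤ K} = ⋂ a, {x : Fin v → X | Ψ (x a) ≤ K} := by ext; simp
  rw [this]
  exact MeasurableSet.iInter fun a =>
    measurableSet_le (h.comp (measurable_pi_apply a)) measurable_const

theorem det_pt {X : Type*} {v : ℕ} (φ : (Fin v → X) → ℝ) (Ψ : X → ℝ) (hΨ0 : ∀ x, 0 ≤ Ψ x)
    (r : ℝ) (hr : 1 ≤ r) (hdom : ∀ x, |φ x| ^ r ≤ ∏ a, Ψ (x a)) (K : ℝ) (x : Fin v → X) :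
    |φ x - phK φ Ψ K x| ^ r ≤ ∑ a, ∏ b, Function.update (fun _ => Ψ) a (hiP Ψ K) b (x b) := by
  have hnn : ∀ a b, 0 ≤ Function.update (fun _ => Ψ) a (hiP Ψ K) b (x b) := by
    intro a b
    by_cases h : b = a
    · subst h; simp [hiP_nonneg hΨ0]
    · simp [Function.update_of_ne h, hΨ0]
  unfold phK
  split_ifs with h
  · rw [sub_self, abs_zero, Real.zero_rpow (by linarith)]
    exact Finset.sum_nonneg fun a _ => Finset.prod_nonneg fun b _ => hnn a b
  · push Not at h
    obtain ⟨a, ha⟩ := h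
    rw [sub_zero]
    refine (hdom x).trans ?_
    refine le_trans (le_of_eq ?_) (Finset.single_le_sum (f := fun a => ∏ b, Function.update (fun _ => Ψ) a (hiP Ψ K) b (x b))
      (fun a _ => Finset.prod_nonneg fun b _ => hnn a b) (Finset.mem_univ a))
    refine Finset.prod_congr rfl fun b _ => ?_
    by_cases h : b = a
    · subst h; simp [hiP, ha]
    · simp [Function.update_of_ne h]

theorem add_rpow_two {a b r : ℝ} (hr : 0 ≤ r) : |a + b| ^ r ≤ 2 ^ r * (|a| ^ r + |b| ^ r) := by
  have h1 : |a + b| ≤ 2 * max |a| |b| := by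
    have := abs_add_le a b
    have := le_max_left |a| |b|
    have := le_max_right |a| |b|
    linarith
  refine (Real.rpow_le_rpow (abs_nonneg _) h1 hr).trans ?_
  rw [Real.mul_rpow (by norm_num) (le_max_of_le_left (abs_nonneg _))]
  refine mul_le_mul_of_nonneg_left ?_ (by positivity)
  have ha : 0 ≤ |a| ^ r := by positivity
  have hb : 0 ≤ |b| ^ r := by positivity
  rcases max_choice |a| |b| with h | h <;> rw [h] <;> linarith

theorem emp_prod {X : Type*} {v n : ℕ} (f : Fin v → X → ℝ) (x : Fin n → X) :
    ∑ i : Fin v → Fin n, ∏ b, f b (x (i b)) = ∏ b, ∑ l, f b (x l) := by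
  rw [Finset.prod_univ_sum, Fintype.piFinset_univ]

theorem prod_upd_le {v : ℕ} (hv : 1 ≤ v) (F : Fin v → ℝ≥0∞) (A η : ℝ≥0∞) (a : Fin v)
    (ha : F a ≤ η) (hb : ∀ b, b ≠ a → F b ≤ A) : ∏ b, F b ≤ η * A ^ (v - 1) := by
  rw [← Finset.mul_prod_erase _ _ (Finset.mem_univ a)]
  refine mul_le_mul' ha ((Finset.prod_le_prod' fun b hb' => hb b (Finset.ne_of_mem_erase hb')).trans ?_)
  simp [Finset.card_erase_of_mem]

theorem approx {X : Type*} [MeasurableSpace X] (μ : Measure X) [IsProbabilityMeasure μ]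
    {v : ℕ} (hv : 1 ≤ v) (φ : (Fin v → X) → ℝ) (hφ : Measurable φ) (Ψ : X → ℝ) (hΨ : Measurable Ψ)
    (hΨ0 : ∀ x, 0 ≤ Ψ x) (r : ℝ) (hr : 1 ≤ r) (hdom : ∀ x, |φ x| ^ r ≤ ∏ a, Ψ (x a))
    (hexp : ∀ t : ℝ, 0 < t → ∫⁻ x, ENNReal.ofReal (Real.exp (t * Ψ x)) ∂μ < ⊤)
    (δ : ℝ) (hδ : 0 < δ) (M : ℝ) (hM : 0 ≤ M) :
    ∃ (m : ℕ) (y : X → Fin m) (g : (Fin v → Fin m) → ℝ), Measurable y ∧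
      (∀ lam : Measure X, IsProbabilityMeasure lam → EntL lam μ M →
        ∫⁻ z, ENNReal.ofReal (|φ z - g (fun a => y (z a))| ^ r) ∂(Measure.pi fun _ => lam) ≤
          ENNReal.ofReal δ) ∧
      ∀ᶠ n : ℕ in atTop, (Measure.pi fun _ : Fin n => μ)
        {x | (n:ℝ) ^ v * δ < ∑ i : Fin v → Fin n, |φ (x ∘ i) - g (fun a => y (x (i a)))| ^ r} ≤
          ENNReal.ofReal (Real.exp (-(n * M))) := by
  classical
  have hv0 : (0:ℝ) < v := by exact_mod_cast hv
  have hv1 : (1:ℝ) ≤ v := by exact_mod_cast hv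
  have hr0 : 0 < r := by linarith
  -- constants
  obtain ⟨A1, hA1, hA1e⟩ : ∃ A1 : ℝ, 0 ≤ A1 ∧ ∫⁻ x, ENNReal.ofReal (Real.exp (Ψ x)) ∂μ ≤
      ENNReal.ofReal (Real.exp A1) := by
    have h := hexp 1 one_pos
    simp only [one_mul] at h
    refine ⟨(∫⁻ x, ENNReal.ofReal (Real.exp (Ψ x)) ∂μ).toReal, ENNReal.toReal_nonneg, ?_⟩
    conv_lhs => rw [← ENNReal.ofReal_toReal h.ne]
    exact ENNReal.ofReal_le_ofReal ((le_add_of_nonneg_right zero_le_one).trans (Real.add_one_le_exp _))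
  obtain ⟨A, hA⟩ : ∃ A, A = A1 + M + 1 := ⟨_, rfl⟩
  have hA0 : 0 < A := by linarith
  obtain ⟨δ', hδ'⟩ : ∃ δ', δ' = δ / (2 * 2 ^ r) := ⟨_, rfl⟩
  have hδ'0 : 0 < δ' := by rw [hδ']; positivity
  have hδδ : 2 ^ r * (δ' + δ') = δ := by rw [hδ']; field_simp; norm_num
  obtain ⟨η, hη⟩ : ∃ η, η = δ' / (v * A ^ (v-1)) := ⟨_, rfl⟩
  have hη0 : 0 < η := by rw [hη]; positivity
  have hηδ : v * (η * A ^ (v-1)) = δ' := by rw [hη]; field_simp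
  obtain ⟨t, ht⟩ : ∃ t, t = (M + 2) / η := ⟨_, rfl⟩
  have ht0 : 0 < t := by rw [ht]; positivity
  have htη : t * η = M + 2 := by rw [ht]; field_simp
  obtain ⟨K, hK1, hK⟩ := tail_trunc μ Ψ hΨ hΨ0 t ht0 (hexp t ht0)
  obtain ⟨K', hK'⟩ : ∃ K' : ℝ, K' = (K ^ v) ^ (1 / r) := ⟨_, rfl⟩
  have hK'0 : 0 < K' := by rw [hK']; positivity
  have hφK : ∀ x, |phK φ Ψ K x| ≤ K' := by
    intro x
    unfold phK
    split_ifs with h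
    · have h1 : |φ x| ^ r ≤ K ^ v := (hdom x).trans ((Finset.prod_le_prod (fun a _ => hΨ0 _)
        (fun a _ => h a)).trans (by simp))
      have h2 := Real.rpow_le_rpow (by positivity) h1 (z := 1/r) (by positivity)
      rwa [← Real.rpow_mul (abs_nonneg _), mul_one_div_cancel hr0.ne', Real.rpow_one, ← hK'] at h2
    · simpa using hK'0.le
  obtain ⟨B, hB⟩ : ∃ B : ℝ, B = (2 * K') ^ r := ⟨_, rfl⟩
  have hB0 : 0 < B := by rw [hB]; positivity
  obtain ⟨θ, hθ⟩ : ∃ θ : ℝ, θ = δ' / 2 := ⟨_, rfl⟩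
  have hθ0 : 0 < θ := by rw [hθ]; positivity
  obtain ⟨s, hs⟩ : ∃ s : ℝ, s = (M + 2) / θ := ⟨_, rfl⟩
  have hs0 : 0 < s := by rw [hs]; positivity
  have hsθ : s * θ = M + 2 := by rw [hs]; field_simp
  obtain ⟨e0, he0⟩ : ∃ e0 : ℝ, e0 = B * Real.exp (-(s * v * B)) / (2 * K') ^ (r - 1) := ⟨_, rfl⟩
  have he00 : 0 < e0 := by rw [he0]; positivity
  obtain ⟨m, y, g, hy, hg, hgd⟩ := dense_bdd (Measure.pi fun _ : Fin v => μ) (phK φ Ψ K)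
    (phK_meas hφ hΨ K) K' hφK hK'0.le (ENNReal.ofReal e0) (by simpa using he00)
  have hgy : Measurable fun z : Fin v → X => g (fun a => y (z a)) :=
    (measurable_of_countable g).comp (measurable_pi_lambda _ fun a => hy.comp (measurable_pi_apply a))
  set D2 : (Fin v → X) → ℝ := fun z => phK φ Ψ K z - g (fun a => y (z a)) with hD2
  have hD2m : Measurable D2 := (phK_meas hφ hΨ K).sub hgy
  have hD2b : ∀ z, |D2 z| ≤ 2 * K' := fun z => by
    refine (abs_sub _ _).trans ?_
    have := hφK z
    have := hg (fun a => y (z a))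
    linarith
  set H : (Fin v → X) → ℝ := fun z => |D2 z| ^ r with hH
  have hHm : Measurable H := (hD2m.abs).pow_const r
  have hH0 : ∀ z, 0 ≤ H z := fun z => by simp only [hH]; positivity
  have hHB : ∀ z, H z ≤ B := fun z => by
    rw [hB]; exact Real.rpow_le_rpow (abs_nonneg _) (hD2b z) hr0.le
  have hHle : ∀ z, H z ≤ (2 * K') ^ (r-1) * |D2 z| := fun z => by
    simp only [hH]
    rcases eq_or_lt_of_le (abs_nonneg (D2 z)) with h | h
    · rw [← h, Real.zero_rpow hr0.ne']; simp
    · have : |D2 z| ^ r = |D2 z| ^ (r-1) * |D2 z| := by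
        rw [← Real.rpow_add_one h.ne']; ring_nf
      rw [this]
      exact mul_le_mul_of_nonneg_right (Real.rpow_le_rpow (abs_nonneg _) (hD2b z) (by linarith)) (abs_nonneg _)
  have hHint : ∫ z, H z ∂(Measure.pi fun _ => μ) ≤ B * Real.exp (-(s * v * B)) := by
    have i1 : Integrable (fun z => |D2 z|) (Measure.pi fun _ : Fin v => μ) :=
      bint _ hD2m.abs ⟨2 * K', fun z => by rw [abs_abs]; exact hD2b z⟩
    have i2 : ∫ z, |D2 z| ∂(Measure.pi fun _ : Fin v => μ) ≤ e0 := by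
      have h1 := hgd
      rw [eLpNorm_one_eq_lintegral_enorm] at h1
      rw [← ENNReal.ofReal_le_ofReal_iff he00.le,
        ofReal_integral_eq_lintegral_ofReal i1 (ae_of_all _ fun z => abs_nonneg _)]
      refine le_trans (le_of_eq (lintegral_congr fun z => ?_)) h1
      rw [← Real.norm_eq_abs, ofReal_norm]
    calc ∫ z, H z ∂(Measure.pi fun _ => μ) ≤ ∫ z, (2 * K') ^ (r-1) * |D2 z| ∂(Measure.pi fun _ => μ) :=
          integral_mono (bint _ hHm ⟨B, fun z => by rw [abs_of_nonneg (hH0 z)]; exact hHB z⟩)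
            (i1.const_mul _) hHle
      _ = (2 * K') ^ (r-1) * ∫ z, |D2 z| ∂(Measure.pi fun _ => μ) := integral_const_mul _ _
      _ ≤ (2 * K') ^ (r-1) * e0 := mul_le_mul_of_nonneg_left i2 (by positivity)
      _ = _ := by rw [he0]; field_simp
  have hτ : (∫ z, H z ∂(Measure.pi fun _ : Fin v => μ)) / B * Real.exp (s * v * B) ≤ 1 := by
    calc _ ≤ (B * Real.exp (-(s * v * B))) / B * Real.exp (s * v * B) := by gcongr
      _ = 1 := by
        rw [mul_div_cancel_left₀ _ hB0.ne', ← Real.exp_add]; simp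
  have hpt : ∀ z : Fin v → X, |φ z - g (fun a => y (z a))| ^ r ≤
      2 ^ r * ((∑ a, ∏ b, Function.update (fun _ => Ψ) a (hiP Ψ K) b (z b)) + H z) := by
    intro z
    have e : φ z - g (fun a => y (z a)) = (φ z - phK φ Ψ K z) + D2 z := by simp only [hD2]; ring
    rw [e]
    refine (add_rpow_two hr0.le).trans ?_
    gcongr
    exact det_pt φ Ψ hΨ0 r hr hdom K z
  have hupn : ∀ (a b : Fin v) x, 0 ≤ Function.update (fun _ => Ψ) a (hiP Ψ K) b x := by
    intro a b x
    by_cases h : b = a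
    · subst h; simp [hiP_nonneg hΨ0]
    · simp [Function.update_of_ne h, hΨ0]
  have hupm : ∀ (a b : Fin v), Measurable (Function.update (fun _ => Ψ) a (hiP Ψ K) b) := by
    intro a b
    by_cases h : b = a
    · subst h; simpa using hiP_meas hΨ K
    · simpa [Function.update_of_ne h] using hΨ
  refine ⟨m, y, g, hy, ?_, ?_⟩
  · intro lam hlam hE
    have l1 : ∫⁻ x, ENNReal.ofReal (Ψ x) ∂lam ≤ ENNReal.ofReal A :=
      (hE.lint Ψ hΨ hΨ0 A1 hA1e).trans (ENNReal.ofReal_le_ofReal (by linarith))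
    have l2 : ∫⁻ x, ENNReal.ofReal (hiP Ψ K x) ∂lam ≤ ENNReal.ofReal η := by
      have := hE.lint (fun x => t * hiP Ψ K x) ((hiP_meas hΨ K).const_mul t)
        (fun x => mul_nonneg ht0.le (hiP_nonneg hΨ0 K x)) 1 hK
      simp only [ENNReal.ofReal_mul ht0.le] at this
      rw [lintegral_const_mul _ (hiP_meas hΨ K).ennreal_ofReal] at this
      have h2 : ENNReal.ofReal t * ∫⁻ x, ENNReal.ofReal (hiP Ψ K x) ∂lam ≤
          ENNReal.ofReal t * ENNReal.ofReal η := by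
        refine this.trans ?_
        rw [← ENNReal.ofReal_mul ht0.le, htη]
        exact ENNReal.ofReal_le_ofReal (by linarith)
      exact (ENNReal.mul_le_mul_iff_right (by simpa using ht0) (by simp)).1 h2
    have l3 : ∀ a : Fin v, ∫⁻ z, ENNReal.ofReal (∏ b, Function.update (fun _ => Ψ) a (hiP Ψ K) b (z b))
        ∂(Measure.pi fun _ : Fin v => lam) ≤ ENNReal.ofReal (η * A ^ (v-1)) := by
      intro a
      have e : ∀ z : Fin v → X, ENNReal.ofReal (∏ b, Function.update (fun _ => Ψ) a (hiP Ψ K) b (z b)) =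
          ∏ b, ENNReal.ofReal (Function.update (fun _ => Ψ) a (hiP Ψ K) b (z b)) := fun z =>
        ENNReal.ofReal_prod_of_nonneg fun b _ => hupn a b _
      simp only [e]
      refine (prod_lint_le (fun _ : Fin v => lam)
        (fun b x => ENNReal.ofReal (Function.update (fun _ => Ψ) a (hiP Ψ K) b x))
        (fun b => (hupm a b).ennreal_ofReal)).trans ?_
      rw [ENNReal.ofReal_mul hη0.le, ENNReal.ofReal_pow hA0.le]
      refine prod_upd_le hv _ _ _ a ?_ ?_
      · simpa using l2
      · intro b hb
        simpa [Function.update_of_ne hb] using l1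
    have l4 : ∫⁻ z, ENNReal.ofReal (H z) ∂(Measure.pi fun _ : Fin v => lam) ≤ ENNReal.ofReal δ' := by
      have h1 := hE.mix (J := Fin v) H hHm B hB0 hH0 hHB (s * v) (by positivity)
      rw [← ofReal_integral_eq_lintegral_ofReal
        (bint _ hHm ⟨B, fun z => by rw [abs_of_nonneg (hH0 z)]; exact hHB z⟩) (ae_of_all _ hH0)]
      refine ENNReal.ofReal_le_ofReal ?_
      rw [Fintype.card_fin] at h1
      have h2 := h1.trans (add_le_add_right hτ _)
      have h3 : s * v * ∫ z, H z ∂(Measure.pi fun _ : Fin v => lam) ≤ s * v * θ := by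
        refine h2.trans ?_
        have : s * v * θ = v * (M + 2) := by rw [← hsθ]; ring
        nlinarith
      have h4 := le_of_mul_le_mul_left h3 (by positivity)
      linarith
    have hm3 : ∀ a : Fin v, Measurable fun z : Fin v → X => 
        ENNReal.ofReal (∏ b, Function.update (fun _ => Ψ) a (hiP Ψ K) b (z b)) := fun a =>
      (Finset.measurable_prod _ fun b _ => (hupm a b).comp (measurable_pi_apply b)).ennreal_ofReal
    calc ∫⁻ z, ENNReal.ofReal (|φ z - g (fun a => y (z a))| ^ r) ∂(Measure.pi fun _ => lam)
        ≤ ∫⁻ z, ENNReal.ofReal (2 ^ r) * ((∑ a, ENNReal.ofReal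
            (∏ b, Function.update (fun _ => Ψ) a (hiP Ψ K) b (z b))) + ENNReal.ofReal (H z))
            ∂(Measure.pi fun _ => lam) := by
          refine lintegral_mono fun z => ?_
          refine (ENNReal.ofReal_le_ofReal (hpt z)).trans (le_of_eq ?_)
          rw [ENNReal.ofReal_mul (by positivity), ENNReal.ofReal_add
            (Finset.sum_nonneg fun a _ => Finset.prod_nonneg fun b _ => hupn a b _) (hH0 z),
            ENNReal.ofReal_sum_of_nonneg fun a _ => Finset.prod_nonneg fun b _ => hupn a b _]
      _ = ENNReal.ofReal (2 ^ r) * ((∑ a : Fin v, ∫⁻ z : Fin v → X, ENNReal.ofReal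
            (∏ b, Function.update (fun _ => Ψ) a (hiP Ψ K) b (z b)) ∂(Measure.pi fun _ => lam)) +
            ∫⁻ z, ENNReal.ofReal (H z) ∂(Measure.pi fun _ => lam)) := by
          rw [lintegral_const_mul (f := fun z => (∑ a : Fin v, ENNReal.ofReal
            (∏ b, Function.update (fun _ => Ψ) a (hiP Ψ K) b (z b))) + ENNReal.ofReal (H z))
            _ ((Finset.measurable_sum _ fun a _ => hm3 a).add hHm.ennreal_ofReal),
            lintegral_add_right _ hHm.ennreal_ofReal, lintegral_finsetSum _ fun a _ => hm3 a]
      _ ≤ ENNReal.ofReal (2 ^ r) * ((∑ a : Fin v, ENNReal.ofReal (η * A ^ (v-1))) + ENNReal.ofReal δ') := by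
          gcongr with a
          · exact l3 a
      _ = ENNReal.ofReal δ := by
          rw [Finset.sum_const, Finset.card_univ, Fintype.card_fin, nsmul_eq_mul,
            ← ENNReal.ofReal_natCast, ← ENNReal.ofReal_mul hv0.le, hηδ,
            ← ENNReal.ofReal_add hδ'0.le hδ'0.le, ← ENNReal.ofReal_mul (by positivity), hδδ]
  · have hlim : ∀ᶠ n : ℕ in atTop, B * v ^ 2 / θ ≤ n := by
      exact tendsto_natCast_atTop_atTop.eventually_ge_atTop _
    filter_upwards [hlim, eventually_ge_atTop 2] with n hn1 hn2
    have hn0 : (0:ℝ) < n := by exact_mod_cast (by omega : 0 < n)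
    have c1 := chern_sum μ n Ψ hΨ 1 A1 A one_pos (by simpa using hA1e)
    have c2 := chern_sum μ n (hiP Ψ K) (hiP_meas hΨ K) t 1 η ht0 hK
    have c3 := chern_bdd μ hv n (by omega) H hHm B hB0 hH0 hHB s θ hs0 hτ
    have x1 : n * (A1 - 1 * A) = -(n * (M + 1)) := by rw [hA]; ring
    have x2 : n * (1 - t * η) = -(n * (M + 1)) := by rw [htη]; ring
    have x3 : n * (1 - s * θ) = -(n * (M + 1)) := by rw [hsθ]; ring
    rw [x1] at c1
    rw [x2] at c2
    rw [x3] at c3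
    refine (measure_mono (?_ : _ ⊆ ({x : Fin n → X | n * A ≤ ∑ l, Ψ (x l)} ∪
      {x : Fin n → X | n * η ≤ ∑ l, hiP Ψ K (x l)}) ∪ _)).trans ((measure_union_le _ _).trans
      ((add_le_add ((measure_union_le _ _).trans (add_le_add c1 c2)) c3).trans ?_))
    · intro x hx
      by_contra hcon
      simp only [Set.mem_union, mem_ofPred_eq, not_or, not_le] at hcon hx
      obtain ⟨⟨k1, k2⟩, k3⟩ := hcon
      refine absurd hx (not_lt.2 ?_)
      have z1 : ∑ i : Fin v → Fin n, |φ (x ∘ i) - g (fun a => y (x (i a)))| ^ r ≤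
          2 ^ r * ((∑ a, ∑ i : Fin v → Fin n, ∏ b, Function.update (fun _ => Ψ) a (hiP Ψ K) b (x (i b)))
            + ∑ i : Fin v → Fin n, H (x ∘ i)) := by
        rw [Finset.sum_comm, ← Finset.sum_add_distrib, Finset.mul_sum]
        exact Finset.sum_le_sum fun i _ => hpt (x ∘ i)
      have nv : (n:ℝ) ^ v = n * (n:ℝ) ^ (v-1) := by rw [← pow_succ', Nat.sub_add_cancel hv]
      have z2 : ∀ a : Fin v, ∑ i : Fin v → Fin n, ∏ b, Function.update (fun _ => Ψ) a (hiP Ψ K) b (x (i b)) ≤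
          (n:ℝ) ^ v * (η * A ^ (v-1)) := by
        intro a
        rw [emp_prod (fun b => Function.update (fun _ => Ψ) a (hiP Ψ K) b) x,
          ← Finset.mul_prod_erase _ _ (Finset.mem_univ a)]
        have q1 : ∏ b ∈ Finset.univ.erase a, ∑ l, Function.update (fun _ => Ψ) a (hiP Ψ K) b (x l) ≤
            (n * A) ^ (v-1) := by
          refine (Finset.prod_le_prod (fun b _ => Finset.sum_nonneg fun l _ => hupn a b _)
            (fun b hb => ?_)).trans (le_of_eq ?_) (b := ∏ b ∈ Finset.univ.erase a, (n * A))
          · rw [Function.update_of_ne (Finset.ne_of_mem_erase hb)]; exact k1.le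
          · simp [Finset.card_erase_of_mem]
        have q2 : ∑ l, Function.update (fun _ => Ψ) a (hiP Ψ K) a (x l) ≤ n * η := by
          simpa using k2.le
        refine (mul_le_mul q2 q1 (Finset.prod_nonneg fun b _ => Finset.sum_nonneg fun l _ => hupn a b _)
          (by positivity)).trans (le_of_eq ?_)
        rw [nv, mul_pow]; ring
      have z3 : ∑ i : Fin v → Fin n, H (x ∘ i) ≤ (n:ℝ) ^ v * δ' := by
        rw [← Finset.sum_filter_add_sum_filter_not _ (fun i : Fin v → Fin n => Function.Injective i)]
        have y1 : ∑ i ∈ Finset.univ.filter (fun i : Fin v → Fin n => ¬ Function.Injective i), H (x ∘ i) ≤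
            (n:ℝ)^v * θ := by
          refine (Finset.sum_le_card_nsmul _ _ B fun i _ => hHB _).trans ?_
          rw [nsmul_eq_mul]
          have y2 : (((Finset.univ.filter (fun i : Fin v → Fin n => ¬ Function.Injective i)).card : ℕ):ℝ) ≤
              v ^ 2 * (n:ℝ) ^ (v-1) := by exact_mod_cast card_noninj
          rw [div_le_iff₀ hθ0] at hn1
          calc _ ≤ (v ^ 2 * (n:ℝ) ^ (v-1)) * B := by gcongr
            _ = (B * v ^ 2) * (n:ℝ) ^ (v-1) := by ring
            _ ≤ (n * θ) * (n:ℝ) ^ (v-1) := by gcongr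
            _ = _ := by rw [nv]; ring
        have : (n:ℝ)^v * δ' = (n:ℝ)^v * θ + (n:ℝ)^v * θ := by rw [hθ]; ring
        rw [this]
        exact add_le_add k3.le y1
      have z4 : ∑ a : Fin v, ∑ i : Fin v → Fin n, ∏ b, Function.update (fun _ => Ψ) a (hiP Ψ K) b (x (i b)) ≤
          (n:ℝ) ^ v * δ' := by
        refine (Finset.sum_le_sum fun a _ => z2 a).trans (le_of_eq ?_)
        rw [Finset.sum_const, Finset.card_univ, Fintype.card_fin, nsmul_eq_mul, ← hηδ]; ring
      refine z1.trans ?_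
      calc _ ≤ 2 ^ r * ((n:ℝ) ^ v * δ' + (n:ℝ) ^ v * δ') := by gcongr
        _ = (n:ℝ)^v * (2 ^ r * (δ' + δ')) := by ring
        _ = _ := by rw [hδδ]
    · rw [← ENNReal.ofReal_add (Real.exp_pos _).le (Real.exp_pos _).le,
        ← ENNReal.ofReal_add (by positivity) (Real.exp_pos _).le]
      refine ENNReal.ofReal_le_ofReal ?_
      have e1 : Real.exp (-(n * (M+1))) = Real.exp (-(n*M)) * Real.exp (-n) := by
        rw [← Real.exp_add]; ring_nf
      have e2 : Real.exp (-(n:ℝ)) ≤ 1 / 3 := by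
        have : (3:ℝ) ≤ Real.exp n := by
          have h1 := Real.add_one_le_exp (n:ℝ)
          have h2 : (2:ℝ) ≤ n := by exact_mod_cast hn2
          linarith
        rw [Real.exp_neg, ← one_div]
        exact one_div_le_one_div_of_le (by norm_num) this
      rw [e1]
      nlinarith [Real.exp_pos (-(n*M))]

end LDPaux

namespace LDPaux

theorem eLp_le {Ω : Type*} [MeasurableSpace Ω] (π : Measure Ω) (h : Ω → ℝ) (p : ℝ≥0∞) (hp0 : 1 ≤ p)
    (hp : p ≠ ⊤) (D : ℝ) (hD : 0 ≤ D)
    (hi : ∫⁻ z, ENNReal.ofReal (|h z| ^ p.toReal) ∂π ≤ ENNReal.ofReal D) :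
    eLpNorm h p π ≤ ENNReal.ofReal (D ^ (1 / p.toReal)) := by
  have h0 : p ≠ 0 := (lt_of_lt_of_le one_pos hp0).ne'
  rw [eLpNorm_eq_lintegral_rpow_enorm_toReal h0 hp, ← ENNReal.ofReal_rpow_of_nonneg hD (by positivity)]
  refine ENNReal.rpow_le_rpow (le_trans (le_of_eq (lintegral_congr fun z => ?_)) hi) (by positivity)
  rw [← ofReal_norm, Real.norm_eq_abs, ENNReal.ofReal_rpow_of_nonneg (abs_nonneg _) (by positivity)]

theorem emp_mp {v n : ℕ} (ι : ℝ → Fin n) (hι : Measurable ι) :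
    MeasurePreserving (fun (z : Fin v → ℝ) a => ι (z a)) (Measure.pi fun _ => unif01)
      (Measure.pi fun _ => unif01.map ι) := by
  haveI : IsProbabilityMeasure (unif01.map ι) := Measure.isProbabilityMeasure_map hι.aemeasurable
  exact measurePreserving_pi (fun _ => unif01) (fun _ => unif01.map ι) (fun _ => hι.measurePreserving _)

theorem emp_sing {v n : ℕ} (ι : ℝ → Fin n) (hι : Measurable ι)
    (hιu : ∀ l, unif01 {a | ι a = l} = (n : ℝ≥0∞)⁻¹) (i : Fin v → Fin n) :
    (Measure.pi fun _ : Fin v => unif01.map ι) {i} = ((n : ℝ≥0∞)⁻¹) ^ v := by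
  haveI : IsProbabilityMeasure (unif01.map ι) := Measure.isProbabilityMeasure_map hι.aemeasurable
  rw [Measure.pi_singleton]
  have : ∀ l, (unif01.map ι) {l} = (n : ℝ≥0∞)⁻¹ := fun l => by
    rw [Measure.map_apply hι (measurableSet_singleton l), ← hιu l]; rfl
  simp [this]

theorem emp_int {v n : ℕ} (ι : ℝ → Fin n) (hι : Measurable ι)
    (hιu : ∀ l, unif01 {a | ι a = l} = (n : ℝ≥0∞)⁻¹) (F : (Fin v → Fin n) → ℝ) :
    ∫ z : Fin v → ℝ, F (fun a => ι (z a)) ∂(Measure.pi fun _ => unif01) = (∑ i, F i) / (n:ℝ) ^ v := by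
  haveI : IsProbabilityMeasure (unif01.map ι) := Measure.isProbabilityMeasure_map hι.aemeasurable
  have mp := emp_mp (v := v) ι hι
  have h1 := integral_map (μ := Measure.pi fun _ : Fin v => unif01) mp.aemeasurable (f := F)
    (measurable_of_countable F).aestronglyMeasurable
  rw [mp.map_eq] at h1
  rw [← h1, integral_fintype (Integrable.of_finite)]
  simp only [Measure.real, emp_sing ι hι hιu, smul_eq_mul]
  rw [← Finset.mul_sum]
  simp
  ring

theorem emp_lint {v n : ℕ} (hn : n ≠ 0) (ι : ℝ → Fin n) (hι : Measurable ι)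
    (hιu : ∀ l, unif01 {a | ι a = l} = (n : ℝ≥0∞)⁻¹) (F : (Fin v → Fin n) → ℝ) (hF : ∀ i, 0 ≤ F i) :
    ∫⁻ z : Fin v → ℝ, ENNReal.ofReal (F (fun a => ι (z a))) ∂(Measure.pi fun _ => unif01) =
      ENNReal.ofReal ((∑ i, F i) / (n:ℝ) ^ v) := by
  have mp := emp_mp (v := v) ι hι
  rw [← emp_int ι hι hιu]
  have hm : Measurable fun z : Fin v → ℝ => F (fun a => ι (z a)) :=
    (measurable_of_countable F).comp mp.measurable
  rw [ofReal_integral_eq_lintegral_ofReal _ (ae_of_all _ fun z => hF _)]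
  refine bint _ hm ⟨∑ i, F i, fun z => ?_⟩
  rw [abs_of_nonneg (hF _)]
  exact Finset.single_le_sum (f := F) (fun i _ => hF i) (Finset.mem_univ _)

theorem CutB.add {w₁ w₂ w₃ : ℝ → ℝ → ℝ} {δ₁ δ₂ : ℝ} (h₁ : CutB (fun x y => w₁ x y - w₂ x y) δ₁)
    (h₂ : CutB (fun x y => w₂ x y - w₃ x y) δ₂)
    (i₁ : Integrable (Function.uncurry w₁) (unif01.prod unif01))
    (i₂ : Integrable (Function.uncurry w₂) (unif01.prod unif01))
    (i₃ : Integrable (Function.uncurry w₃) (unif01.prod unif01)) :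
    CutB (fun x y => w₁ x y - w₃ x y) (δ₁ + δ₂) := by
  intro S T hS hT
  have hST : ∀ z : ℝ × ℝ, S.indicator (fun _ => (1:ℝ)) z.1 * T.indicator (fun _ => (1:ℝ)) z.2 =
      (S ×ˢ T).indicator (fun _ => (1:ℝ)) z := by
    intro z
    by_cases h1 : z.1 ∈ S <;> by_cases h2 : z.2 ∈ T <;> simp [Set.indicator, h1, h2]
  have hI : ∀ f : ℝ × ℝ → ℝ, Integrable f (unif01.prod unif01) → Integrable
      (fun z : ℝ × ℝ => S.indicator (fun _ => (1:ℝ)) z.1 * T.indicator (fun _ => (1:ℝ)) z.2 * f z)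
      (unif01.prod unif01) := by
    intro f hf
    simp only [hST]
    have := hf.indicator (hS.prod hT)
    refine this.congr (ae_of_all _ fun z => ?_)
    by_cases h : z ∈ S ×ˢ T <;> simp [Set.indicator, h]
  have a1 := h₁ S T hS hT
  have a2 := h₂ S T hS hT
  have e : ∫ z, S.indicator (fun _ => (1:ℝ)) z.1 * T.indicator (fun _ => (1:ℝ)) z.2 *
      (w₁ z.1 z.2 - w₃ z.1 z.2) ∂(unif01.prod unif01) =
      ∫ z, S.indicator (fun _ => (1:ℝ)) z.1 * T.indicator (fun _ => (1:ℝ)) z.2 *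
      (w₁ z.1 z.2 - w₂ z.1 z.2) ∂(unif01.prod unif01) +
      ∫ z, S.indicator (fun _ => (1:ℝ)) z.1 * T.indicator (fun _ => (1:ℝ)) z.2 *
      (w₂ z.1 z.2 - w₃ z.1 z.2) ∂(unif01.prod unif01) := by
    rw [← integral_add (hI (fun z => w₁ z.1 z.2 - w₂ z.1 z.2) (i₁.sub i₂))
      (hI (fun z => w₂ z.1 z.2 - w₃ z.1 z.2) (i₂.sub i₃))]
    refine integral_congr_ae (ae_of_all _ fun z => ?_)
    simp only
    ring
  rw [e]
  exact (abs_add_le _ _).trans (add_le_add a1 a2)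

theorem CutB.symm {w₁ w₂ : ℝ → ℝ → ℝ} {δ : ℝ} (h : CutB (fun x y => w₁ x y - w₂ x y) δ) :
    CutB (fun x y => w₂ x y - w₁ x y) δ := by
  intro S T hS hT
  have := h S T hS hT
  rw [← abs_neg, ← integral_neg]
  refine le_trans (le_of_eq ?_) this
  congr 1
  refine integral_congr_ae (ae_of_all _ fun z => ?_)
  simp only; ring

theorem CutB.mono {w : ℝ → ℝ → ℝ} {δ δ' : ℝ} (h : CutB w δ) (hd : δ ≤ δ') : CutB w δ' :=
  fun S T hS hT => (h S T hS hT).trans hd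

/-- a single comparison: replacing `φ` by `g ∘ y`. -/
theorem repl {v : ℕ} {Ω : Type*} [MeasurableSpace Ω] (ν : Measure Ω) [IsProbabilityMeasure ν]
    (α : Ω → ℝ) (hα : MeasurePreserving α ν unif01)
    (E : Finset (Fin v × Fin v)) (d : ℕ) (hd : 1 ≤ d) (hE : Deg E d)
    (w : ℝ → ℝ → ℝ) (hw : Measurable (Function.uncurry w))
    (p q : ℝ≥0∞) (hpq : p⁻¹ + q⁻¹ = 1) (hq : 1 ≤ q) (hp0 : 1 ≤ p) (hp : p ≠ ⊤) (C : ℝ≥0)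
    (hC : kerNorm w (q * d) ≤ C) (f g : (Fin v → Ω) → ℝ) (hf : Measurable f) (hg : Measurable g)
    (hgb : ∃ B, ∀ z, |g z| ≤ B) (D : ℝ) (hD : 0 ≤ D)
    (hi : ∫⁻ z, ENNReal.ofReal (|f z - g z| ^ p.toReal) ∂(Measure.pi fun _ => ν) ≤ ENNReal.ofReal D) :
    |∫ z : Fin v → Ω, f z * ∏ e ∈ E, w (α (z e.1)) (α (z e.2)) ∂(Measure.pi fun _ => ν) -
      ∫ z : Fin v → Ω, g z * ∏ e ∈ E, w (α (z e.1)) (α (z e.2)) ∂(Measure.pi fun _ => ν)| ≤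
      D ^ (1 / p.toReal) * C ^ E.card := by
  obtain ⟨B, hB⟩ := hgb
  have h1 := eLp_le (Measure.pi fun _ : Fin v => ν) (fun z => f z - g z) p hp0 hp D hD hi
  have hfin : eLpNorm (fun z => f z - g z) p (Measure.pi fun _ : Fin v => ν) ≠ ⊤ :=
    ne_top_of_le_ne_top ENNReal.ofReal_ne_top h1
  have hgfin : eLpNorm g p (Measure.pi fun _ : Fin v => ν) ≠ ⊤ :=
    (MemLp.of_bound hg.aestronglyMeasurable B (ae_of_all _ hB)).2.ne
  have hCt : kerNorm w (q * d) ≠ ⊤ := ne_top_of_le_ne_top ENNReal.coe_ne_top hC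
  have j1 := ker_int ν α hα E d hd hE (fun _ => w) (fun _ _ => hw) p q hpq hq (fun _ _ => hCt)
    (fun z => f z - g z) (hf.sub hg) hfin
  have j2 := ker_int ν α hα E d hd hE (fun _ => w) (fun _ _ => hw) p q hpq hq (fun _ _ => hCt)
    g hg hgfin
  have b := ker_bound ν α hα E d hd hE w hw p q hpq hq C hC (fun z => f z - g z) (hf.sub hg) hfin
  have e : ∫ z : Fin v → Ω, f z * ∏ e ∈ E, w (α (z e.1)) (α (z e.2)) ∂(Measure.pi fun _ => ν) =
      ∫ z : Fin v → Ω, (f z - g z) * ∏ e ∈ E, w (α (z e.1)) (α (z e.2)) ∂(Measure.pi fun _ => ν) +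
      ∫ z : Fin v → Ω, g z * ∏ e ∈ E, w (α (z e.1)) (α (z e.2)) ∂(Measure.pi fun _ => ν) := by
    rw [← integral_add j1 j2]
    refine integral_congr_ae (ae_of_all _ fun z => ?_)
    simp only; ring
  rw [e, add_sub_cancel_right]
  refine b.trans ?_
  gcongr
  exact ENNReal.toReal_le_of_le_ofReal (by positivity) h1

end LDPaux

namespace LDPaux

/-- cell masses of `ν`. -/
noncomputable def mNu {X : Type*} [MeasurableSpace X] {k m : ℕ} (c : ℝ → Fin k) (y : X → Fin m)
    (ν : Measure (ℝ × X)) (ij : Fin k × Fin m) : ℝ := ν.real {z | c z.1 = ij.1 ∧ y z.2 = ij.2}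

/-- cell masses of the empirical measure. -/
noncomputable def mX {X : Type*} {k m n : ℕ} (c : ℝ → Fin k) (y : X → Fin m)
    (ι : ℝ → Fin n) (x : Fin n → X) (ij : Fin k × Fin m) : ℝ :=
  unif01.real {a | c a = ij.1 ∧ y (x (ι a)) = ij.2}

/-- averaged cell masses. -/
noncomputable def mBar {X : Type*} [MeasurableSpace X] {k m n : ℕ} (c : ℝ → Fin k) (y : X → Fin m)
    (ι : ℝ → Fin n) (P : Measure (Fin n → X)) (ij : Fin k × Fin m) : ℝ :=
  (unif01.prod P).real {z | c z.1 = ij.1 ∧ y (z.2 (ι z.1)) = ij.2}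

theorem meas_ker {k : ℕ} (c : ℝ → Fin k) (hc : Measurable c) (κ : Fin k → Fin k → ℝ) :
    Measurable (Function.uncurry fun x y => κ (c x) (c y)) :=
  (measurable_of_countable (fun ij : Fin k × Fin k => κ ij.1 ij.2)).comp
    ((hc.comp measurable_fst).prodMk (hc.comp measurable_snd))

theorem mp_fst {X : Type*} [MeasurableSpace X] {ν : Measure (ℝ × X)} (h : inTM ν) :
    MeasurePreserving Prod.fst ν unif01 := ⟨measurable_fst, h.2⟩

theorem eval_meas {X : Type*} [MeasurableSpace X] {n : ℕ} (ι : ℝ → Fin n) (hι : Measurable ι) :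
    Measurable fun z : ℝ × (Fin n → X) => z.2 (ι z.1) :=
  measurable_from_prod_countable_right
    (f := fun z : Fin n × (Fin n → X) => z.2 z.1) (fun l => measurable_pi_apply l)
    |>.comp ((hι.comp measurable_fst).prodMk measurable_snd)

end LDPaux

namespace LDPaux

/-- Conclusion of the approximation step. -/
def Assembled {X : Type*} [MeasurableSpace X] (μ : Measure X) {v : ℕ} (φ : (Fin v → X) → ℝ)
    (E : Finset (Fin v × Fin v)) (W : ℝ → ℝ → ℝ) (s : ℝ≥0∞) (C : ℝ≥0) : Prop :=
  ∀ ε > 0, ∀ M : ℝ, 0 ≤ M → ∃ (k m : ℕ) (c : ℝ → Fin k) (y : X → Fin m)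
    (R : (Fin k × Fin m → ℝ) → ℝ), Measurable c ∧ Measurable y ∧ Continuous R ∧
    (∀ ν : Measure (ℝ × X), inTM ν → EntL ν (unif01.prod μ) M →
      |∫ z : Fin v → ℝ × X, φ (fun a => (z a).2) * ∏ e ∈ E, W (z e.1).1 (z e.2).1
        ∂(Measure.pi fun _ => ν) - R (mNu c y ν)| ≤ ε) ∧
    ∃ δ > 0, ∀ᶠ n : ℕ in atTop, ∀ (ι : ℝ → Fin n) (Q : Fin n → Fin n → ℝ), Measurable ι →
      (∀ l, unif01 {a | ι a = l} = (n : ℝ≥0∞)⁻¹) →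
      kerNorm (fun x y => Q (ι x) (ι y)) s ≤ C →
      CutB (fun x y => Q (ι x) (ι y) - W x y) δ →
      (∀ J : Finset (Fin v → Fin n), (∀ i, Function.Injective i → i ∈ J) →
        (Measure.pi fun _ : Fin n => μ) {x | ε < |(∑ i ∈ J, φ (x ∘ i) * ∏ e ∈ E, Q (i e.1) (i e.2)) /
          (n:ℝ) ^ v - R (mX c y ι x)|} ≤ ENNReal.ofReal (Real.exp (-(n * M)))) ∧
      (∀ ν : Measure (ℝ × X), inTM ν → ∀ P : Measure (Fin n → X), IsProbabilityMeasure P →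
        (∀ l j, P {x | y (x l) = j} = n * ν {z | ι z.1 = l ∧ y z.2 = j}) →
        |R (mNu c y ν) - R (mBar c y ι P)| ≤ ε)

theorem assemble.{u} {X : Type u} [MeasurableSpace X] (μ : Measure X) [IsProbabilityMeasure μ]
    {v : ℕ} (hv : 1 ≤ v) (φ : (Fin v → X) → ℝ) (hφ : Measurable φ) (Ψ : X → ℝ) (hΨ : Measurable Ψ)
    (hΨ0 : ∀ x, 0 ≤ Ψ x) (p q : ℝ≥0∞) (hpq : p⁻¹ + q⁻¹ = 1) (hq : 1 ≤ q) (hp0 : 1 ≤ p) (hp : p ≠ ⊤)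
    (hdom : ∀ x, |φ x| ^ p.toReal ≤ ∏ a, Ψ (x a))
    (hexp : ∀ t : ℝ, 0 < t → ∫⁻ x, ENNReal.ofReal (Real.exp (t * Ψ x)) ∂μ < ⊤)
    (E : Finset (Fin v × Fin v)) (d : ℕ) (hd : 1 ≤ d) (hE : Deg E d) (C : ℝ≥0)
    (W : ℝ → ℝ → ℝ) (hW : Measurable (Function.uncurry W)) (hWC : kerNorm W (q * d) ≤ C)
    (hNA : ∀ ε : ℝ≥0∞, ε ≠ 0 → ∃ (k : ℕ) (c : ℝ → Fin k) (κ : Fin k → Fin k → ℝ), Measurable c ∧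
      kerNorm (fun x y => κ (c x) (c y)) (q * d) ≤ C ∧
      kerNorm (fun x y => W x y - κ (c x) (c y)) 1 ≤ ε) :
    Assembled μ φ E W (q * d) C := by
  classical
  intro ε hε M hM
  have hr : 1 ≤ p.toReal := by
    have := ENNReal.toReal_mono hp hp0
    simpa using this
  have hr0 : 0 < p.toReal := by linarith
  have hqd : 1 ≤ q * (d:ℝ≥0∞) := one_le_qd hq hd
  obtain ⟨C1, hC1⟩ : ∃ C1 : ℝ, C1 = (C:ℝ) ^ E.card + 1 := ⟨_, rfl⟩
  have hC10 : 0 < C1 := by rw [hC1]; positivity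
  obtain ⟨D, hD⟩ : ∃ D : ℝ, D = (ε / (4 * C1)) ^ p.toReal := ⟨_, rfl⟩
  have hD0 : 0 < D := by rw [hD]; positivity
  have hDC : D ^ (1 / p.toReal) * (C:ℝ) ^ E.card ≤ ε / 4 := by
    rw [hD, ← Real.rpow_mul (by positivity), mul_one_div_cancel hr0.ne', Real.rpow_one]
    have : (C:ℝ) ^ E.card ≤ C1 := by rw [hC1]; linarith
    calc _ ≤ ε / (4 * C1) * C1 := by gcongr
      _ = ε / 4 := by field_simp
  obtain ⟨m, y, g, hy, happ1, happ2⟩ := approx μ hv φ hφ Ψ hΨ hΨ0 p.toReal hr hdom hexp (D / 2)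
    (by positivity) M hM
  obtain ⟨δa, hδa, Ha⟩ := count_fin.{u} E d hd hE p q hpq hq hp0 hp C g (ε / 4) (by positivity)
  obtain ⟨δb, hδb, Hb⟩ := count_fin.{0} E d hd hE p q hpq hq hp0 hp C g (ε / 4) (by positivity)
  obtain ⟨δ1, hδ1, hdelA, hdelB⟩ : ∃ δ1 > 0, δ1 ≤ δa ∧ δ1 ≤ δb :=
    ⟨min δa δb, lt_min hδa hδb, min_le_left _ _, min_le_right _ _⟩
  obtain ⟨k, c, κ, hc, hκC, hκ1⟩ := hNA (ENNReal.ofReal (δ1 / 2)) (by simpa using hδ1)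
  have hκm := meas_ker c hc κ
  have hcutW : CutB (fun x y => W x y - κ (c x) (c y)) (δ1 / 2) :=
    CutB_of_L1 (fun x y => W x y - κ (c x) (c y)) (hW.sub hκm) _ (by positivity) hκ1
  obtain ⟨Bg, hBg0, hBg⟩ : ∃ B : ℝ, 0 ≤ B ∧ ∀ s, |g s| ≤ B := by
    refine ⟨∑ s, |g s|, Finset.sum_nonneg fun _ _ => abs_nonneg _, fun s => ?_⟩
    exact Finset.single_le_sum (f := fun s => |g s|) (fun _ _ => abs_nonneg _) (Finset.mem_univ s)
  have hgm : Measurable g := measurable_of_countable g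
  refine ⟨k, m, c, y, Poly E κ g, hc, hy, Poly_cont E κ g, ?_, δ1 / 2, by positivity, ?_⟩
  · intro ν hν hent
    haveI := hν.1
    have hpush := push ν (fun z => c z.1) (hc.comp measurable_fst) (fun z => y z.2)
      (hy.comp measurable_snd) E κ g
    have hlam : IsProbabilityMeasure (ν.map Prod.snd) :=
      Measure.isProbabilityMeasure_map measurable_snd.aemeasurable
    have hentl : EntL (ν.map Prod.snd) μ M := by
      have := hent.map Prod.snd measurable_snd
      rwa [Measure.map_snd_prod, measure_univ, one_smul] at this
    have mp : MeasurePreserving (fun (z : Fin v → ℝ × X) a => (z a).2) (Measure.pi fun _ => ν)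
        (Measure.pi fun _ => ν.map Prod.snd) :=
      measurePreserving_pi (fun _ => ν) (fun _ => ν.map Prod.snd)
        (fun _ => measurable_snd.measurePreserving _)
    have hgy : Measurable fun z : Fin v → X => g (fun a => y (z a)) :=
      hgm.comp (measurable_pi_lambda _ fun a => hy.comp (measurable_pi_apply a))
    have hl := happ1 _ hlam hentl
    rw [← mp.lintegral_comp (f := fun z => ENNReal.ofReal (|φ z - g (fun a => y (z a))| ^ p.toReal))
      (((hφ.sub hgy).abs.pow_const _).ennreal_ofReal)] at hl
    have h1 := repl ν Prod.fst (mp_fst hν) E d hd hE W hW p q hpq hq hp0 hp C hWC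
      (fun z => φ (fun a => (z a).2)) (fun z => g (fun a => y (z a).2)) (hφ.comp mp.measurable)
      (hgy.comp mp.measurable) ⟨Bg, fun z => hBg _⟩ D hD0.le
      (hl.trans (ENNReal.ofReal_le_ofReal (by linarith)))
    have h2 := Ha W _ hW hκm hWC hκC (hcutW.mono (by linarith)) (ℝ × X) ν Prod.fst (mp_fst hν)
      (fun z => y z.2) (hy.comp measurable_snd)
    have h3 := h1.trans hDC
    have hR : Poly E κ g (mNu c y ν) = Poly E κ g (fun ij => ν.real {ω | c ω.1 = ij.1 ∧ y ω.2 = ij.2}) := rfl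
    rw [hR, ← hpush]
    rw [abs_le] at h2 h3 ⊢
    constructor <;> linarith [h2.1, h2.2, h3.1, h3.2]
  · have hlim : ∀ᶠ n : ℕ in atTop, Bg ^ p.toReal * v ^ 2 / (D / 2) ≤ n :=
      tendsto_natCast_atTop_atTop.eventually_ge_atTop _
    filter_upwards [hlim, eventually_ge_atTop 1, happ2] with n hn1 hn2 hn3
    intro ι Q hι hιu hQC hQW
    have hn0 : (0:ℝ) < n := by exact_mod_cast hn2
    have hnn : n ≠ 0 := by omega
    have nv : (n:ℝ) ^ v = n * (n:ℝ) ^ (v-1) := by rw [← pow_succ', Nat.sub_add_cancel hv]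
    have hwm := meas_ker ι hι Q
    have iQ := ker_integrable _ hwm hqd (ne_top_of_le_ne_top ENNReal.coe_ne_top hQC)
    have iW := ker_integrable _ hW hqd (ne_top_of_le_ne_top ENNReal.coe_ne_top hWC)
    have iκ := ker_integrable _ hκm hqd (ne_top_of_le_ne_top ENNReal.coe_ne_top hκC)
    have hcut1 : CutB (fun x y => Q (ι x) (ι y) - κ (c x) (c y)) δ1 := by
      have := hQW.add hcutW iQ iW iκ
      exact this.mono (by linarith)
    constructor
    · intro J hJ
      refine le_trans (measure_mono fun x hx => ?_) hn3
      simp only [mem_ofPred_eq] at hx ⊢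
      by_contra hcon
      refine absurd hx (not_lt.2 ?_)
      rw [not_lt] at hcon
      set yx : ℝ → Fin m := fun a => y (x (ι a)) with hyx
      have hyxm : Measurable yx := (measurable_of_countable fun l => y (x l)).comp hι
      have mpid : MeasurePreserving (id : ℝ → ℝ) unif01 unif01 := MeasurePreserving.id _
      set F : (Fin v → Fin n) → ℝ := fun i => if i ∈ J then φ (x ∘ i) else 0 with hF
      have emp := emp_mp (v := v) ι hι
      have z1 : (∑ i ∈ J, φ (x ∘ i) * ∏ e ∈ E, Q (i e.1) (i e.2)) / (n:ℝ) ^ v =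
          ∫ z : Fin v → ℝ, F (fun a => ι (z a)) * ∏ e ∈ E, Q (ι (z e.1)) (ι (z e.2))
            ∂(Measure.pi fun _ => unif01) := by
        rw [emp_int ι hι hιu (fun i => F i * ∏ e ∈ E, Q (i e.1) (i e.2))]
        congr 1
        simp only [hF, ite_mul, zero_mul]
        rw [← Finset.sum_filter]
        congr 1
        ext i; simp
      have z2 : ∑ i, |F i - g (fun a => y (x (i a)))| ^ p.toReal ≤ (n:ℝ) ^ v * D := by
        have w1 : ∀ i, |F i - g (fun a => y (x (i a)))| ^ p.toReal ≤
            |φ (x ∘ i) - g (fun a => y (x (i a)))| ^ p.toReal +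
            if ¬ Function.Injective i then Bg ^ p.toReal else 0 := by
          intro i
          by_cases hi : i ∈ J
          · have : F i = φ (x ∘ i) := by simp only [hF]; rw [if_pos hi]
            rw [this]
            have hB0 : 0 ≤ Bg ^ p.toReal := by positivity
            split_ifs <;> linarith
          · have hni : ¬ Function.Injective i := fun h => hi (hJ i h)
            have : F i = 0 := by simp only [hF]; rw [if_neg hi]
            rw [this, if_pos hni, zero_sub, abs_neg]
            have h1 : |g (fun a => y (x (i a)))| ^ p.toReal ≤ Bg ^ p.toReal :=
              Real.rpow_le_rpow (abs_nonneg _) (hBg _) hr0.le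
            have h2 : 0 ≤ |φ (x ∘ i) - g (fun a => y (x (i a)))| ^ p.toReal := by positivity
            linarith
        refine (Finset.sum_le_sum fun i _ => w1 i).trans ?_
        rw [Finset.sum_add_distrib, ← Finset.sum_filter, Finset.sum_const, nsmul_eq_mul]
        have y2 : (((Finset.univ.filter (fun i : Fin v → Fin n => ¬ Function.Injective i)).card : ℕ):ℝ) ≤
              v ^ 2 * (n:ℝ) ^ (v-1) := by exact_mod_cast card_noninj
        rw [div_le_iff₀ (by positivity)] at hn1
        have y3 : (((Finset.univ.filter (fun i : Fin v → Fin n => ¬ Function.Injective i)).card : ℕ):ℝ) *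
            Bg ^ p.toReal ≤ (n:ℝ) ^ v * (D / 2) := by
          calc _ ≤ (v ^ 2 * (n:ℝ) ^ (v-1)) * Bg ^ p.toReal := by gcongr
            _ = (Bg ^ p.toReal * v ^ 2) * (n:ℝ) ^ (v-1) := by ring
            _ ≤ (n * (D / 2)) * (n:ℝ) ^ (v-1) := by gcongr
            _ = _ := by rw [nv]; ring
        linarith
      have z3 : ∫⁻ z : Fin v → ℝ, ENNReal.ofReal (|F (fun a => ι (z a)) - g (fun a => yx (z a))| ^ p.toReal)
          ∂(Measure.pi fun _ => unif01) ≤ ENNReal.ofReal D := by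
        have := emp_lint hnn ι hι hιu (fun i : Fin v → Fin n => |F i - g (fun a => y (x (i a)))| ^ p.toReal)
          (fun i => by positivity)
        simp only [hyx]
        rw [this]
        refine ENNReal.ofReal_le_ofReal ?_
        rw [div_le_iff₀ (by positivity), mul_comm]
        exact z2
      have h1 := repl unif01 id mpid E d hd hE _ hwm p q hpq hq hp0 hp C hQC
        (fun z => F (fun a => ι (z a))) (fun z => g (fun a => yx (z a)))
        ((measurable_of_countable F).comp emp.measurable)
        (hgm.comp (measurable_pi_lambda _ fun a => hyxm.comp (measurable_pi_apply a)))
        ⟨Bg, fun z => hBg _⟩ D hD0.le z3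
      have h2 := Hb _ _ hwm hκm hQC hκC (hcut1.mono hdelB) ℝ unif01 id mpid yx hyxm
      have h3 := h1.trans hDC
      have hpush := push unif01 c hc yx hyxm E κ g
      have hR : Poly E κ g (mX c y ι x) = Poly E κ g (fun ij => unif01.real {ω | c ω = ij.1 ∧ yx ω = ij.2}) := rfl
      rw [hR, ← hpush, z1]
      simp only [id] at h2 h3
      rw [abs_le] at h2 h3 ⊢
      constructor <;> linarith [h2.1, h2.2, h3.1, h3.2]
    · intro ν hν P hP hPν
      haveI := hν.1
      have hev := eval_meas (X := X) ι hι
      have mp2 : MeasurePreserving Prod.fst (unif01.prod P) unif01 := measurePreserving_fst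
      have a1 := Ha _ _ hwm hκm hQC hκC (hcut1.mono hdelA) (ℝ × X) ν Prod.fst (mp_fst hν)
        (fun z => y z.2) (hy.comp measurable_snd)
      have a2 := Ha _ _ hwm hκm hQC hκC (hcut1.mono hdelA) (ℝ × (Fin n → X)) (unif01.prod P) Prod.fst mp2
        (fun z => y (z.2 (ι z.1))) (hy.comp hev)
      have b1 := push ν (fun z => c z.1) (hc.comp measurable_fst) (fun z => y z.2)
        (hy.comp measurable_snd) E κ g
      have b2 := push (unif01.prod P) (fun z => c z.1) (hc.comp measurable_fst) (fun z => y (z.2 (ι z.1)))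
        (hy.comp hev) E κ g
      have c1 := push ν (fun z => ι z.1) (hι.comp measurable_fst) (fun z => y z.2)
        (hy.comp measurable_snd) E Q g
      have c2 := push (unif01.prod P) (fun z => ι z.1) (hι.comp measurable_fst) (fun z => y (z.2 (ι z.1)))
        (hy.comp hev) E Q g
      rw [b1, c1] at a1
      rw [b2, c2] at a2
      have eq : (fun ij : Fin n × Fin m => ν.real {ω | ι ω.1 = ij.1 ∧ y ω.2 = ij.2}) =
          fun ij => (unif01.prod P).real {ω | ι ω.1 = ij.1 ∧ y (ω.2 (ι ω.1)) = ij.2} := by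
        ext ⟨l, j⟩
        simp only [Measure.real]
        congr 1
        have : {ω : ℝ × (Fin n → X) | ι ω.1 = l ∧ y (ω.2 (ι ω.1)) = j} =
            {a | ι a = l} ×ˢ {x | y (x l) = j} := by
          ext ω
          simp only [mem_ofPred_eq, Set.mem_prod]
          constructor
          · rintro ⟨h1, h2⟩; rw [h1] at h2; exact ⟨h1, h2⟩
          · rintro ⟨h1, h2⟩; rw [h1]; exact ⟨rfl, h2⟩
        rw [this, Measure.prod_prod, hιu, hPν, ← mul_assoc, ENNReal.inv_mul_cancel (by simpa using hnn)
          (by simp), one_mul]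
      rw [eq] at a1
      show |Poly E κ g (fun ij => ν.real {ω | c ω.1 = ij.1 ∧ y ω.2 = ij.2}) -
        Poly E κ g (fun ij => (unif01.prod P).real {ω | c ω.1 = ij.1 ∧ y (ω.2 (ι ω.1)) = ij.2})| ≤ ε
      rw [abs_le] at a1 a2 ⊢
      constructor <;> linarith [a1.1, a1.2, a2.1, a2.2]

end LDPaux

namespace LDPaux

theorem lim_meas {S Ω : Type*} [MeasurableSpace Ω] (𝒰 : Ultrafilter S) (ν : S → Measure Ω)
    (hν : ∀ s, IsProbabilityMeasure (ν s)) (ρ : Measure Ω) [IsProbabilityMeasure ρ] (c : ℝ)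
    (hent : ∀ s, EntL (ν s) ρ c) :
    ∃ ν' : Measure Ω, IsProbabilityMeasure ν' ∧ EntL ν' ρ c ∧
      ∀ A, MeasurableSet A → Tendsto (fun s => (ν s).real A) 𝒰 (nhds (ν'.real A)) := by
  have hex : ∀ A : Set Ω, ∃ x ∈ Set.Icc (0:ℝ) 1, Tendsto (fun s => (ν s).real A) 𝒰 (nhds x) := by
    intro A
    have hcpt : IsCompact (Set.Icc (0:ℝ) 1) := isCompact_Icc
    obtain ⟨x, hx, hle⟩ := (isCompact_iff_ultrafilter_le_nhds.1 hcpt) (𝒰.map fun s => (ν s).real A) (by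
      rw [le_principal_iff]
      refine Filter.mem_map.2 (Filter.univ_mem' fun s => ?_)
      exact ⟨measureReal_nonneg, measureReal_le_one⟩)
    exact ⟨x, hx, hle⟩
  choose L hL01 hL using hex
  have hadd : ∀ A B, MeasurableSet B → Disjoint A B → L (A ∪ B) = L A + L B := by
    intro A B hB hd
    refine tendsto_nhds_unique (hL (A ∪ B)) (((hL A).add (hL B)).congr fun s => ?_)
    exact (measureReal_union hd hB).symm
  have hac : ∀ A, MeasurableSet A → ∀ t, 0 ≤ t →
      t * L A ≤ c + Real.log (1 + ρ.real A * (Real.exp t - 1)) := by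
    intro A hA t ht
    refine le_of_tendsto ((hL A).const_mul t) (Eventually.of_forall fun s => ?_)
    haveI := hν s
    exact (hent s).ac A hA t ht
  obtain ⟨s0⟩ := 𝒰.nonempty_of_mem (Filter.univ_mem)
  have hc0 : 0 ≤ c := by haveI := hν s0; exact (hent s0).nonneg
  have hcont : ∀ A : ℕ → Set Ω, (∀ n, MeasurableSet (A n)) → Antitone A → ⋂ n, A n = ∅ →
      Tendsto (fun n => L (A n)) atTop (nhds 0) := by
    intro A hA hanti hempty
    have h1 : Tendsto (fun n => ρ.real (A n)) atTop (nhds 0) := by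
      have := tendsto_measure_iInter_atTop (μ := ρ) (fun n => (hA n).nullMeasurableSet) hanti
        ⟨0, measure_ne_top _ _⟩
      rw [hempty, measure_empty] at this
      have h2 := (ENNReal.tendsto_toReal (a := 0) (by simp)).comp this
      simpa [Measure.real, Function.comp_def] using h2
    rw [Metric.tendsto_atTop]
    intro ε hε
    obtain ⟨t, ht⟩ : ∃ t : ℝ, t = (c + 1) / (ε / 2) := ⟨_, rfl⟩
    have ht0 : 0 < t := by rw [ht]; positivity
    have h2 : Tendsto (fun n => Real.log (1 + ρ.real (A n) * (Real.exp t - 1))) atTop (nhds 0) := by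
      have h3 : Tendsto (fun n => 1 + ρ.real (A n) * (Real.exp t - 1)) atTop (nhds 1) := by
        have := (h1.mul_const (Real.exp t - 1)).const_add 1
        simpa using this
      have := (Real.continuousAt_log (x := 1) one_ne_zero).tendsto.comp h3
      simpa [Function.comp_def] using this
    obtain ⟨N, hN⟩ := (h2.eventually (gt_mem_nhds (show (0:ℝ) < 1 by norm_num))).exists_forall_of_atTop
    refine ⟨N, fun n hn => ?_⟩
    have h4 := hac (A n) (hA n) t ht0.le
    have h5 := hN n hn
    rw [Real.dist_eq, sub_zero, abs_of_nonneg (hL01 _).1]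
    have h6 : t * L (A n) ≤ t * (ε / 2) := by
      have : t * (ε / 2) = c + 1 := by rw [ht]; field_simp
      linarith
    have := le_of_mul_le_mul_left h6 ht0
    linarith
  let m : ∀ A : Set Ω, MeasurableSet A → ℝ≥0∞ := fun A _ => ENNReal.ofReal (L A)
  have hL0 : L ∅ = 0 := by
    have := hadd ∅ ∅ MeasurableSet.empty (by simp)
    simpa using this
  have hm0 : m ∅ MeasurableSet.empty = 0 := by simp [m, hL0]
  have hmU : ∀ ⦃f : ℕ → Set Ω⦄ (h : ∀ i, MeasurableSet (f i)), Pairwise (Function.onFun Disjoint f) →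
      m (⋃ i, f i) (MeasurableSet.iUnion h) = ∑' i, m (f i) (h i) := by
    intro f hf hd
    have htail : Tendsto (fun n => L (⋃ i ≥ n, f i)) atTop (nhds 0) := by
      refine hcont _ (fun n => MeasurableSet.iUnion fun i => MeasurableSet.iUnion fun _ => hf i) ?_ ?_
      · intro a b hab
        exact biUnion_subset_biUnion_left fun i hi => le_trans hab hi
      · ext x
        simp only [mem_iInter, mem_iUnion, mem_empty_iff_false, iff_false, not_forall]
        by_cases hx : ∃ i, x ∈ f i
        · obtain ⟨i, hi⟩ := hx
          refine ⟨i + 1, ?_⟩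
          rintro ⟨j, hj, hxj⟩
          have hij : i ≠ j := by intro h; subst h; exact absurd hj (by simp)
          exact (Set.disjoint_left.1 (hd hij) hi) hxj
        · refine ⟨0, ?_⟩
          rintro ⟨j, hj, hxj⟩
          exact hx ⟨j, hxj⟩
    have hpart : ∀ n, L (⋃ i, f i) = ∑ i ∈ Finset.range n, L (f i) + L (⋃ i ≥ n, f i) := by
      intro n
      induction n with
      | zero => simp
      | succ n ih =>
        rw [ih, Finset.sum_range_succ, add_assoc]
        congr 1
        rw [← hadd _ _ (MeasurableSet.iUnion fun i => MeasurableSet.iUnion fun _ => hf i)]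
        · congr 1
          ext x
          simp only [mem_iUnion, mem_union]
          constructor
          · rintro ⟨i, hi, hx⟩
            rcases eq_or_lt_of_le hi with h | h
            · left; rw [h]; exact hx
            · right; exact ⟨i, h, hx⟩
          · rintro (hx | ⟨i, hi, hx⟩)
            · exact ⟨n, le_rfl, hx⟩
            · exact ⟨i, by have : i ≥ n + 1 := hi
                           show i ≥ n
                           omega, hx⟩
        · rw [Set.disjoint_iUnion₂_right]
          intro i hi
          exact hd (by have : i ≥ n + 1 := hi
                       omega)
    have h1 : Tendsto (fun n => ∑ i ∈ Finset.range n, L (f i)) atTop (nhds (L (⋃ i, f i))) := by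
      have : ∀ n, ∑ i ∈ Finset.range n, L (f i) = L (⋃ i, f i) - L (⋃ i ≥ n, f i) := by
        intro n; rw [hpart n]; ring
      simp only [this]
      simpa using htail.const_sub (L (⋃ i, f i))
    have h2 := (ENNReal.continuous_ofReal.tendsto _).comp h1
    refine tendsto_nhds_unique h2 ((ENNReal.tendsto_nat_tsum _).congr fun n => ?_)
    simp only [Function.comp, m]
    rw [ENNReal.ofReal_sum_of_nonneg fun i _ => (hL01 _).1]
  refine ⟨Measure.ofMeasurable m hm0 hmU, ?_⟩
  set ν' := Measure.ofMeasurable m hm0 hmU with hν'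
  have hval : ∀ A, MeasurableSet A → ν' A = ENNReal.ofReal (L A) := fun A hA =>
    Measure.ofMeasurable_apply A hA
  have hvr : ∀ A, MeasurableSet A → ν'.real A = L A := fun A hA => by
    rw [Measure.real, hval A hA, ENNReal.toReal_ofReal (hL01 _).1]
  have hprob : IsProbabilityMeasure ν' := by
    refine ⟨?_⟩
    rw [hval _ MeasurableSet.univ]
    have : L Set.univ = 1 := by
      refine tendsto_nhds_unique (hL Set.univ) (tendsto_const_nhds.congr fun s => ?_)
      haveI := hν s
      simp
    rw [this]; simp
  have hT : ∀ A, MeasurableSet A → Tendsto (fun s => (ν s).real A) 𝒰 (nhds (ν'.real A)) :=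
    fun A hA => by rw [hvr A hA]; exact hL A
  refine ⟨hprob, ?_, hT⟩
  have hsimple : ∀ g : SimpleFunc Ω ℝ, ∀ B, (∀ x, |g x| ≤ B) →
      ∫ x, g x ∂ν' ≤ c + Real.log (∫ x, Real.exp (g x) ∂ρ) := by
    intro g B hB
    have h1 : Tendsto (fun s => ∫ x, g x ∂ν s) 𝒰 (nhds (∫ x, g x ∂ν')) := by
      rw [SimpleFunc.integral_eq_sum g (bint ν' g.measurable ⟨B, hB⟩)]
      have : ∀ s, ∫ x, g x ∂ν s = ∑ x ∈ g.range, (ν s).real (g ⁻¹' {x}) • x := fun s => by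
        haveI := hν s
        exact SimpleFunc.integral_eq_sum g (bint (ν s) g.measurable ⟨B, hB⟩)
      simp only [this]
      exact tendsto_finsetSum _ fun x _ => (hT _ (g.measurableSet_preimage _)).smul_const x
    exact le_of_tendsto h1 (Eventually.of_forall fun s => hent s g g.measurable ⟨B, hB⟩)
  intro g hg hB
  obtain ⟨B, hB⟩ := hB
  have hgs := hg.stronglyMeasurable
  have hB0 : 0 ≤ B := by
    have : Nonempty Ω := by
      by_contra h
      rw [not_nonempty_iff] at h
      have h1 := hprob.measure_univ
      rw [Set.univ_eq_empty_iff.2 h] at h1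
      simp at h1
    exact (abs_nonneg _).trans (hB this.some)
  have hbd : ∀ n x, |hgs.approxBounded B n x| ≤ B := fun n x => hgs.norm_approxBounded_le hB0 n x
  have hlim : ∀ x, Tendsto (fun n => hgs.approxBounded B n x) atTop (nhds (g x)) := fun x =>
    hgs.tendsto_approxBounded_of_norm_le (hB x)
  have l1 : Tendsto (fun n => ∫ x, hgs.approxBounded B n x ∂ν') atTop (nhds (∫ x, g x ∂ν')) :=
    tendsto_integral_of_dominated_convergence (fun _ => B)
      (fun n => (hgs.approxBounded B n).measurable.aestronglyMeasurable) (integrable_const _)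
      (fun n => ae_of_all _ (hbd n)) (ae_of_all _ hlim)
  have l2 : Tendsto (fun n => ∫ x, Real.exp (hgs.approxBounded B n x) ∂ρ) atTop
      (nhds (∫ x, Real.exp (g x) ∂ρ)) :=
    tendsto_integral_of_dominated_convergence (fun _ => Real.exp B)
      (fun n => (Real.measurable_exp.comp (hgs.approxBounded B n).measurable).aestronglyMeasurable)
      (integrable_const _)
      (fun n => ae_of_all _ fun x => by
        rw [Real.norm_eq_abs, Real.abs_exp]
        exact Real.exp_le_exp.2 ((le_abs_self _).trans (hbd n x)))
      (ae_of_all _ fun x => (Real.continuous_exp.tendsto _).comp (hlim x))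
  have hpos : 0 < ∫ x, Real.exp (g x) ∂ρ := (Real.exp_pos _).trans_le (exp_int_bounds ρ hg hB).1
  exact le_of_tendsto_of_tendsto l1 ((l2.log hpos.ne').const_add c)
    (Eventually.of_forall fun n => hsimple _ B (hbd n))

end LDPaux

namespace LDPaux

/-- The functional `T` as an integral over the product measure. -/
noncomputable def Tf {X : Type*} [MeasurableSpace X] {v : ℕ} (φ : (Fin v → X) → ℝ)
    (E : Finset (Fin v × Fin v)) (W : ℝ → ℝ → ℝ) (ν : Measure (ℝ × X)) : ℝ :=
  ∫ z : Fin v → ℝ × X, φ (fun a => (z a).2) * ∏ e ∈ E, W (z e.1).1 (z e.2).1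
        ∂(Measure.pi fun _ => ν)

/-- The rate function. -/
noncomputable def Irate {X : Type*} [MeasurableSpace X] (μ : Measure X) {v : ℕ} (φ : (Fin v → X) → ℝ)
    (E : Finset (Fin v × Fin v)) (W : ℝ → ℝ → ℝ) (t : ℝ) : ℝ≥0∞ :=
  ⨅ (ν : Measure (ℝ × X)) (_ : inTM ν ∧ KLdiv ν (unif01.prod μ) ≠ ⊤ ∧ Tf φ E W ν = t),
    KLdiv ν (unif01.prod μ)

theorem Irate_lt {X : Type*} [MeasurableSpace X] (μ : Measure X) [IsProbabilityMeasure μ]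
    {v : ℕ} (φ : (Fin v → X) → ℝ)
    (E : Finset (Fin v × Fin v)) (W : ℝ → ℝ → ℝ) (t : ℝ) (M : ℝ) (hM : 0 ≤ M)
    (h : Irate μ φ E W t < ENNReal.ofReal M) :
    ∃ ν : Measure (ℝ × X), inTM ν ∧ EntL ν (unif01.prod μ) M ∧ Tf φ E W ν = t := by
  unfold Irate at h
  simp only [iInf_lt_iff] at h
  obtain ⟨ν, ⟨h1, h2, h3⟩, h4⟩ := h
  haveI := h1.1
  exact ⟨ν, h1, EntL_of_KL ν _ M hM h4.le, h3⟩

theorem Irate_le {X : Type*} [MeasurableSpace X] (μ : Measure X) [IsProbabilityMeasure μ]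
    {v : ℕ} (φ : (Fin v → X) → ℝ)
    (E : Finset (Fin v × Fin v)) (W : ℝ → ℝ → ℝ) (M : ℝ)
    (ν : Measure (ℝ × X)) (h1 : inTM ν) (h2 : EntL ν (unif01.prod μ) M) :
    Irate μ φ E W (Tf φ E W ν) ≤ ENNReal.ofReal M := by
  haveI := h1.1
  have h3 := h2.KL_le
  unfold Irate
  exact (iInf₂_le ν ⟨h1, (h3.trans_lt ENNReal.ofReal_lt_top).ne, rfl⟩).trans h3

theorem lim_T {X S : Type*} [MeasurableSpace X] (μ : Measure X) [IsProbabilityMeasure μ]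
    {v : ℕ} (φ : (Fin v → X) → ℝ) (E : Finset (Fin v × Fin v)) (W : ℝ → ℝ → ℝ) (s : ℝ≥0∞) (C : ℝ≥0)
    (hA : Assembled μ φ E W s C) (𝒰 : Ultrafilter S) (ν : S → Measure (ℝ × X)) (hν : ∀ s, inTM (ν s))
    (M : ℝ) (hent : ∀ s, EntL (ν s) (unif01.prod μ) M) :
    ∃ ν' : Measure (ℝ × X), inTM ν' ∧ EntL ν' (unif01.prod μ) M ∧
      Tendsto (fun s => Tf φ E W (ν s)) 𝒰 (nhds (Tf φ E W ν')) := by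
  obtain ⟨ν', hp, he, hlim⟩ := lim_meas 𝒰 ν (fun s => (hν s).1) (unif01.prod μ) M hent
  have hTM : inTM ν' := by
    refine ⟨hp, ?_⟩
    ext A hA
    rw [Measure.map_apply measurable_fst hA]
    have h1 : ν'.real (Prod.fst ⁻¹' A) = unif01.real A := by
      refine tendsto_nhds_unique (hlim _ (measurable_fst hA)) (tendsto_const_nhds.congr fun s => ?_)
      rw [← (hν s).2, Measure.real, Measure.real, Measure.map_apply measurable_fst hA]
    exact (ENNReal.toReal_eq_toReal_iff' (measure_ne_top _ _) (measure_ne_top _ _)).1 h1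
  refine ⟨ν', hTM, he, ?_⟩
  rw [Metric.tendsto_nhds]
  intro ε hε
  obtain ⟨k, m, c, y, R, hc, hy, hR, h1, -⟩ := hA (ε / 4) (by positivity) M he.nonneg
  have hm : Tendsto (fun s => mNu c y (ν s)) 𝒰 (nhds (mNu c y ν')) := by
    rw [tendsto_pi_nhds]
    intro ij
    refine hlim _ ?_
    exact ((hc.comp measurable_fst) (measurableSet_singleton ij.1)).inter
      ((hy.comp measurable_snd) (measurableSet_singleton ij.2))
  have hRm := (hR.tendsto _).comp hm
  rw [Metric.tendsto_nhds] at hRm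
  filter_upwards [hRm (ε / 4) (by positivity)] with s hs
  have a1 := h1 (ν s) (hν s) (hent s)
  have a2 := h1 ν' hTM he
  rw [Real.dist_eq] at hs ⊢
  simp only [Function.comp] at hs
  have e1 : Tf φ E W (ν s) - Tf φ E W ν' = (Tf φ E W (ν s) - R (mNu c y (ν s))) +
    (R (mNu c y (ν s)) - R (mNu c y ν')) - (Tf φ E W ν' - R (mNu c y ν')) := by ring
  rw [e1]
  unfold Tf
  refine (abs_sub _ _).trans_lt ?_
  have := abs_add_le (Tf φ E W (ν s) - R (mNu c y (ν s))) (R (mNu c y (ν s)) - R (mNu c y ν'))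
  unfold Tf at this
  linarith

theorem good {X : Type*} [MeasurableSpace X] (μ : Measure X) [IsProbabilityMeasure μ]
    {v : ℕ} (φ : (Fin v → X) → ℝ) (E : Finset (Fin v × Fin v)) (W : ℝ → ℝ → ℝ) (s : ℝ≥0∞) (C : ℝ≥0)
    (hA : Assembled μ φ E W s C) (c : ℝ≥0∞) (hc : c ≠ ⊤) : IsCompact {t | Irate μ φ E W t ≤ c} := by
  rw [isCompact_iff_ultrafilter_le_nhds]
  intro 𝒰 h𝒰
  lift c to ℝ≥0 using hc
  have key : ∀ η : ℝ, 0 < η → ∃ a, Irate μ φ E W a ≤ ENNReal.ofReal (c + η) ∧ ↑𝒰 ≤ nhds a := by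
    intro η hη
    rw [le_principal_iff] at h𝒰
    have hex : ∀ t ∈ {t | Irate μ φ E W t ≤ c}, ∃ ν : Measure (ℝ × X), inTM ν ∧
        EntL ν (unif01.prod μ) (c + η) ∧ Tf φ E W ν = t := by
      intro t ht
      refine Irate_lt μ φ E W t _ (by positivity) (lt_of_le_of_lt ht ?_)
      rw [← ENNReal.ofReal_coe_nnreal]
      exact (ENNReal.ofReal_lt_ofReal_iff (by positivity)).2 (by linarith)
    obtain ⟨t0, ht0⟩ := 𝒰.nonempty_of_mem h𝒰
    obtain ⟨ν0, b1, b2, -⟩ := hex t0 ht0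
    have hex2 : ∀ t, ∃ ν : Measure (ℝ × X), inTM ν ∧
        EntL ν (unif01.prod μ) (c + η) ∧ (Irate μ φ E W t ≤ c → Tf φ E W ν = t) := by
      intro t
      by_cases ht : Irate μ φ E W t ≤ c
      · obtain ⟨ν, h1, h2, h3⟩ := hex t ht
        exact ⟨ν, h1, h2, fun _ => h3⟩
      · exact ⟨ν0, b1, b2, fun h => absurd h ht⟩
    choose ν h1 h2 h3 using hex2
    obtain ⟨ν', d1, d2, d3⟩ := lim_T μ φ E W s C hA 𝒰 ν h1 _ h2
    refine ⟨_, Irate_le μ φ E W _ ν' d1 d2, ?_⟩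
    have : Tendsto id (𝒰 : Filter ℝ) (nhds (Tf φ E W ν')) := by
      refine d3.congr' ?_
      filter_upwards [h𝒰] with t ht using h3 t ht
    exact this
  obtain ⟨a, -, ha⟩ := key 1 one_pos
  refine ⟨a, ?_, ha⟩
  refine ENNReal.le_of_forall_pos_le_add fun η hη _ => ?_
  obtain ⟨b, hb1, hb⟩ := key η (by exact_mod_cast hη)
  have : a = b := tendsto_nhds_unique (f := id) (l := (𝒰 : Filter ℝ)) ha hb
  rw [this]
  refine hb1.trans ?_
  rw [ENNReal.ofReal_add (by positivity) (by positivity)]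
  simp

end LDPaux

namespace LDPaux

theorem fiber_sum {Ω : Type*} [MeasurableSpace Ω] (ν : Measure Ω) [IsFiniteMeasure ν] {n : ℕ}
    (f : Ω → Fin n) (hf : Measurable f) (S : Set Ω) (hS : MeasurableSet S) :
    ν.real S = ∑ l, ν.real {z | z ∈ S ∧ f z = l} := by
  have h1 : S = ⋃ l ∈ (Finset.univ : Finset (Fin n)), {z | z ∈ S ∧ f z = l} := by
    ext z; simp
  conv_lhs => rw [h1]
  rw [measureReal_biUnion_finset]
  · intro a _ b _ hab
    refine Set.disjoint_left.2 fun z hz1 hz2 => hab ?_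
    exact hz1.2.symm.trans hz2.2
  · intro l _
    exact hS.inter (hf (measurableSet_singleton l))

theorem cell_meas {Ω A B : Type*} [MeasurableSpace Ω] [MeasurableSpace A] [MeasurableSpace B]
    [MeasurableSingletonClass A] [MeasurableSingletonClass B] {f : Ω → A} {g : Ω → B}
    (hf : Measurable f) (hg : Measurable g) (a : A) (b : B) :
    MeasurableSet {z | f z = a ∧ g z = b} :=
  (hf (measurableSet_singleton a)).inter (hg (measurableSet_singleton b))

theorem mX_eq {X : Type*} {k m n : ℕ} (c : ℝ → Fin k) (hc : Measurable c) (y : X → Fin m)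
    (ι : ℝ → Fin n) (hι : Measurable ι) (x : Fin n → X) (ij : Fin k × Fin m) :
    mX c y ι x ij = ∑ l, unif01.real {a | c a = ij.1 ∧ ι a = l} *
      (if y (x l) = ij.2 then 1 else 0) := by
  classical
  unfold mX
  have hyx : Measurable fun a => y (x (ι a)) := (measurable_of_countable fun l => y (x l)).comp hι
  rw [fiber_sum unif01 ι hι _ (cell_meas hc hyx ij.1 ij.2)]
  refine Finset.sum_congr rfl fun l _ => ?_
  split_ifs with h
  · rw [mul_one]
    congr 1
    ext a
    simp only [mem_ofPred_eq]
    constructor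
    · rintro ⟨⟨h1, h2⟩, h3⟩; exact ⟨h1, h3⟩
    · rintro ⟨h1, h3⟩; exact ⟨⟨h1, by rw [h3]; exact h⟩, h3⟩
  · rw [mul_zero]
    have : {z | z ∈ {a | c a = ij.1 ∧ y (x (ι a)) = ij.2} ∧ ι z = l} = ∅ := by
      ext a
      simp only [mem_ofPred_eq, mem_empty_iff_false, iff_false]
      rintro ⟨⟨h1, h2⟩, h3⟩
      rw [h3] at h2; exact h h2
    rw [this]; simp

theorem mX_lin {X : Type*} {k m n : ℕ} (c : ℝ → Fin k) (hc : Measurable c) (y : X → Fin m)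
    (ι : ℝ → Fin n) (hι : Measurable ι) (x : Fin n → X) (lam : Fin k × Fin m → ℝ) :
    ∑ ij, lam ij * mX c y ι x ij =
      ∑ l, ∑ i, unif01.real {a | c a = i ∧ ι a = l} * lam (i, y (x l)) := by
  classical
  simp only [mX_eq c hc y ι hι x, Finset.mul_sum]
  rw [Finset.sum_comm]
  refine Finset.sum_congr rfl fun l _ => ?_
  rw [Fintype.sum_prod_type]
  refine Finset.sum_congr rfl fun i _ => ?_
  rw [Finset.sum_eq_single (y (x l))]
  · simp; ring
  · intro j _ hj
    simp [Ne.symm hj]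
  · intro h; simp at h

theorem chernoff_cell {X : Type*} [MeasurableSpace X] (μ : Measure X) [IsProbabilityMeasure μ]
    {k m n : ℕ} (hn : n ≠ 0) (c : ℝ → Fin k) (hc : Measurable c) (y : X → Fin m) (hy : Measurable y)
    (ι : ℝ → Fin n) (hι : Measurable ι) (hιu : ∀ l, unif01 {a | ι a = l} = (n : ℝ≥0∞)⁻¹)
    (r : Fin k × Fin m → ℝ) (hr : ∀ ij, 0 < r ij)
    (hr1 : ∀ i, ∑ j, μ.real {x | y x = j} * r (i, j) = 1) (a : ℝ) :
    (Measure.pi fun _ : Fin n => μ) {x | a ≤ ∑ ij, Real.log (r ij) * mX c y ι x ij} ≤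
      ENNReal.ofReal (Real.exp (-(n * a))) := by
  have hn0 : (0:ℝ) < n := by positivity
  obtain ⟨w, hw⟩ : ∃ w : Fin n → Fin k → ℝ, w = fun l i => n * unif01.real {a | c a = i ∧ ι a = l} :=
    ⟨_, rfl⟩
  have hw0 : ∀ l i, 0 ≤ w l i := by intro l i; rw [hw]; positivity
  have hw1 : ∀ l, ∑ i, w l i = 1 := by
    intro l
    rw [hw, ← Finset.mul_sum]
    have := fiber_sum unif01 c hc {a | ι a = l} (hι (measurableSet_singleton l))
    have h2 : ∑ i, unif01.real {a | c a = i ∧ ι a = l} = (n:ℝ)⁻¹ := by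
      have h3 : unif01.real {a | ι a = l} = (n:ℝ)⁻¹ := by
        rw [Measure.real, hιu l]; simp
      rw [← h3, this]
      refine Finset.sum_congr rfl fun i _ => ?_
      congr 1
      ext a; simp [and_comm]
    rw [h2]; field_simp
  obtain ⟨h, hh⟩ : ∃ h : Fin n → X → ℝ, h = fun l x => ∑ i, w l i * Real.log (r (i, y x)) := ⟨_, rfl⟩
  have hhm : ∀ l, Measurable (h l) := by
    intro l
    rw [hh]
    exact (measurable_of_countable fun j => ∑ i, w l i * Real.log (r (i, j))).comp hy
  have hF : ∀ x : Fin n → X, n * ∑ ij, Real.log (r ij) * mX c y ι x ij = ∑ l, h l (x l) := by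
    intro x
    rw [mX_lin c hc y ι hι x, Finset.mul_sum, hh]
    refine Finset.sum_congr rfl fun l _ => ?_
    rw [Finset.mul_sum, hw]
    refine Finset.sum_congr rfl fun i _ => ?_
    ring
  have hset : {x : Fin n → X | a ≤ ∑ ij, Real.log (r ij) * mX c y ι x ij} =
      {x | n * a ≤ ∑ l, h l (x l)} := by
    ext x
    simp only [mem_ofPred_eq]
    rw [← hF x]
    exact (mul_le_mul_iff_right₀ hn0).symm
  rw [hset]
  have hmain : ∫⁻ x : Fin n → X, ENNReal.ofReal (Real.exp (∑ l, h l (x l)))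
      ∂(Measure.pi fun _ : Fin n => μ) ≤ ENNReal.ofReal (Real.exp 0) := by
    have e1 : ∀ x : Fin n → X, ENNReal.ofReal (Real.exp (∑ l, h l (x l))) =
        ∏ l, ENNReal.ofReal (Real.exp (h l (x l))) := by
      intro x
      rw [Real.exp_sum, ENNReal.ofReal_prod_of_nonneg fun _ _ => (Real.exp_pos _).le]
    simp only [e1]
    refine (prod_lint_le (fun _ : Fin n => μ) (fun l x => ENNReal.ofReal (Real.exp (h l x)))
      (fun l => ENNReal.measurable_ofReal.comp (Real.measurable_exp.comp (hhm l)))).trans ?_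
    rw [Real.exp_zero, ENNReal.ofReal_one]
    refine Finset.prod_le_one' fun l _ => ?_
    have hb : ∀ x, Real.exp (h l x) ≤ ∑ i, w l i * r (i, y x) := by
      intro x
      have := convexOn_exp.map_sum_le (t := Finset.univ) (w := w l)
        (p := fun i => Real.log (r (i, y x))) (fun i _ => hw0 l i) (hw1 l) (fun _ _ => mem_univ _)
      simp only [smul_eq_mul] at this
      rw [hh]
      refine this.trans (le_of_eq ?_)
      refine Finset.sum_congr rfl fun i _ => ?_
      rw [Real.exp_log (hr _)]
    have hsm : Measurable fun x => ∑ i, w l i * r (i, y x) :=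
      (measurable_of_countable fun j => ∑ i, w l i * r (i, j)).comp hy
    calc ∫⁻ x, ENNReal.ofReal (Real.exp (h l x)) ∂μ
        ≤ ∫⁻ x, ENNReal.ofReal (∑ i, w l i * r (i, y x)) ∂μ :=
          lintegral_mono fun x => ENNReal.ofReal_le_ofReal (hb x)
      _ = ENNReal.ofReal (∫ x, ∑ i, w l i * r (i, y x) ∂μ) := by
          rw [ofReal_integral_eq_lintegral_ofReal]
          · refine bint μ hsm ⟨∑ j, |∑ i, w l i * r (i, j)|, fun x => ?_⟩
            exact Finset.single_le_sum (f := fun j => |∑ i, w l i * r (i, j)|)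
              (fun _ _ => abs_nonneg _) (Finset.mem_univ (y x))
          · exact ae_of_all _ fun x => Finset.sum_nonneg fun i _ => mul_nonneg (hw0 l i) (hr _).le
      _ ≤ 1 := by
          have hpush : ∫ x, ∑ i, w l i * r (i, y x) ∂μ =
              ∑ j, μ.real {x | y x = j} * ∑ i, w l i * r (i, j) := by
            have h1 := integral_map (μ := μ) hy.aemeasurable
              (f := fun j => ∑ i, w l i * r (i, j)) (measurable_of_countable _).aestronglyMeasurable
            rw [← h1]
            haveI := Measure.isProbabilityMeasure_map (μ := μ) hy.aemeasurable
            rw [integral_fintype Integrable.of_finite]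
            refine Finset.sum_congr rfl fun j _ => ?_
            rw [smul_eq_mul, Measure.real, Measure.map_apply hy (measurableSet_singleton j)]
            rfl
          rw [hpush]
          have : ∑ j, μ.real {x | y x = j} * ∑ i, w l i * r (i, j) = 1 := by
            simp only [Finset.mul_sum]
            rw [Finset.sum_comm]
            rw [← hw1 l]
            refine Finset.sum_congr rfl fun i _ => ?_
            have := hr1 i
            calc _ = w l i * ∑ j, μ.real {x | y x = j} * r (i, j) := by
                  rw [Finset.mul_sum]
                  exact Finset.sum_congr rfl fun j _ => by ring
              _ = _ := by rw [this, mul_one]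
          rw [this]; simp
  have hFm : Measurable fun x : Fin n → X => ∑ l, h l (x l) :=
    Finset.measurable_sum _ fun l _ => (hhm l).comp (measurable_pi_apply l)
  have := exp_markov (Measure.pi fun _ : Fin n => μ) (fun x => ∑ l, h l (x l)) hFm (n * a) 0 hmain
  simpa using this

end LDPaux

namespace LDPaux

theorem int_fin {Ω : Type*} [MeasurableSpace Ω] (μ : Measure Ω) [IsProbabilityMeasure μ]
    {J : Type*} [Fintype J] [MeasurableSpace J] [MeasurableSingletonClass J]
    (y : Ω → J) (hy : Measurable y) (f : J → ℝ) :
    Integrable (fun x => f (y x)) μ ∧ ∫ x, f (y x) ∂μ = ∑ j, μ.real {x | y x = j} * f j := by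
  have hfm : Measurable f := measurable_of_countable f
  constructor
  · refine bint μ (hfm.comp hy) ⟨∑ j, |f j|, fun x => ?_⟩
    exact Finset.single_le_sum (f := fun j => |f j|)
      (fun _ _ => abs_nonneg _) (Finset.mem_univ (y x))
  · have h1 := integral_map (μ := μ) hy.aemeasurable (f := f) hfm.aestronglyMeasurable
    rw [← h1]
    haveI := Measure.isProbabilityMeasure_map (μ := μ) hy.aemeasurable
    rw [integral_fintype Integrable.of_finite]
    refine Finset.sum_congr rfl fun j _ => ?_
    rw [smul_eq_mul, Measure.real, Measure.map_apply hy (measurableSet_singleton j)]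
    rfl

theorem cell_density {X : Type*} [MeasurableSpace X] (μ : Measure X) [IsProbabilityMeasure μ]
    {k m : ℕ} (c : ℝ → Fin k) (hc : Measurable c) (y : X → Fin m) (hy : Measurable y)
    (r : Fin k × Fin m → ℝ) (hr : ∀ ij, 0 ≤ r ij)
    (hr1 : ∀ i, ∑ j, μ.real {x | y x = j} * r (i, j) = 1) :
    ∃ ν : Measure (ℝ × X), inTM ν ∧
      (∀ ij, mNu c y ν ij = unif01.real {a | c a = ij.1} * μ.real {x | y x = ij.2} * r ij) ∧
      KLdiv ν (unif01.prod μ) ≤ ENNReal.ofReal (∑ ij, mNu c y ν ij * Real.log (r ij)) := by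
  have hcy : Measurable fun z : ℝ × X => (c z.1, y z.2) :=
    (hc.comp measurable_fst).prodMk (hy.comp measurable_snd)
  have hrm : Measurable r := measurable_of_countable r
  obtain ⟨f, hf⟩ : ∃ f : ℝ × X → ℝ≥0∞, f = fun z => ENNReal.ofReal (r (c z.1, y z.2)) := ⟨_, rfl⟩
  have hfm : Measurable f := by rw [hf]; exact ENNReal.measurable_ofReal.comp (hrm.comp hcy)
  have hin : ∀ a, ∫⁻ x, f (a, x) ∂μ = 1 := by
    intro a
    rw [hf]
    have h1 := int_fin μ y hy (fun j => r (c a, j))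
    rw [← ofReal_integral_eq_lintegral_ofReal h1.1 (ae_of_all _ fun _ => hr _), h1.2, hr1]
    simp
  obtain ⟨ν, hν⟩ : ∃ ν, ν = (unif01.prod μ).withDensity f := ⟨_, rfl⟩
  have hfst : ∀ A : Set ℝ, MeasurableSet A → ν (Prod.fst ⁻¹' A) = unif01 A := by
    intro A hA
    rw [hν, withDensity_apply _ (measurable_fst hA)]
    have : (Prod.fst ⁻¹' A : Set (ℝ × X)) = A ×ˢ Set.univ := by ext; simp
    rw [this, ← Measure.prod_restrict, lintegral_prod _ hfm.aemeasurable]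
    simp only [Measure.restrict_univ, hin]
    simp
  have hprob : IsProbabilityMeasure ν := by
    refine ⟨?_⟩
    have := hfst Set.univ MeasurableSet.univ
    simpa using this
  have hTM : inTM ν := by
    refine ⟨hprob, ?_⟩
    ext A hA
    rw [Measure.map_apply measurable_fst hA, hfst A hA]
  have hmNu : ∀ ij, mNu c y ν ij = unif01.real {a | c a = ij.1} * μ.real {x | y x = ij.2} * r ij := by
    intro ij
    unfold mNu
    have hcm : MeasurableSet {z : ℝ × X | c z.1 = ij.1 ∧ y z.2 = ij.2} := cell_meas (hc.comp (measurable_fst (α := ℝ) (β := X)))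
      (hy.comp measurable_snd) ij.1 ij.2
    have hcell : {z : ℝ × X | c z.1 = ij.1 ∧ y z.2 = ij.2} = {a | c a = ij.1} ×ˢ {x | y x = ij.2} := by
      ext z; simp
    rw [Measure.real, hν, withDensity_apply _ hcm]
    have : ∫⁻ z in {z : ℝ × X | c z.1 = ij.1 ∧ y z.2 = ij.2}, f z ∂(unif01.prod μ) =
        ∫⁻ z in {z : ℝ × X | c z.1 = ij.1 ∧ y z.2 = ij.2}, ENNReal.ofReal (r ij) ∂(unif01.prod μ) := by
      refine setLIntegral_congr_fun hcm fun z hz => ?_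
      have hz' : c z.1 = ij.1 ∧ y z.2 = ij.2 := hz
      rw [hf]
      simp only [hz'.1, hz'.2]
    rw [this, setLIntegral_const, hcell, Measure.prod_prod, ENNReal.toReal_mul, ENNReal.toReal_mul,
      ENNReal.toReal_ofReal (hr _)]
    simp only [Measure.real]
    ring
  refine ⟨ν, hTM, hmNu, ?_⟩
  have hac : ν ≪ unif01.prod μ := by rw [hν]; exact withDensity_absolutelyContinuous _ _
  have hllr : llr ν (unif01.prod μ) =ᵐ[ν] fun z => Real.log (r (c z.1, y z.2)) := by
    have h1 : ν.rnDeriv (unif01.prod μ) =ᵐ[unif01.prod μ] f := by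
      rw [hν]; exact Measure.rnDeriv_withDensity _ hfm
    filter_upwards [hac.ae_le h1] with z hz
    rw [llr, hz, hf]
    simp only
    rw [ENNReal.toReal_ofReal (hr _)]
  have h2 := int_fin ν (fun z : ℝ × X => (c z.1, y z.2)) hcy (fun ij => Real.log (r ij))
  unfold KLdiv
  rw [if_pos ⟨hac, h2.1.congr hllr.symm⟩, integral_congr_ae hllr, h2.2]
  refine ENNReal.ofReal_le_ofReal (le_of_eq ?_)
  refine Finset.sum_congr rfl fun ij _ => ?_
  unfold mNu
  congr 2
  ext z
  simp [Prod.ext_iff]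

/-- Local Chernoff bound around a point of the simplex. -/
theorem local_chernoff {X : Type*} [MeasurableSpace X] (μ : Measure X) [IsProbabilityMeasure μ]
    {k m : ℕ} (c : ℝ → Fin k) (hc : Measurable c) (y : X → Fin m) (hy : Measurable y)
    (m0 : Fin k × Fin m → ℝ) (hm0 : ∀ ij, 0 ≤ m0 ij)
    (hm1 : ∀ i, ∑ j, m0 (i, j) = unif01.real {a | c a = i}) (b : ℝ) (hb : 0 ≤ b)
    (hH : ∀ ν : Measure (ℝ × X), inTM ν → mNu c y ν = m0 →
      ¬ KLdiv ν (unif01.prod μ) ≤ ENNReal.ofReal b) (b' : ℝ) (hb' : b' < b) :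
    ∃ O : Set (Fin k × Fin m → ℝ), IsOpen O ∧ m0 ∈ O ∧ ∀ n : ℕ, n ≠ 0 → ∀ ι : ℝ → Fin n,
      Measurable ι → (∀ l, unif01 {a | ι a = l} = (n : ℝ≥0∞)⁻¹) →
      (Measure.pi fun _ : Fin n => μ) {x | mX c y ι x ∈ O} ≤
        ENNReal.ofReal (Real.exp (-(n * b'))) := by
  by_cases hnull : ∃ ij, 0 < m0 ij ∧ μ {x | y x = ij.2} = 0
  · obtain ⟨ij, h1, h2⟩ := hnull
    refine ⟨{w | 0 < w ij}, isOpen_lt continuous_const (continuous_apply ij), h1, ?_⟩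
    intro n hn ι hι hιu
    have hz : (Measure.pi fun _ : Fin n => μ) (⋃ l, {x : Fin n → X | y (x l) = ij.2}) = 0 := by
      refine measure_iUnion_null fun l => ?_
      have := (measurePreserving_eval (fun _ : Fin n => μ) l).measure_preimage
        (s := {x | y x = ij.2}) (hy (measurableSet_singleton _)).nullMeasurableSet
      rw [h2] at this
      exact this
    refine (measure_mono_null ?_ hz).le.trans zero_le
    intro x hx
    by_contra hcon
    simp only [mem_iUnion, mem_ofPred_eq, not_exists] at hcon
    have hx' : 0 < mX c y ι x ij := hx
    rw [mX_eq c hc y ι hι] at hx'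
    rw [Finset.sum_eq_zero] at hx'
    · exact lt_irrefl _ hx'
    · intro l _
      rw [if_neg (hcon l), mul_zero]
  · push Not at hnull
    obtain ⟨pp, hpp⟩ : ∃ pp : Fin k → ℝ, pp = fun i => unif01.real {a | c a = i} := ⟨_, rfl⟩
    obtain ⟨mu, hmu⟩ : ∃ mu : Fin m → ℝ, mu = fun j => μ.real {x | y x = j} := ⟨_, rfl⟩
    have hpp0 : ∀ i, 0 ≤ pp i := fun i => by rw [hpp]; exact measureReal_nonneg
    have hmu0 : ∀ i, 0 ≤ mu i := fun i => by rw [hmu]; exact measureReal_nonneg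
    have hmu1 : ∑ j, mu j = 1 := by
      have := fiber_sum μ y hy Set.univ MeasurableSet.univ
      simp only [mem_univ, true_and] at this
      rw [hmu, ← this]; simp
    have hz1 : ∀ i j, pp i = 0 → m0 (i, j) = 0 := by
      intro i j hi
      have h1 := hm1 i
      rw [hpp] at hi
      simp only at hi
      rw [hi] at h1
      exact (Finset.sum_eq_zero_iff_of_nonneg (fun j _ => hm0 (i, j))).1 h1 j (Finset.mem_univ j)
    have hz2 : ∀ i j, mu j = 0 → m0 (i, j) = 0 := by
      intro i j hj
      by_contra hcon
      have h1 : 0 < m0 (i, j) := lt_of_le_of_ne (hm0 _) (Ne.symm hcon)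
      refine hnull (i, j) h1 ?_
      rw [hmu] at hj
      exact (measureReal_eq_zero_iff).1 hj
    classical
    obtain ⟨r, hrd⟩ : ∃ r : Fin k × Fin m → ℝ, r = fun ij =>
      if pp ij.1 = 0 then 1 else m0 ij / (pp ij.1 * mu ij.2) := ⟨_, rfl⟩
    have hr0 : ∀ ij, 0 ≤ r ij := by
      intro ij
      rw [hrd]
      simp only
      split_ifs
      · norm_num
      · exact div_nonneg (hm0 _) (mul_nonneg (hpp0 _) (hmu0 _))
    have hr1 : ∀ i, ∑ j, mu j * r (i, j) = 1 := by
      intro i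
      by_cases hi : pp i = 0
      · have : ∀ j, mu j * r (i, j) = mu j := by
          intro j; rw [hrd]; simp only; rw [if_pos hi, mul_one]
        simp only [this, hmu1]
      · have : ∀ j, mu j * r (i, j) = m0 (i, j) / pp i := by
          intro j; rw [hrd]; simp only; rw [if_neg hi]
          by_cases hj : mu j = 0
          · rw [hz2 i j hj]; simp
          · field_simp
        simp only [this, ← Finset.sum_div, hm1 i]
        rw [hpp] at hi ⊢
        exact div_self hi
    have hrm : ∀ ij : Fin k × Fin m, pp ij.1 * mu ij.2 * r ij = m0 ij := by
      rintro ⟨i, j⟩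
      by_cases hi : pp i = 0
      · rw [hz1 i j hi]; simp [hi]
      · by_cases hj : mu j = 0
        · rw [hz2 i j hj]; simp [hj]
        · rw [hrd]; simp only; rw [if_neg hi]; field_simp
    obtain ⟨ν, hν1, hν2, hν3⟩ := cell_density μ c hc y hy r hr0 (by
      intro i; have := hr1 i; rw [hmu] at this; exact this)
    have hνm : mNu c y ν = m0 := by
      funext ij
      rw [hν2 ij, ← hrm ij, hpp, hmu]
    have hHb : b ≤ ∑ ij, m0 ij * Real.log (r ij) := by
      by_contra hcon
      push Not at hcon
      rw [hνm] at hν3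
      exact hH ν hν1 hνm (hν3.trans (ENNReal.ofReal_le_ofReal hcon.le))
    obtain ⟨θ, hθ0, hθ1, hθ⟩ : ∃ θ : ℝ, 0 < θ ∧ θ < 1 ∧ b' < (1 - θ) * b := by
      have h1 : Tendsto (fun θ : ℝ => (1 - θ) * b) (nhdsWithin 0 (Set.Ioi 0)) (nhds ((1 - 0) * b)) := by
        apply Tendsto.mono_left _ nhdsWithin_le_nhds
        exact (Continuous.tendsto (by fun_prop) 0)
      have h2 := h1.eventually (lt_mem_nhds (show b' < (1 - 0) * b by linarith))
      have h3 : ∀ᶠ θ : ℝ in nhdsWithin 0 (Set.Ioi 0), 0 < θ := eventually_mem_nhdsWithin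
      have h4 : ∀ᶠ θ : ℝ in nhdsWithin 0 (Set.Ioi 0), θ < 1 :=
        nhdsWithin_le_nhds (gt_mem_nhds one_pos)
      obtain ⟨θ, a1, a2, a3⟩ := (h2.and (h3.and h4)).exists
      exact ⟨θ, a2, a3, a1⟩
    obtain ⟨s, hs⟩ : ∃ s : Fin k × Fin m → ℝ, s = fun ij => (1 - θ) * r ij + θ := ⟨_, rfl⟩
    have hs0 : ∀ ij, 0 < s ij := by
      intro ij; rw [hs]
      have := mul_nonneg (by linarith : 0 ≤ 1 - θ) (hr0 ij)
      simp only; linarith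
    have hs1 : ∀ i, ∑ j, mu j * s (i, j) = 1 := by
      intro i
      have : ∀ j, mu j * s (i, j) = (1 - θ) * (mu j * r (i, j)) + θ * mu j := by
        intro j; rw [hs]; ring
      simp only [this]
      rw [Finset.sum_add_distrib, ← Finset.mul_sum, ← Finset.mul_sum, hr1, hmu1]
      ring
    have hconc : (1 - θ) * b ≤ ∑ ij, Real.log (s ij) * m0 ij := by
      calc (1 - θ) * b ≤ (1 - θ) * ∑ ij, m0 ij * Real.log (r ij) :=
            mul_le_mul_of_nonneg_left hHb (by linarith)
        _ = ∑ ij, (1 - θ) * (m0 ij * Real.log (r ij)) := by rw [Finset.mul_sum]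
        _ ≤ _ := by
          refine Finset.sum_le_sum fun ij _ => ?_
          rcases eq_or_lt_of_le (hm0 ij) with h | h
          · rw [← h]; simp
          · have hrpos : 0 < r ij := by
              rcases eq_or_lt_of_le (hr0 ij) with h' | h'
              · have := hrm ij
                rw [← h', mul_zero] at this
                linarith
              · exact h'
            have h1 := strictConcaveOn_log_Ioi.concaveOn.2 (Set.mem_Ioi.2 hrpos)
              (Set.mem_Ioi.2 one_pos) (by linarith : 0 ≤ 1 - θ) hθ0.le (by ring)
            simp only [smul_eq_mul, Real.log_one, mul_zero, add_zero, mul_one] at h1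
            rw [hs]
            nlinarith [mul_le_mul_of_nonneg_right h1 h.le]
    refine ⟨{w | b' < ∑ ij, Real.log (s ij) * w ij}, isOpen_lt continuous_const ?_, ?_, ?_⟩
    · exact continuous_finsetSum _ fun ij _ => continuous_const.mul (continuous_apply ij)
    · exact hθ.trans_le hconc
    · intro n hn ι hι hιu
      refine le_trans (measure_mono ?_) (chernoff_cell μ hn c hc y hy ι hι hιu s hs0 (by
        intro i; have := hs1 i; rw [hmu] at this; exact this) b')
      intro x hx
      have hx' : b' < ∑ ij, Real.log (s ij) * mX c y ι x ij := hx
      exact hx'.le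

end LDPaux

namespace LDPaux

/-- The statistic with index set `J`. -/
noncomputable def Tn {X : Type*} {v n : ℕ} (φ : (Fin v → X) → ℝ) (E : Finset (Fin v × Fin v))
    (Q : Fin n → Fin n → ℝ) (J : Finset (Fin v → Fin n)) (x : Fin n → X) : ℝ :=
  (∑ i ∈ J, φ (x ∘ i) * ∏ e ∈ E, Q (i e.1) (i e.2)) / (n:ℝ) ^ v

/-- Convergence of the weights. -/
def SeqOK (Q : ∀ n : ℕ, Fin n → Fin n → ℝ) (W : ℝ → ℝ → ℝ) (s : ℝ≥0∞) (C : ℝ≥0) : Prop :=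
  ∀ δ > 0, ∀ᶠ n : ℕ in atTop, ∃ ι : ℝ → Fin n, Measurable ι ∧
      (∀ l, unif01 {a | ι a = l} = (n : ℝ≥0∞)⁻¹) ∧
      kerNorm (fun x y => Q n (ι x) (ι y)) s ≤ C ∧
      CutB (fun x y => Q n (ι x) (ι y) - W x y) δ

theorem mX_row {X : Type*} {k m n : ℕ} (c : ℝ → Fin k) (hc : Measurable c) (y : X → Fin m)
    (ι : ℝ → Fin n) (hι : Measurable ι) (x : Fin n → X) (i : Fin k) :
    ∑ j, mX c y ι x (i, j) = unif01.real {a | c a = i} := by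
  have hyx : Measurable fun a => y (x (ι a)) := (measurable_of_countable fun l => y (x l)).comp hι
  rw [fiber_sum unif01 (fun a => y (x (ι a))) hyx {a | c a = i} (hc (measurableSet_singleton i))]
  rfl

theorem upper {X : Type*} [MeasurableSpace X] (μ : Measure X) [IsProbabilityMeasure μ]
    {v : ℕ} (φ : (Fin v → X) → ℝ) (E : Finset (Fin v × Fin v)) (W : ℝ → ℝ → ℝ) (s : ℝ≥0∞) (C : ℝ≥0)
    (hA : Assembled μ φ E W s C) (Q : ∀ n : ℕ, Fin n → Fin n → ℝ) (hQ : SeqOK Q W s C)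
    (J : ∀ n : ℕ, Finset (Fin v → Fin n)) (hJ : ∀ n i, Function.Injective i → i ∈ J n)
    (F : Set ℝ) (hF : IsClosed F) (b : ℝ) (hb : 0 ≤ b)
    (hFb : ∀ t ∈ F, ¬ Irate μ φ E W t ≤ ENNReal.ofReal b) (b' : ℝ) (hb' : b' < b) :
    ∀ᶠ n : ℕ in atTop, (Measure.pi fun _ : Fin n => μ) {x | Tn φ E (Q n) (J n) x ∈ F} ≤
      ENNReal.ofReal (Real.exp (-(n * b'))) := by
  have hK := good μ φ E W s C hA (ENNReal.ofReal b) ENNReal.ofReal_ne_top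
  obtain ⟨d, hd, hdisj⟩ := Disjoint.exists_thickenings (s := {t | Irate μ φ E W t ≤ ENNReal.ofReal b})
    (t := F) (Set.disjoint_left.2 fun t h1 h2 => hFb t h2 h1) hK hF
  have hsep : ∀ t f, Irate μ φ E W t ≤ ENNReal.ofReal b → f ∈ F → d ≤ |t - f| := by
    intro t f ht hf
    by_contra hcon
    push Not at hcon
    have q1 : f ∈ Metric.thickening d {t | Irate μ φ E W t ≤ ENNReal.ofReal b} := by
      rw [Metric.mem_thickening_iff]
      exact ⟨t, ht, by rw [dist_comm]; exact hcon⟩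
    exact Set.disjoint_left.1 hdisj q1 (Metric.self_subset_thickening hd F hf)
  obtain ⟨k, m, c, y, R, hc, hy, hR, h1, δ, hδ, hev⟩ := hA (d / 4) (by positivity) b hb
  obtain ⟨b2, hb2, hb2'⟩ := exists_between hb'
  obtain ⟨K, hKd⟩ : ∃ K : Set (Fin k × Fin m → ℝ), K = {w | (∀ ij, 0 ≤ w ij ∧ w ij ≤ 1) ∧
    (∀ i, ∑ j, w (i, j) = unif01.real {a | c a = i}) ∧ R w ∈ Metric.cthickening (d / 4) F} := ⟨_, rfl⟩
  have hKc : IsCompact K := by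
    refine (isCompact_univ_pi (s := fun _ : Fin k × Fin m => Set.Icc (0:ℝ) 1)
      (fun _ => isCompact_Icc)).of_isClosed_subset ?_ ?_
    · rw [hKd]
      have e1 : IsClosed {w : Fin k × Fin m → ℝ | ∀ ij, 0 ≤ w ij ∧ w ij ≤ 1} := by
        simp only [setOf_forall]
        exact isClosed_iInter fun ij => (isClosed_le continuous_const (continuous_apply ij)).inter
          (isClosed_le (continuous_apply ij) continuous_const)
      have e2 : IsClosed {w : Fin k × Fin m → ℝ | ∀ i, ∑ j, w (i, j) = unif01.real {a | c a = i}} := by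
        simp only [setOf_forall]
        exact isClosed_iInter fun i => isClosed_eq
          (continuous_finsetSum _ fun j _ => continuous_apply (i, j)) continuous_const
      exact e1.inter (e2.inter (Metric.isClosed_cthickening.preimage hR))
    · rw [hKd]
      intro w hw
      exact Set.mem_univ_pi.2 fun ij => hw.1 ij
  have hloc : ∀ w ∈ K, ∃ O : Set (Fin k × Fin m → ℝ), IsOpen O ∧ w ∈ O ∧ ∀ n : ℕ, n ≠ 0 →
      ∀ ι : ℝ → Fin n, Measurable ι → (∀ l, unif01 {a | ι a = l} = (n : ℝ≥0∞)⁻¹) →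
      (Measure.pi fun _ : Fin n => μ) {x | mX c y ι x ∈ O} ≤
        ENNReal.ofReal (Real.exp (-(n * b2))) := by
    intro w hw
    rw [hKd] at hw
    refine local_chernoff μ c hc y hy w (fun ij => (hw.1 ij).1) hw.2.1 b hb ?_ b2 hb2'
    intro ν hν hνw hcon
    haveI := hν.1
    have hent := EntL_of_KL ν (unif01.prod μ) b hb hcon
    have a1 := h1 ν hν hent
    have a2 := Irate_le μ φ E W b ν hν hent
    rw [hνw] at a1
    have a3 : ∃ f ∈ F, |R w - f| < d / 2 := by
      have := Metric.cthickening_subset_thickening' (δ₁ := d / 4) (δ₂ := d / 2)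
        (by positivity) (by linarith) F hw.2.2
      rw [Metric.mem_thickening_iff] at this
      obtain ⟨f, hf, hdist⟩ := this
      exact ⟨f, hf, by rwa [Real.dist_eq] at hdist⟩
    obtain ⟨f, hf, hRf⟩ := a3
    have a4 := hsep _ f a2 hf
    have a5 : |Tf φ E W ν - f| ≤ |Tf φ E W ν - R w| + |R w - f| := abs_sub_le _ _ _
    have a6 : |Tf φ E W ν - R w| ≤ d / 4 := a1
    linarith
  choose! O hO1 hO2 hO3 using hloc
  obtain ⟨t, htK, htcov⟩ := hKc.elim_nhds_subcover O (fun w hw => (hO1 w hw).mem_nhds (hO2 w hw))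
  have hlarge : ∀ᶠ n : ℕ in atTop, ((t.card : ℝ) + 1) * Real.exp (-(n * b2)) ≤ Real.exp (-(n * b')) := by
    have g1 : Tendsto (fun n : ℕ => Real.exp ((n:ℝ) * (b2 - b'))) atTop atTop :=
      Real.tendsto_exp_atTop.comp (tendsto_natCast_atTop_atTop.atTop_mul_const (by linarith))
    filter_upwards [g1.eventually_ge_atTop ((t.card : ℝ) + 1)] with n hn
    have : Real.exp (-(n * b')) = Real.exp ((n:ℝ) * (b2 - b')) * Real.exp (-(n * b2)) := by
      rw [← Real.exp_add]; congr 1; ring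
    rw [this]
    exact mul_le_mul_of_nonneg_right hn (Real.exp_pos _).le
  filter_upwards [hev, hQ δ hδ, hlarge, eventually_ne_atTop 0] with n hn1 ⟨ι, i1, i2, i3, i4⟩ hn2 hn0
  have hbad := (hn1 ι (Q n) i1 i2 i3 i4).1 (J n) (hJ n)
  have hincl : {x | Tn φ E (Q n) (J n) x ∈ F} ⊆
      {x | d / 4 < |Tn φ E (Q n) (J n) x - R (mX c y ι x)|} ∪ ⋃ w ∈ t, {x | mX c y ι x ∈ O w} := by
    intro x hx
    by_cases hx1 : d / 4 < |Tn φ E (Q n) (J n) x - R (mX c y ι x)|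
    · exact Or.inl hx1
    · right
      push Not at hx1
      have hxK : mX c y ι x ∈ K := by
        rw [hKd]
        refine ⟨fun ij => ⟨measureReal_nonneg, measureReal_le_one⟩, fun i => mX_row c hc y ι i1 x i, ?_⟩
        refine Metric.mem_cthickening_of_dist_le _ (Tn φ E (Q n) (J n) x) _ _ hx ?_
        rw [dist_comm]; exact hx1
      have := htcov hxK
      simp only [mem_iUnion] at this ⊢
      obtain ⟨w, hw, hxw⟩ := this
      exact ⟨w, hw, hxw⟩
  refine (measure_mono hincl).trans ((measure_union_le _ _).trans ?_)
  have hsum : (Measure.pi fun _ : Fin n => μ) (⋃ w ∈ t, {x | mX c y ι x ∈ O w}) ≤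
      t.card * ENNReal.ofReal (Real.exp (-(n * b2))) := by
    refine (measure_biUnion_finset_le t _).trans ?_
    refine (Finset.sum_le_sum fun w hw => hO3 w (htK w hw) n hn0 ι i1 i2).trans ?_
    simp
  have hbad2 : (Measure.pi fun _ : Fin n => μ) {x | d / 4 < |Tn φ E (Q n) (J n) x - R (mX c y ι x)|} ≤
      ENNReal.ofReal (Real.exp (-(n * b2))) := by
    refine hbad.trans (ENNReal.ofReal_le_ofReal (Real.exp_le_exp.2 ?_))
    have : (n:ℝ) * b2 ≤ n * b := mul_le_mul_of_nonneg_left hb2'.le (by positivity)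
    linarith
  refine (add_le_add hbad2 hsum).trans ?_
  refine le_trans (le_of_eq ?_) (ENNReal.ofReal_le_ofReal hn2)
  rw [ENNReal.ofReal_mul (by positivity), ENNReal.ofReal_add (by positivity) (by norm_num),
    ENNReal.ofReal_natCast, ENNReal.ofReal_one]
  ring

end LDPaux

namespace LDPaux

theorem cheb {X : Type*} [MeasurableSpace X] {n : ℕ} (hn : n ≠ 0) (lam : Fin n → Measure X)
    (hlam : ∀ l, IsProbabilityMeasure (lam l)) (h : Fin n → X → ℝ) (hm : ∀ l, Measurable (h l))
    (h01 : ∀ l x, 0 ≤ h l x ∧ h l x ≤ (n:ℝ)⁻¹) (η : ℝ) (hη : 0 < η) :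
    (Measure.pi lam) {x | η ≤ |∑ l, h l (x l) - ∫ x, ∑ l, h l (x l) ∂(Measure.pi lam)|} ≤
      ENNReal.ofReal ((n:ℝ)⁻¹ / η ^ 2) := by
  have hn0 : (0:ℝ) < n := by positivity
  have hmem : ∀ l, MemLp (fun x : Fin n → X => h l (x l)) 2 (Measure.pi lam) := by
    intro l
    refine MemLp.of_bound ((hm l).comp (measurable_pi_apply l)).aestronglyMeasurable (n:ℝ)⁻¹
      (ae_of_all _ fun x => ?_)
    rw [Real.norm_eq_abs, abs_of_nonneg (h01 l _).1]
    exact (h01 l _).2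
  have hsum : MemLp (∑ l, fun x : Fin n → X => h l (x l)) 2 (Measure.pi lam) :=
    memLp_finsetSum' _ fun l _ => hmem l
  have hind := ProbabilityTheory.iIndepFun_pi (μ := lam) (X := h) fun l => (hm l).aemeasurable
  have hvar := ProbabilityTheory.IndepFun.variance_sum (μ := Measure.pi lam) (s := Finset.univ)
    (X := fun l (x : Fin n → X) => h l (x l)) (fun l _ => hmem l)
    (fun i _ j _ hij => hind.indepFun hij)
  have hle : ProbabilityTheory.variance (∑ l, fun x : Fin n → X => h l (x l)) (Measure.pi lam) ≤ (n:ℝ)⁻¹ := by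
    rw [hvar]
    have : ∀ l : Fin n, ProbabilityTheory.variance (fun x : Fin n → X => h l (x l)) (Measure.pi lam) ≤
        (n:ℝ)⁻¹ * (n:ℝ)⁻¹ := by
      intro l
      have := ProbabilityTheory.variance_le_sq_of_bounded (μ := Measure.pi lam)
        (X := fun x : Fin n → X => h l (x l)) (a := 0) (b := (n:ℝ)⁻¹)
        (ae_of_all _ fun x => h01 l _) ((hm l).comp (measurable_pi_apply l)).aemeasurable
      refine this.trans ?_
      have h0 : 0 < (n:ℝ)⁻¹ := by positivity
      nlinarith
    refine (Finset.sum_le_sum fun l _ => this l).trans ?_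
    simp only [Finset.sum_const, Finset.card_univ, Fintype.card_fin, nsmul_eq_mul]
    exact le_of_eq (by field_simp)
  have hc := ProbabilityTheory.meas_ge_le_variance_div_sq hsum hη
  refine le_trans (le_of_eq ?_) (hc.trans (ENNReal.ofReal_le_ofReal (by gcongr)))
  congr 1
  ext x
  simp only [Finset.sum_apply, mem_ofPred_eq]

theorem mBar_eq {X : Type*} [MeasurableSpace X] {k m n : ℕ} (c : ℝ → Fin k) (hc : Measurable c)
    (y : X → Fin m) (hy : Measurable y) (ι : ℝ → Fin n) (hι : Measurable ι)
    (P : Measure (Fin n → X)) [IsProbabilityMeasure P] (ij : Fin k × Fin m) :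
    mBar c y ι P ij = ∫ x, mX c y ι x ij ∂P := by
  unfold mBar mX
  have hS : MeasurableSet {z : ℝ × (Fin n → X) | c z.1 = ij.1 ∧ y (z.2 (ι z.1)) = ij.2} :=
    cell_meas (hc.comp measurable_fst) (hy.comp (eval_meas ι hι)) ij.1 ij.2
  simp only [Measure.real]
  rw [integral_toReal]
  · rw [Measure.prod_apply_symm hS]
    rfl
  · exact (measurable_measure_prodMk_right hS).aemeasurable
  · exact ae_of_all _ fun x => measure_lt_top _ _

theorem mX_cheb {X : Type*} [MeasurableSpace X] {k m n : ℕ} (hn : n ≠ 0) (c : ℝ → Fin k)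
    (hc : Measurable c)
    (y : X → Fin m) (hy : Measurable y) (ι : ℝ → Fin n) (hι : Measurable ι)
    (hιu : ∀ l, unif01 {a | ι a = l} = (n : ℝ≥0∞)⁻¹)
    (lam : Fin n → Measure X) (hlam : ∀ l, IsProbabilityMeasure (lam l)) (ij : Fin k × Fin m)
    (η : ℝ) (hη : 0 < η) :
    (Measure.pi lam) {x | η ≤ |mX c y ι x ij - mBar c y ι (Measure.pi lam) ij|} ≤
      ENNReal.ofReal ((n:ℝ)⁻¹ / η ^ 2) := by
  classical
  rw [mBar_eq c hc y hy ι hι]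
  simp only [mX_eq c hc y ι hι]
  refine cheb hn lam hlam (fun l x => unif01.real {a | c a = ij.1 ∧ ι a = l} *
      (if y x = ij.2 then 1 else 0)) ?_ ?_ η hη
  · intro l
    exact (measurable_of_countable fun j : Fin m => unif01.real {a | c a = ij.1 ∧ ι a = l} *
      (if j = ij.2 then (1:ℝ) else 0)).comp hy
  · intro l x
    have h1 : unif01.real {a | c a = ij.1 ∧ ι a = l} ≤ (n:ℝ)⁻¹ := by
      have h3 : unif01.real {a | ι a = l} = (n:ℝ)⁻¹ := by
        rw [Measure.real, hιu l]; simp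
      rw [← h3]
      exact measureReal_mono (fun a ha => ha.2)
    have h0 : 0 ≤ unif01.real {a | c a = ij.1 ∧ ι a = l} := measureReal_nonneg
    have h2 : (0:ℝ) ≤ (n:ℝ)⁻¹ := by positivity
    split_ifs
    · rw [mul_one]; exact ⟨h0, h1⟩
    · rw [mul_zero]; exact ⟨le_rfl, h2⟩

theorem lower {X : Type*} [MeasurableSpace X] (μ : Measure X) [IsProbabilityMeasure μ]
    {v : ℕ} (φ : (Fin v → X) → ℝ) (E : Finset (Fin v × Fin v)) (W : ℝ → ℝ → ℝ) (s : ℝ≥0∞) (C : ℝ≥0)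
    (hA : Assembled μ φ E W s C) (Q : ∀ n : ℕ, Fin n → Fin n → ℝ) (hQ : SeqOK Q W s C)
    (J : ∀ n : ℕ, Finset (Fin v → Fin n)) (hJ : ∀ n i, Function.Injective i → i ∈ J n)
    (G : Set ℝ) (hG : IsOpen G) (ν : Measure (ℝ × X)) (hν : inTM ν) (D : ℝ)
    (hent : EntL ν (unif01.prod μ) D) (hT : Tf φ E W ν ∈ G) (D' : ℝ) (hD' : D < D') :
    ∀ᶠ n : ℕ in atTop, ENNReal.ofReal (Real.exp (-(n * D'))) ≤
      (Measure.pi fun _ : Fin n => μ) {x | Tn φ E (Q n) (J n) x ∈ G} := by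
  haveI := hν.1
  have hD0 : 0 ≤ D := hent.nonneg
  obtain ⟨d, hd, hball⟩ := Metric.isOpen_iff.1 hG _ hT
  obtain ⟨k, m, c, y, R, hc, hy, hR, h1, δ, hδ, hev⟩ := hA (d / 8) (by positivity) (D' + 1) (by linarith)
  have hTR := h1 ν hν (hent.mono (by linarith))
  have hTR' : |Tf φ E W ν - R (mNu c y ν)| ≤ d / 8 := hTR
  -- uniform continuity
  have hcpt : IsCompact (Set.pi Set.univ fun _ : Fin k × Fin m => Set.Icc (0:ℝ) 1) :=
    isCompact_univ_pi fun _ => isCompact_Icc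
  obtain ⟨η, hη, hunif⟩ := Metric.uniformContinuousOn_iff.1
    (hcpt.uniformContinuousOn_of_continuous hR.continuousOn) (d / 8) (by positivity)
  obtain ⟨D1, hD1⟩ : ∃ D1, D1 = (D + D') / 2 := ⟨_, rfl⟩
  obtain ⟨D2, hD2⟩ : ∃ D2, D2 = (D + D1) / 2 := ⟨_, rfl⟩
  have hD1pos : 0 < D1 := by rw [hD1]; linarith
  have hlim : Tendsto (fun n : ℕ => D1 * (1 - ((k * m : ℕ) : ℝ) * ((n:ℝ)⁻¹ / η ^ 2))) atTop
      (nhds (D1 * (1 - ((k * m : ℕ) : ℝ) * (0 / η ^ 2)))) := by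
    refine Tendsto.const_mul _ (Tendsto.const_sub _ (Tendsto.const_mul _ (Tendsto.div_const ?_ _)))
    exact tendsto_inv_atTop_nhds_zero_nat
  have hev1 := hlim.eventually (lt_mem_nhds (a := D2) (by
    rw [zero_div, mul_zero, sub_zero, mul_one, hD2, hD1]; linarith))
  have hexpT : ∀ a : ℝ, 0 < a → ∀ b : ℝ, ∀ᶠ n : ℕ in atTop, b ≤ Real.exp ((n:ℝ) * a) := by
    intro a ha b
    have g1 : Tendsto (fun n : ℕ => Real.exp ((n:ℝ) * a)) atTop atTop :=
      Real.tendsto_exp_atTop.comp (tendsto_natCast_atTop_atTop.atTop_mul_const ha)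
    exact g1.eventually_ge_atTop b
  filter_upwards [hev, hQ δ hδ, hev1, hexpT (D2 - D) (by rw [hD2, hD1]; linarith) 2,
    hexpT (D' - D1) (by rw [hD1]; linarith) 2, eventually_ne_atTop 0] with
    n hn1 ⟨ι, i1, i2, i3, i4⟩ hn2 hn3 hn4 hn0
  obtain ⟨hbad, hiii⟩ := hn1 ι (Q n) i1 i2 i3 i4
  have hbad := hbad (J n) (hJ n)
  have hnpos : (0:ℝ) < n := by positivity
  have hcl : ∀ l, IsProbabilityMeasure (condLaw ι ν l) := condLaw_prob ι i1 i2 hn0 ν hν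
  have hRb := hiii ν hν (Measure.pi (condLaw ι ν)) inferInstance (by
    intro l j
    have := (measurePreserving_eval (condLaw ι ν) l).measure_preimage
        (s := {x | y x = j}) (hy (measurableSet_singleton _)).nullMeasurableSet
    rw [condLaw_apply ι ν l {x | y x = j} (hy (measurableSet_singleton j))] at this
    exact this)
  have hentn := condLaw_ent ι i1 i2 hn0 ν hν μ D hent
  obtain ⟨A, hA⟩ : ∃ A : Set (Fin n → X), A = {x | ∀ ij, |mX c y ι x ij -
    mBar c y ι (Measure.pi (condLaw ι ν)) ij| < η} := ⟨_, rfl⟩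
  have hmXm : ∀ ij, Measurable fun x : Fin n → X => mX c y ι x ij := by
    intro ij
    classical
    simp only [mX_eq c hc y ι i1]
    refine Finset.measurable_sum _ fun l _ => ?_
    exact ((measurable_of_countable fun j : Fin m => unif01.real {a | c a = ij.1 ∧ ι a = l} *
      (if j = ij.2 then (1:ℝ) else 0)).comp hy).comp (measurable_pi_apply l)
  have hAm : MeasurableSet A := by
    rw [hA]
    simp only [setOf_forall]
    refine MeasurableSet.iInter fun ij => ?_
    exact measurableSet_lt ((hmXm ij).sub_const _).abs measurable_const
  have hAc : (Measure.pi (condLaw ι ν)).real Aᶜ ≤ ((k * m : ℕ) : ℝ) * ((n:ℝ)⁻¹ / η ^ 2) := by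
    refine ENNReal.toReal_le_of_le_ofReal (by positivity) ?_
    have hsub : Aᶜ ⊆ ⋃ ij ∈ (Finset.univ : Finset (Fin k × Fin m)), {x | η ≤ |mX c y ι x ij -
        mBar c y ι (Measure.pi (condLaw ι ν)) ij|} := by
      intro x hx
      rw [hA] at hx
      simp only [mem_compl_iff, mem_ofPred_eq, not_forall, not_lt] at hx
      obtain ⟨ij, hij⟩ := hx
      simp only [mem_iUnion]
      exact ⟨ij, Finset.mem_univ _, hij⟩
    refine (measure_mono hsub).trans ((measure_biUnion_finset_le _ _).trans ?_)
    refine (Finset.sum_le_sum fun ij _ => mX_cheb hn0 c hc y hy ι i1 i2 _ hcl ij η hη).trans ?_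
    rw [Finset.sum_const, nsmul_eq_mul, ENNReal.ofReal_mul (by positivity), ENNReal.ofReal_natCast]
    simp
  have hAr : D2 < D1 * (Measure.pi (condLaw ι ν)).real A := by
    have h5 : (Measure.pi (condLaw ι ν)).real A = 1 - (Measure.pi (condLaw ι ν)).real Aᶜ := by
      rw [measureReal_compl hAm]; simp
    refine hn2.trans_le (mul_le_mul_of_nonneg_left ?_ hD1pos.le)
    rw [h5]; linarith
  -- entropy inequality
  have hac := hentn.ac A hAm (n * D1) (by positivity)
  obtain ⟨pA, hpA⟩ : ∃ pA, pA = (Measure.pi fun _ : Fin n => μ).real A := ⟨_, rfl⟩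
  have hpA0 : 0 ≤ pA := by rw [hpA]; exact measureReal_nonneg
  rw [← hpA] at hac
  have hpos : 0 < 1 + pA * (Real.exp (n * D1) - 1) := by
    have : 1 ≤ Real.exp (n * D1) := Real.one_le_exp (by positivity)
    have := mul_nonneg hpA0 (by linarith : 0 ≤ Real.exp (n * D1) - 1)
    linarith
  have hlog : n * (D2 - D) ≤ Real.log (1 + pA * (Real.exp (n * D1) - 1)) := by
    have := mul_le_mul_of_nonneg_left hAr.le hnpos.le
    nlinarith
  have hexp := (Real.le_log_iff_exp_le hpos).1 hlog
  have hpAge : Real.exp (-(n * D1)) ≤ pA := by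
    have h6 : 1 ≤ pA * Real.exp (n * D1) := by nlinarith
    rw [Real.exp_neg]
    rw [inv_le_iff_one_le_mul₀ (Real.exp_pos _)]
    exact h6
  -- inclusion
  have hincl : A ⊆ {x | Tn φ E (Q n) (J n) x ∈ G} ∪
      {x | d / 8 < |Tn φ E (Q n) (J n) x - R (mX c y ι x)|} := by
    intro x hx
    by_cases hx1 : d / 8 < |Tn φ E (Q n) (J n) x - R (mX c y ι x)|
    · exact Or.inr hx1
    · left
      push Not at hx1
      refine hball ?_
      rw [Metric.mem_ball, Real.dist_eq]
      rw [hA] at hx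
      have h7 : |R (mX c y ι x) - R (mBar c y ι (Measure.pi (condLaw ι ν)))| < d / 8 := by
        have := hunif (mX c y ι x) (Set.mem_univ_pi.2 fun ij => ⟨measureReal_nonneg, measureReal_le_one⟩)
          (mBar c y ι (Measure.pi (condLaw ι ν)))
          (Set.mem_univ_pi.2 fun ij => ⟨measureReal_nonneg, measureReal_le_one⟩)
          ((dist_pi_lt_iff hη).2 fun ij => by rw [Real.dist_eq]; exact hx ij)
        rwa [Real.dist_eq] at this
      rw [abs_lt] at h7 ⊢
      rw [abs_le] at hx1 hRb hTR'
      constructor <;> linarith [h7.1, h7.2, hx1.1, hx1.2, hRb.1, hRb.2, hTR'.1, hTR'.2]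
  have hfin : (Measure.pi fun _ : Fin n => μ) A ≤
      (Measure.pi fun _ : Fin n => μ) {x | Tn φ E (Q n) (J n) x ∈ G} +
        ENNReal.ofReal (Real.exp (-(n * (D' + 1)))) :=
    (measure_mono hincl).trans ((measure_union_le _ _).trans (add_le_add_right hbad _))
  have hfin2 : pA ≤ (Measure.pi fun _ : Fin n => μ).real {x | Tn φ E (Q n) (J n) x ∈ G} +
      Real.exp (-(n * (D' + 1))) := by
    have := ENNReal.toReal_mono (by simp) hfin
    rw [ENNReal.toReal_add (measure_ne_top _ _) ENNReal.ofReal_ne_top,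
      ENNReal.toReal_ofReal (Real.exp_pos _).le] at this
    rw [hpA]; exact this
  rw [← ofReal_measureReal]
  refine ENNReal.ofReal_le_ofReal ?_
  have h8 : 2 * Real.exp (-(n * D')) ≤ Real.exp (-(n * D1)) := by
    have : Real.exp (-(n * D1)) = Real.exp ((n:ℝ) * (D' - D1)) * Real.exp (-(n * D')) := by
      rw [← Real.exp_add]; congr 1; ring
    rw [this]
    exact mul_le_mul_of_nonneg_right hn4 (Real.exp_pos _).le
  have h9 : Real.exp (-(n * (D' + 1))) ≤ Real.exp (-(n * D')) := Real.exp_le_exp.2 (by linarith)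
  linarith

end LDPaux

namespace LDPaux

theorem log_exp (r : ℝ) : ENNReal.log (ENNReal.ofReal (Real.exp r)) = (r : EReal) := by
  rw [ENNReal.log_ofReal_of_pos (Real.exp_pos r), Real.log_exp]

theorem inv_mul_real (n : ℕ) (hn : n ≠ 0) (D : ℝ) :
    (((n : ℝ)⁻¹ : ℝ) : EReal) * ((-(n * D) : ℝ) : EReal) = ((-D : ℝ) : EReal) := by
  rw [← EReal.coe_mul]
  congr 1
  have : (n:ℝ) ≠ 0 := by exact_mod_cast hn
  field_simp

theorem liminf_ge (p : ℕ → ℝ≥0∞) (D : ℝ)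
    (h : ∀ᶠ n : ℕ in atTop, ENNReal.ofReal (Real.exp (-(n * D))) ≤ p n) :
    ((-D : ℝ) : EReal) ≤ Filter.atTop.liminf fun n : ℕ =>
        (((n : ℝ)⁻¹ : ℝ) : EReal) * ENNReal.log (p n) := by
  refine le_liminf_of_le (by isBoundedDefault) ?_
  filter_upwards [h, eventually_ne_atTop 0] with n hn hn0
  rw [← inv_mul_real n hn0 D, ← log_exp (-(n * D))]
  exact mul_le_mul_of_nonneg_left (ENNReal.log_monotone hn)
    (EReal.coe_nonneg.2 (by positivity))

theorem limsup_le (p : ℕ → ℝ≥0∞) (D : ℝ)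
    (h : ∀ᶠ n : ℕ in atTop, p n ≤ ENNReal.ofReal (Real.exp (-(n * D)))) :
    (Filter.atTop.limsup fun n : ℕ =>
        (((n : ℝ)⁻¹ : ℝ) : EReal) * ENNReal.log (p n)) ≤ ((-D : ℝ) : EReal) := by
  refine limsup_le_of_le (by isBoundedDefault) ?_
  filter_upwards [h, eventually_ne_atTop 0] with n hn hn0
  rw [← inv_mul_real n hn0 D, ← log_exp (-(n * D))]
  exact mul_le_mul_of_nonneg_left (ENNReal.log_monotone hn)
    (EReal.coe_nonneg.2 (by positivity))

theorem ldp {X : Type*} [MeasurableSpace X] (μ : Measure X) [IsProbabilityMeasure μ]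
    {v : ℕ} (φ : (Fin v → X) → ℝ) (E : Finset (Fin v × Fin v)) (W : ℝ → ℝ → ℝ) (s : ℝ≥0∞) (C : ℝ≥0)
    (hA : Assembled μ φ E W s C) (Q : ∀ n : ℕ, Fin n → Fin n → ℝ) (hQ : SeqOK Q W s C)
    (J : ∀ n : ℕ, Finset (Fin v → Fin n)) (hJ : ∀ n i, Function.Injective i → i ∈ J n) :
    SatisfiesLDP (fun n => Measure.pi fun _ : Fin n => μ)
      (fun n x => Tn φ E (Q n) (J n) x) (Irate μ φ E W) := by
  refine ⟨fun c hc => good μ φ E W s C hA c hc, fun F _ => ⟨?_, ?_⟩⟩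
  · rw [EReal.neg_le]
    refine le_iInf₂ fun t ht => ?_
    rw [← EReal.le_of_forall_lt_iff_le]
    intro D' hD'
    rw [EReal.neg_le]
    have hlt : Irate μ φ E W t ≠ ⊤ := by
      intro h
      rw [h] at hD'
      exact absurd hD' (by simp)
    obtain ⟨D, hD1, hD2⟩ := EReal.lt_iff_exists_real_btwn.1 hD'
    have hD0 : 0 < D := by
      have : (0:EReal) ≤ (Irate μ φ E W t : EReal) := EReal.coe_ennreal_nonneg _
      exact_mod_cast this.trans_lt hD1
    have hI : Irate μ φ E W t < ENNReal.ofReal D := by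
      rw [← EReal.coe_ennreal_lt_coe_ennreal_iff, EReal.coe_ennreal_ofReal, max_eq_left hD0.le]
      exact hD1
    obtain ⟨ν, h1, h2, h3⟩ := Irate_lt μ φ E W t D hD0.le hI
    have := liminf_ge _ D' (lower μ φ E W s C hA Q hQ J hJ (interior F) isOpen_interior ν h1 D h2
      (by rw [h3]; exact ht) D' (by exact_mod_cast hD2))
    rw [← EReal.coe_neg]
    refine this.trans (liminf_le_liminf ?_ (by isBoundedDefault) (by isBoundedDefault))
    refine Eventually.of_forall fun n => ?_
    exact mul_le_mul_of_nonneg_left (ENNReal.log_monotone (measure_mono (fun x hx => interior_subset (s := F) hx)))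
      (EReal.coe_nonneg.2 (by positivity))
  · rw [EReal.le_neg]
    rw [← EReal.ge_of_forall_gt_iff_ge]
    intro b' hb'
    rw [EReal.le_neg, ← EReal.coe_neg]
    by_cases hneg : b' < 0
    · refine limsup_le _ b' (Eventually.of_forall fun n => ?_)
      refine prob_le_one.trans ?_
      rw [← ENNReal.ofReal_one]
      refine ENNReal.ofReal_le_ofReal (Real.one_le_exp ?_)
      have : (0:ℝ) ≤ n := by positivity
      nlinarith
    · push Not at hneg
      obtain ⟨b, hb1, hb2⟩ := EReal.lt_iff_exists_real_btwn.1 hb'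
      have hb1' : b' < b := by exact_mod_cast hb1
      refine limsup_le _ b' ?_
      have := upper μ φ E W s C hA Q hQ J hJ (closure F) isClosed_closure b (by linarith) (by
        intro t ht hcon
        have h1 : (b : EReal) < (Irate μ φ E W t : EReal) := hb2.trans_le (iInf₂_le t ht)
        rw [← EReal.coe_ennreal_le_coe_ennreal_iff, EReal.coe_ennreal_ofReal,
          max_eq_left (by linarith : (0:ℝ) ≤ b)] at hcon
        exact absurd h1 (not_lt.2 hcon)) b' hb1'
      filter_upwards [this] with n hn
      refine le_trans (measure_mono ?_) hn
      intro x hx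
      exact subset_closure (s := F) hx

end LDPaux

namespace LDPaux

/-- index of the step containing `x`. -/
noncomputable def idx (n : ℕ) (hn : 0 < n) (x : ℝ) : Fin n :=
  ⟨min (⌈(n:ℝ) * x⌉₊ - 1) (n - 1), by omega⟩

theorem idx_meas (n : ℕ) (hn : 0 < n) : Measurable (idx n hn) := by
  have h : Measurable fun x : ℝ => ⌈(n:ℝ) * x⌉₊ := Nat.measurable_ceil.comp (by fun_prop)
  exact (measurable_of_countable (fun m : ℕ => (⟨min (m - 1) (n - 1), by omega⟩ : Fin n))).comp h

theorem idx_iff (n : ℕ) (hn : 0 < n) (x : ℝ) (hx : x ∈ Ioc (0:ℝ) 1) (l : Fin n) :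
    x ∈ Ioc (((l : ℕ) : ℝ)/n) ((((l : ℕ) : ℝ)+1)/n) ↔ idx n hn x = l := by
  have hn' : (0:ℝ) < n := by exact_mod_cast hn
  have h1 : x ∈ Ioc (((l : ℕ) : ℝ)/n) ((((l : ℕ) : ℝ)+1)/n) ↔ ⌈(n:ℝ) * x⌉₊ = (l:ℕ) + 1 := by
    rw [Nat.ceil_eq_iff (by omega), mem_Ioc, div_lt_iff₀ hn', le_div_iff₀ hn', mul_comm]
    simp
  have h2 : 0 < ⌈(n:ℝ) * x⌉₊ := Nat.ceil_pos.2 (mul_pos hn' hx.1)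
  have h3 : ⌈(n:ℝ) * x⌉₊ ≤ n := by
    rw [Nat.ceil_le]; nlinarith [hx.2]
  rw [h1, Fin.ext_iff]
  have := l.2
  simp only [idx]
  omega

theorem unif01_Ioc : unif01 = volume.restrict (Ioc (0:ℝ) 1) := by
  unfold unif01; exact (Measure.restrict_congr_set Ioc_ae_eq_Icc).symm

theorem idx_unif (n : ℕ) (hn : 0 < n) (l : Fin n) :
    unif01 {a | idx n hn a = l} = (n : ℝ≥0∞)⁻¹ := by
  have hn' : (0:ℝ) < n := by exact_mod_cast hn
  have hm : MeasurableSet {a | idx n hn a = l} := idx_meas n hn (measurableSet_singleton l)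
  rw [unif01_Ioc, Measure.restrict_apply hm]
  have : {a | idx n hn a = l} ∩ Ioc (0:ℝ) 1 = Ioc (((l : ℕ) : ℝ)/n) ((((l : ℕ) : ℝ)+1)/n) := by
    ext x
    constructor
    · rintro ⟨h1, h2⟩
      exact (idx_iff n hn x h2 l).2 h1
    · intro h
      have hx : x ∈ Ioc (0:ℝ) 1 := by
        refine ⟨lt_of_le_of_lt (by positivity) h.1, h.2.trans ?_⟩
        rw [div_le_one hn']
        exact_mod_cast l.2
      exact ⟨(idx_iff n hn x hx l).1 h, hx⟩
  rw [this, Real.volume_Ioc, ← sub_div, add_sub_cancel_left, one_div,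
    ENNReal.ofReal_inv_of_pos hn', ENNReal.ofReal_natCast]

theorem step_eq (n : ℕ) (hn : 0 < n) (Q : Fin n → Fin n → ℝ) (x y : ℝ) (hx : x ∈ Ioc (0:ℝ) 1)
    (hy : y ∈ Ioc (0:ℝ) 1) : stepKernel n Q x y = Q (idx n hn x) (idx n hn y) := by
  unfold stepKernel
  simp only [idx_iff n hn x hx, idx_iff n hn y hy, ite_and]
  simp

theorem step_ae (n : ℕ) (hn : 0 < n) (Q : Fin n → Fin n → ℝ) :
    (fun z : ℝ × ℝ => stepKernel n Q z.1 z.2) =ᵐ[unif01.prod unif01]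
      fun z => Q (idx n hn z.1) (idx n hn z.2) := by
  have h0 : ∀ᵐ x ∂unif01, x ∈ Ioc (0:ℝ) 1 := by
    rw [unif01_Ioc]; exact ae_restrict_mem measurableSet_Ioc
  have h1 : ∀ᵐ z ∂(unif01.prod unif01), z.1 ∈ Ioc (0:ℝ) 1 :=
    (Measure.quasiMeasurePreserving_fst (μ := unif01) (ν := unif01)).ae h0
  have h2 : ∀ᵐ z ∂(unif01.prod unif01), z.2 ∈ Ioc (0:ℝ) 1 :=
    (Measure.quasiMeasurePreserving_snd (μ := unif01) (ν := unif01)).ae h0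
  filter_upwards [h1, h2] with z a b
  exact step_eq n hn Q z.1 z.2 a b

theorem mpb_id : MPB id := ⟨bijOn_id _, MeasurePreserving.id _⟩

theorem step_meas (n : ℕ) (Q : Fin n → Fin n → ℝ) :
    Measurable (Function.uncurry (stepKernel n Q)) := by
  unfold stepKernel Function.uncurry
  refine Finset.measurable_sum _ fun i _ => Finset.measurable_sum _ fun j _ => ?_
  refine Measurable.ite ?_ measurable_const measurable_const
  exact (measurableSet_Ioc.preimage measurable_fst).inter (measurableSet_Ioc.preimage measurable_snd)

/-- The terms in the cut distance. -/
theorem cut_term (w : ℝ → ℝ → ℝ) (hw : Integrable (Function.uncurry w) (unif01.prod unif01))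
    (S T : Set ℝ) (hS : MeasurableSet S) (hT : MeasurableSet T) :
    ∫ z, S.indicator (fun _ => (1:ℝ)) z.1 * T.indicator (fun _ => (1:ℝ)) z.2 * w z.1 z.2
      ∂(unif01.prod unif01) =
    ∫ x in Icc (0:ℝ) 1 ∩ S, ∫ y in Icc (0:ℝ) 1 ∩ T, w x y := by
  have e : ∀ A : Set ℝ, MeasurableSet A → volume.restrict (Icc (0:ℝ) 1 ∩ A) = unif01.restrict A := by
    intro A hA
    rw [unif01, Measure.restrict_restrict hA, inter_comm]
  rw [e S hS, e T hT, ← integral_prod (fun z : ℝ × ℝ => w z.1 z.2), Measure.prod_restrict,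
    ← integral_indicator (hS.prod hT)]
  · refine integral_congr_ae (Eventually.of_forall fun z => ?_)
    by_cases h1 : z.1 ∈ S <;> by_cases h2 : z.2 ∈ T <;> simp [indicator, h1, h2]
  · rw [Measure.prod_restrict]
    exact hw.restrict

theorem cutB_of_cutDist (w₁ w₂ : ℝ → ℝ → ℝ) (δ : ℝ)
    (hw : Integrable (Function.uncurry fun x y => w₁ x y - w₂ x y) (unif01.prod unif01))
    (h : cutDist w₁ w₂ ≤ δ) : CutB (fun x y => w₁ x y - w₂ x y) δ := by
  intro S T hS hT
  have hb : ∀ S T : Set ℝ, MeasurableSet S → MeasurableSet T →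
      |∫ x in Icc (0:ℝ) 1 ∩ S, ∫ y in Icc (0:ℝ) 1 ∩ T, (w₁ x y - w₂ x y)| ≤
        ∫ z, |w₁ z.1 z.2 - w₂ z.1 z.2| ∂(unif01.prod unif01) := by
    intro S T hS hT
    rw [← cut_term _ hw S T hS hT]
    refine (abs_integral_le_integral_abs).trans ?_
    refine integral_mono_of_nonneg (Eventually.of_forall fun _ => abs_nonneg _) hw.abs
      (Eventually.of_forall fun z => ?_)
    by_cases h1 : z.1 ∈ S <;> by_cases h2 : z.2 ∈ T <;> simp [indicator, h1, h2, Function.uncurry]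
  rw [cut_term _ hw S T hS hT]
  refine le_trans ?_ h
  unfold cutDist
  have b1 : ∀ S : {S : Set ℝ // MeasurableSet S}, BddAbove (range fun T : {T : Set ℝ // MeasurableSet T} =>
      |∫ x in Set.Icc (0:ℝ) 1 ∩ S.1, ∫ y in Set.Icc (0:ℝ) 1 ∩ T.1, (w₁ x y - w₂ x y)|) := by
    intro S
    refine ⟨∫ z, |w₁ z.1 z.2 - w₂ z.1 z.2| ∂(unif01.prod unif01), ?_⟩
    rintro _ ⟨T, rfl⟩
    exact hb S.1 T.1 S.2 T.2
  haveI : Nonempty {T : Set ℝ // MeasurableSet T} := ⟨⟨∅, MeasurableSet.empty⟩⟩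
  have b2 : BddAbove (range fun S : {S : Set ℝ // MeasurableSet S} =>
      ⨆ T : {T : Set ℝ // MeasurableSet T},
      |∫ x in Set.Icc (0:ℝ) 1 ∩ S.1, ∫ y in Set.Icc (0:ℝ) 1 ∩ T.1, (w₁ x y - w₂ x y)|) := by
    refine ⟨∫ z, |w₁ z.1 z.2 - w₂ z.1 z.2| ∂(unif01.prod unif01), ?_⟩
    rintro _ ⟨S, rfl⟩
    exact ciSup_le fun T => hb S.1 T.1 S.2 T.2
  exact (le_ciSup (b1 ⟨S, hS⟩) ⟨T, hT⟩).trans (le_ciSup b2 ⟨S, hS⟩)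

theorem kerNorm_comp (w : ℝ → ℝ → ℝ) (hw : Measurable (Function.uncurry w)) (s : ℝ≥0∞) (σ : ℝ → ℝ)
    (hσ : MeasurePreserving σ unif01 unif01) :
    kerNorm (fun x y => w (σ x) (σ y)) s = kerNorm w s := by
  have hm : AEStronglyMeasurable (Function.uncurry w) (unif01.prod unif01) := hw.aestronglyMeasurable
  have h2 : MeasurePreserving (Prod.map σ σ) (unif01.prod unif01) (unif01.prod unif01) := hσ.prod hσ
  have h := eLpNorm_comp_measurePreserving (p := s) hm h2
  exact h

theorem meas_comp (w : ℝ → ℝ → ℝ) (hw : Measurable (Function.uncurry w)) (σ : ℝ → ℝ)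
    (hσ : Measurable σ) : Measurable (Function.uncurry fun x y => w (σ x) (σ y)) :=
  hw.comp (hσ.prodMap hσ)

theorem seqOK (Q : ∀ n : ℕ, Fin n → Fin n → ℝ) (W : ℝ → ℝ → ℝ) (hW : Measurable (Function.uncurry W))
    (hW1 : kerNorm W 1 ≠ ⊤) (s : ℝ≥0∞) (hs : 1 ≤ s) (C : ℝ≥0)
    (hcut : Tendsto (fun n => weakCutDist (stepKernel n (Q n)) W) atTop (nhds 0))
    (hC : ∀ᶠ n in atTop, kerNorm (stepKernel n (Q n)) s ≤ C) : SeqOK Q W s C := by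
  intro δ hδ
  filter_upwards [hC, hcut.eventually (gt_mem_nhds hδ), eventually_gt_atTop 0] with n h1 h2 hn
  haveI : Nonempty {σ : ℝ → ℝ // MPB σ} := ⟨⟨id, mpb_id⟩⟩
  obtain ⟨⟨σ, hσb, hσ⟩, h3⟩ := exists_lt_of_ciInf_lt h2
  simp only at h3
  have hσ2 : MeasurePreserving (Prod.map σ σ) (unif01.prod unif01) (unif01.prod unif01) := hσ.prod hσ
  have hae : (fun z : ℝ × ℝ => stepKernel n (Q n) (σ z.1) (σ z.2)) =ᵐ[unif01.prod unif01]
      fun z => Q n (idx n hn (σ z.1)) (idx n hn (σ z.2)) :=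
    hσ2.quasiMeasurePreserving.ae (step_ae n hn (Q n))
  have hst := step_meas n (Q n)
  have hk : kerNorm (fun x y => stepKernel n (Q n) (σ x) (σ y)) s = kerNorm (stepKernel n (Q n)) s := by
    exact kerNorm_comp _ hst s σ hσ
  have hmσ : Measurable (Function.uncurry fun x y => stepKernel n (Q n) (σ x) (σ y)) :=
    meas_comp _ hst σ hσ.measurable
  have hi : Integrable (Function.uncurry fun x y => stepKernel n (Q n) (σ x) (σ y))
      (unif01.prod unif01) := by
    refine ker_integrable _ hmσ hs ?_
    rw [hk]
    exact (h1.trans_lt ENNReal.coe_lt_top).ne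
  have hWi := ker_integrable W hW le_rfl hW1
  refine ⟨fun x => idx n hn (σ x), (idx_meas n hn).comp hσ.measurable, ?_, ?_, ?_⟩
  · intro l
    have hm : MeasurableSet {a | idx n hn a = l} := idx_meas n hn (measurableSet_singleton l)
    rw [← idx_unif n hn l]
    exact hσ.measure_preimage hm.nullMeasurableSet
  · refine le_trans (le_of_eq ?_) h1
    rw [← hk]
    exact (eLpNorm_congr_ae hae).symm
  · have := cutB_of_cutDist (fun x y => stepKernel n (Q n) (σ x) (σ y)) W δ (hi.sub hWi) h3.le
    intro S T hS hT
    refine le_trans (le_of_eq ?_) (this S T hS hT)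
    congr 1
    refine integral_congr_ae ?_
    filter_upwards [hae] with z hz
    rw [hz]

theorem seqOK_zero (s : ℝ≥0∞) : SeqOK (fun _ _ _ => 0) (fun _ _ => 0) s 0 := by
  intro δ hδ
  filter_upwards [eventually_gt_atTop 0] with n hn
  refine ⟨idx n hn, idx_meas n hn, idx_unif n hn, ?_, ?_⟩
  · simp [kerNorm]
  · intro S T hS hT
    simp [hδ.le]

theorem core.{u} {X : Type u} [MeasurableSpace X] (μ : Measure X) [IsProbabilityMeasure μ]
    {v : ℕ} (hv : 1 ≤ v) (φ : (Fin v → X) → ℝ) (hφ : Measurable φ) (Ψ : X → ℝ) (hΨ : Measurable Ψ)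
    (hΨ0 : ∀ x, 0 ≤ Ψ x) (p q : ℝ≥0∞) (hpq : p⁻¹ + q⁻¹ = 1) (hq : 1 ≤ q) (hp0 : 1 ≤ p) (hp : p ≠ ⊤)
    (hdom : ∀ x, |φ x| ^ p.toReal ≤ ∏ a, Ψ (x a))
    (hexp : ∀ t : ℝ, 0 < t → ∫⁻ x, ENNReal.ofReal (Real.exp (t * Ψ x)) ∂μ < ⊤)
    (E : Finset (Fin v × Fin v)) (d : ℕ) (hd : 1 ≤ d) (hE : Deg E d) (C : ℝ≥0)
    (W : ℝ → ℝ → ℝ) (hW : Measurable (Function.uncurry W)) (hW1 : kerNorm W 1 ≠ ⊤)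
    (Q : ∀ n : ℕ, Fin n → Fin n → ℝ) (hQ : SeqOK Q W (q * d) C)
    (J : ∀ n : ℕ, Finset (Fin v → Fin n)) (hJ : ∀ n i, Function.Injective i → i ∈ J n) :
    SatisfiesLDP (fun n => Measure.pi fun _ : Fin n => μ)
      (fun n x => Tn φ E (Q n) (J n) x) (Irate μ φ E W) := by
  have hs : 1 ≤ q * (d : ℝ≥0∞) := one_le_qd hq hd
  have h0 : ∀ j : ℕ, ∃ w : ℝ → ℝ → ℝ, Measurable (Function.uncurry w) ∧ kerNorm w (q * d) ≤ C ∧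
      CutB (fun x y => w x y - W x y) (1 / ((j:ℝ) + 1)) := by
    intro j
    obtain ⟨n, ι, h1, h2, h3, h4⟩ := (hQ (1 / ((j:ℝ) + 1)) Nat.one_div_pos_of_nat).exists
    exact ⟨fun x y => Q n (ι x) (ι y), meas_ker ι h1 (Q n), h3, h4⟩
  choose w hw hws hcut using h0
  have hcut' : ∀ δ > 0, ∀ᶠ n in atTop, CutB (fun x y => w n x y - W x y) δ := by
    intro δ hδ
    filter_upwards [(tendsto_one_div_add_atTop_nhds_zero_nat (𝕜 := ℝ)).eventually (gt_mem_nhds hδ)]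
      with n hn
    exact (hcut n).mono hn.le
  refine ldp μ φ E W (q * d) C ?_ Q hQ J hJ
  refine assemble μ hv φ hφ Ψ hΨ hΨ0 p q hpq hq hp0 hp hdom hexp E d hd hE C W hW ?_ ?_
  · exact norm_limit W hW hW1 _ hs C ENNReal.coe_ne_top w hw (Eventually.of_forall hws) hcut'
  · intro ε hε
    exact norm_approx W hW hW1 _ hs C ENNReal.coe_ne_top w hw (Eventually.of_forall hws) hcut' ε hε

end LDPaux

namespace LDPaux

theorem exp_tail {X : Type*} [MeasurableSpace X] (μ : Measure X) [IsProbabilityMeasure μ]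
    (ψ : X → ℝ) (hψpos : ∀ x, 0 ≤ ψ x) (p p' : ℝ≥0∞) (hp' : p' ≤ p) (hp't : p' ≠ ⊤)
    (hT : TailCond μ ψ p) (t : ℝ) (ht : 0 < t) :
    ∫⁻ x, ENNReal.ofReal (Real.exp (t * ψ x ^ p'.toReal)) ∂μ < ⊤ := by
  unfold TailCond at hT
  split_ifs at hT with h
  · obtain ⟨C, hC⟩ := hT
    refine lt_of_le_of_lt (lintegral_mono (g := fun _ => ENNReal.ofReal (Real.exp (t * C ^ p'.toReal)))
      fun x => ?_) ?_
    · refine ENNReal.ofReal_le_ofReal (Real.exp_le_exp.2 ?_)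
      exact mul_le_mul_of_nonneg_left
        (Real.rpow_le_rpow (hψpos x) (hC x) ENNReal.toReal_nonneg) ht.le
    · simp
  · refine lt_of_le_of_lt (lintegral_mono (g := fun x => ENNReal.ofReal (Real.exp t) *
      ENNReal.ofReal (Real.exp (t * ψ x ^ p.toReal))) fun x => ?_) ?_
    · simp only
      rw [← ENNReal.ofReal_mul (Real.exp_pos _).le, ← Real.exp_add]
      refine ENNReal.ofReal_le_ofReal (Real.exp_le_exp.2 ?_)
      have hr : p'.toReal ≤ p.toReal := ENNReal.toReal_mono h hp'
      have : ψ x ^ p'.toReal ≤ 1 + ψ x ^ p.toReal := by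
        rcases le_total (ψ x) 1 with h1 | h1
        · have := Real.rpow_le_one (hψpos x) h1 (z := p'.toReal) ENNReal.toReal_nonneg
          have := Real.rpow_nonneg (hψpos x) p.toReal
          linarith
        · have := Real.rpow_le_rpow_of_exponent_le h1 hr
          linarith
      nlinarith
    · rw [lintegral_const_mul' _ _ ENNReal.ofReal_ne_top]
      exact ENNReal.mul_lt_top ENNReal.ofReal_lt_top (hT t ht)

theorem deg_max {v : ℕ} (G : SimpleGraph (Fin v)) [DecidableRel G.Adj] :
    Deg (Finset.univ.filter (fun p : Fin v × Fin v => G.Adj p.1 p.2 ∧ p.1 < p.2)) G.maxDegree := by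
  refine ⟨fun a => ?_, fun e he => (Finset.mem_filter.1 he).2.2⟩
  refine le_trans ?_ (G.degree_le_maxDegree a)
  rw [← SimpleGraph.card_neighborFinset_eq_degree]
  refine Finset.card_le_card_of_injOn (fun e => if e.1 = a then e.2 else e.1) ?_ ?_
  · intro e he
    simp only [Finset.coe_filter, Finset.mem_filter, Finset.mem_univ, true_and] at he
    obtain ⟨⟨h1, h2⟩, h3⟩ := he
    simp only [SimpleGraph.coe_neighborFinset, SimpleGraph.mem_neighborSet]
    split_ifs with h
    · rw [← h]; exact h1
    · rcases h3 with h3 | h3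
      · exact absurd h3.symm h
      · rw [h3]; exact h1.symm
  · intro e he f hf hef
    simp only [Finset.coe_filter, Finset.mem_filter, Finset.mem_univ, true_and] at he hf
    obtain ⟨⟨h1, h2⟩, h3⟩ := he
    obtain ⟨⟨k1, k2⟩, k3⟩ := hf
    obtain ⟨e1, e2⟩ := e
    obtain ⟨f1, f2⟩ := f
    simp only at *
    split_ifs at hef <;> simp only [Prod.mk.injEq] <;> grind

theorem main_aux {X : Type*} [MeasurableSpace X]
    (μ : Measure X) [IsProbabilityMeasure μ]
    {v : ℕ} (hv : 2 ≤ v) (G : SimpleGraph (Fin v)) [DecidableRel G.Adj]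
    (φ : (Fin v → X) → ℝ) (hφ : Measurable φ)
    (Q : ∀ n : ℕ, Fin n → Fin n → ℝ)
    (W : ℝ → ℝ → ℝ) (hWmeas : Measurable (Function.uncurry W))
    (hWL1 : kerNorm W 1 ≠ ⊤)
    (hcut : Tendsto (fun n => weakCutDist (stepKernel n (Q n)) W) atTop (nhds 0))
    (ψ : X → ℝ) (hψmeas : Measurable ψ) (hψpos : ∀ x, 0 ≤ ψ x)
    (p : ℝ≥0∞) (hTail : TailCond μ ψ p)
    (hdom : ∀ y : Fin v → X, |φ y| ≤ ∏ a, ψ (y a))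
    (q : ℝ≥0∞) (hq : 1 < q) (hpq : p⁻¹ + q⁻¹ ≤ 1)
    (hnorm : Filter.atTop.limsup
        (fun n => kerNorm (stepKernel n (Q n)) (q * (G.maxDegree : ℝ≥0∞))) ≠ ⊤)
    (E : Finset (Fin v × Fin v))
    (hE : E = Finset.univ.filter (fun p : Fin v × Fin v => G.Adj p.1 p.2 ∧ p.1 < p.2))
    (J : ∀ n : ℕ, Finset (Fin v → Fin n)) (hJ : ∀ n i, Function.Injective i → i ∈ J n) :
    SatisfiesLDP (fun n => Measure.pi fun _ : Fin n => μ)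
      (fun n x => Tn φ E (Q n) (J n) x) (Irate μ φ E W) := by
  have hq1 : q⁻¹ < 1 := ENNReal.inv_lt_one.2 hq
  have hq1' : q⁻¹ ≠ ⊤ := (hq1.trans ENNReal.one_lt_top).ne
  set p' : ℝ≥0∞ := (1 - q⁻¹)⁻¹ with hp'
  have hp't : p' ≠ ⊤ := by
    rw [hp', Ne, ENNReal.inv_eq_top]
    exact (tsub_pos_of_lt hq1).ne'
  have hpq' : p'⁻¹ + q⁻¹ = 1 := by rw [hp', inv_inv]; exact tsub_add_cancel_of_le hq1.le
  have hp1 : 1 ≤ p' := by rw [hp', ENNReal.one_le_inv]; exact tsub_le_self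
  have hp'p : p' ≤ p := by
    rw [hp', ENNReal.inv_le_iff_inv_le]
    exact ENNReal.le_sub_of_add_le_right hq1' hpq
  have hr : 0 ≤ p'.toReal := ENNReal.toReal_nonneg
  have hd : Deg E G.maxDegree := hE ▸ deg_max G
  have key := fun (d : ℕ) (hd1 : 1 ≤ d) (hd : Deg E d) (C : ℝ≥0) (W : ℝ → ℝ → ℝ)
    (hW : Measurable (Function.uncurry W)) (hW1 : kerNorm W 1 ≠ ⊤)
    (Q : ∀ n : ℕ, Fin n → Fin n → ℝ) (hQ : SeqOK Q W (q * d) C) =>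
    core μ (by omega) φ hφ (fun x => ψ x ^ p'.toReal) (hψmeas.pow_const _)
    (fun x => Real.rpow_nonneg (hψpos x) _) p' q hpq' hq.le hp1 hp't
    (fun x => by
      rw [Real.finset_prod_rpow _ _ fun i _ => hψpos _]
      exact Real.rpow_le_rpow (abs_nonneg _) (hdom x) hr)
    (fun t ht => exp_tail μ ψ hψpos p p' hp'p hp't hTail t ht) E d hd1 hd C W hW hW1 Q hQ J hJ
  rcases Nat.eq_zero_or_pos G.maxDegree with h0 | h0
  · have hE0 : E = ∅ := by
      rw [Finset.eq_empty_iff_forall_notMem]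
      intro e he
      have := hd.1 e.1
      rw [h0, Nat.le_zero, Finset.card_eq_zero] at this
      have h2 : e ∈ E.filter (fun f => e.1 = f.1 ∨ e.1 = f.2) := Finset.mem_filter.2 ⟨he, Or.inl rfl⟩
      rw [this] at h2
      simp at h2
    have := key 1 le_rfl ⟨fun a => (hd.1 a).trans (by omega), hd.2⟩ 0 (fun _ _ => 0)
      measurable_const (by simp [kerNorm]) (fun _ _ _ => 0) (seqOK_zero _)
    subst hE0
    have hI : Irate μ φ ∅ W = Irate μ φ ∅ (fun _ _ => 0) := by
      funext t; simp [Irate, Tf]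
    rw [hI]
    simpa [Tn] using this
  · obtain ⟨c, hc1, hc2⟩ := exists_between hnorm.lt_top
    lift c to ℝ≥0 using hc2.ne
    have hC := (Filter.eventually_lt_of_limsup_lt hc1).mono fun n h => h.le
    exact key G.maxDegree h0 hd c W hWmeas hWL1 Q
      (seqOK Q W hWmeas hWL1 _ (one_le_qd hq.le h0) c hcut hC)

theorem rate_eq {X : Type*} [MeasurableSpace X] {v : ℕ} (G : SimpleGraph (Fin v))
    [DecidableRel G.Adj] (W : ℝ → ℝ → ℝ) (φ : (Fin v → X) → ℝ) (μ : Measure X) :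
    rate0 G W φ μ = Irate μ φ
      (Finset.univ.filter (fun p : Fin v × Fin v => G.Adj p.1 p.2 ∧ p.1 < p.2)) W := by
  funext t
  unfold rate0 Irate
  rw [iInf_subtype]
  refine iInf_congr fun ν => ?_
  refine iInf_congr_Prop ?_ fun _ => rfl
  refine and_congr_right fun h => and_congr_right fun _ => ?_
  haveI := h.1
  have : probOr ν = ν := by unfold probOr; rw [if_pos h.1]
  unfold TWphi Tf piProb edgeProd
  simp only [this]

end LDPaux

/-- Theorem 1.1, LDP for inhomogeneous U/V-statistics. -/
theorem ldp_inhomogeneous_U_V_statistics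
    {X : Type*} [MeasurableSpace X] [TopologicalSpace X] [PolishSpace X] [BorelSpace X]
    (μ : Measure X) [IsProbabilityMeasure μ]
    (hnondeg : ∀ x : X, μ ≠ Measure.dirac x)
    {v : ℕ} (hv : 2 ≤ v) (G : SimpleGraph (Fin v)) [DecidableRel G.Adj]
    (φ : (Fin v → X) → ℝ) (hφ : Measurable φ)
    (Q : ∀ n : ℕ, Fin n → Fin n → ℝ)
    (hQsymm : ∀ n i j, Q n i j = Q n j i) (hQzero : ∀ n i, Q n i i = 0)
    (W : ℝ → ℝ → ℝ) (hWmeas : Measurable (Function.uncurry W))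
    (hWsymm : ∀ x y, W x y = W y x) (hWL1 : kerNorm W 1 ≠ ⊤)
    (hcut : Tendsto (fun n => weakCutDist (stepKernel n (Q n)) W) atTop (nhds 0))
    (ψ : X → ℝ) (hψmeas : Measurable ψ) (hψpos : ∀ x, 0 ≤ ψ x)
    (p : ℝ≥0∞) (hp : 1 ≤ p) (hTail : TailCond μ ψ p)
    (hdom : ∀ y : Fin v → X, |φ y| ≤ ∏ a, ψ (y a))
    (q : ℝ≥0∞) (hq : 1 < q) (hpq : p⁻¹ + q⁻¹ ≤ 1)
    (hnorm : Filter.atTop.limsup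
        (fun n => kerNorm (stepKernel n (Q n)) (q * (G.maxDegree : ℝ≥0∞))) ≠ ⊤) :
    SatisfiesLDP (fun n => Measure.pi fun _ : Fin n => μ)
      (fun n x => Ustat G φ n (Q n) x) (rate0 G W φ μ) ∧
    SatisfiesLDP (fun n => Measure.pi fun _ : Fin n => μ)
      (fun n x => Vstat G φ n (Q n) x) (rate0 G W φ μ) := by
  constructor
  · rw [LDPaux.rate_eq]
    exact LDPaux.main_aux μ hv G φ hφ Q W hWmeas hWL1 hcut ψ hψmeas hψpos p hTail hdom q hq hpq hnorm
      _ rfl (fun n => Finset.univ.filter (fun i : Fin v → Fin n => Function.Injective i))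
      (fun n i hi => Finset.mem_filter.2 ⟨Finset.mem_univ _, hi⟩)
  · rw [LDPaux.rate_eq]
    exact LDPaux.main_aux μ hv G φ hφ Q W hWmeas hWL1 hcut ψ hψmeas hψpos p hTail hdom q hq hpq hnorm
      _ rfl (fun n => Finset.univ) (fun n i hi => Finset.mem_univ _)
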